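/- Monien's hierarchy theorem: for every k ≥ 1, the class co2NFA(k) is a strict subset of co2NFA(k+1); that is, co2NFA(k) ⊆ co2NFA(k+1) and there exists a language L ⊆ {0,1}^* accepted by some two-way (k+1)-head automaton but not by any two-way k-head automaton. -/

import Mathlib

/-- A two-way multihead finite automaton with `k` heads over `Σ = {0,1}`: a finite set
of states `Fin n` with distinguished states `init`, `accept`, `reject`, and a transition
relation. Symbols of the extended alphabet `Σ⋆ = {0,1,⋆}` are encoded as `Option Bool`
(`none` being the end-marker `⋆`); directions are encoded as `Bool` (`true` = right,
i.e. `+1`; `false` = left, i.e. `−1`). -/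
structure TwoWayAutomaton (k : ℕ) where
  n : ℕ
  init : Fin n
  accept : Fin n
  reject : Fin n
  trans : Set (((Fin k → Option Bool) × Fin n) × ((Fin k × Bool) × Fin n))

/-- The symbol at position `p` of the cyclic presentation of the word `w`, with positions
in `ℤ/(|w|+1)ℤ`: the end-marker `⋆` at position `0`, and the `p`-th letter of `w` at
positions `1 ≤ p ≤ |w|`. -/
def symbolAt (w : List Bool) (p : ZMod (w.length + 1)) : Option Bool :=
  if p.val = 0 then none else some (w.getD (p.val - 1) false)

/-- One computation step on input `w`: a configuration is a pair of a tuple of head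
positions and a state; an enabled transition (all heads read the required symbols)
moves one head one position in the given direction and changes the state. -/
def Step {k : ℕ} (M : TwoWayAutomaton k) (w : List Bool)
    (c c' : (Fin k → ZMod (w.length + 1)) × Fin M.n) : Prop :=
  ∃ (s : Fin k → Option Bool) (i : Fin k) (d : Bool) (q' : Fin M.n),
    ((s, c.2), ((i, d), q')) ∈ M.trans ∧
    (∀ j, symbolAt w (c.1 j) = s j) ∧
    c' = (Function.update c.1 i (c.1 i + if d then 1 else -1), q')

/-- `M` accepts `w` iff no run on `w` (finite sequence of steps starting from all heads
at position `0` in state `init`) reaches a configuration whose state is `reject`. -/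
def Accepts {k : ℕ} (M : TwoWayAutomaton k) (w : List Bool) : Prop :=
  ¬ ∃ c : (Fin k → ZMod (w.length + 1)) × Fin M.n,
      Relation.ReflTransGen (Step M w) (fun _ => 0, M.init) c ∧ c.2 = M.reject

/-- The class of languages accepted by some two-way `k`-head automaton. -/
def co2NFA (k : ℕ) : Set (Set (List Bool)) :=
  {L | ∃ M : TwoWayAutomaton k, ∀ w, w ∈ L ↔ Accepts M w}

/-- Families of binary relations on `A`, indexed by inputs. -/
abbrev Fam (W A : Type) := W → A → A → Prop

/-- The families definable from the primitive ones in `P` by regular operations. -/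
inductive Prog {W A : Type} (P : Fam W A → Prop) : Fam W A → Prop
  | base {R} : P R → Prog P R
  | idle : Prog P (fun _ c d => c = d)
  | empty : Prog P (fun _ _ _ => False)
  | comp {R S} : Prog P R → Prog P S → Prog P (fun x c d => ∃ e, R x c e ∧ S x e d)
  | union {R S} : Prog P R → Prog P S → Prog P (fun x c d => R x c d ∨ S x c d)
  | star {R} : Prog P R → Prog P (fun x => Relation.ReflTransGen (R x))

/-- `φ` can be tested without changing the configuration. -/
def Test {W A : Type} (P : Fam W A → Prop) (φ : W → A → Prop) : Prop :=
  Prog P (fun x c d => c = d ∧ φ x c)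

/-- `Φ` is a bisimulation between `R` and `S`. -/
def Simulates {W A B : Type} (Φ : W → A → B → Prop) (R : Fam W A) (S : Fam W B) : Prop :=
  ∀ x c d, Φ x c d →
    (∀ c', R x c c' → ∃ d', S x d d' ∧ Φ x c' d') ∧
    (∀ d', S x d d' → ∃ c', R x c c' ∧ Φ x c' d')

namespace Prog

variable {W A B : Type} {P : Fam W A → Prop} {Q : Fam W B → Prop}

theorem congr {R S : Fam W A} (h : Prog P R) (e : ∀ x c d, S x c d ↔ R x c d) : Prog P S := by
  have : S = R := by
    funext x c d
    exact propext (e x c d)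
  exact this ▸ h

theorem exists_finite {I : Type*} [Finite I] {f : I → Fam W A} (h : ∀ i, Prog P (f i)) :
    Prog P (fun x c d => ∃ i, f i x c d) := by
  classical
  have := Fintype.ofFinite I
  have key : ∀ s : Finset I, Prog P (fun x c d => ∃ i ∈ s, f i x c d) := by
    intro s
    induction s using Finset.induction_on with
    | empty => exact empty.congr (by simp)
    | insert a s _ ih => exact ((h a).union ih).congr (by simp)
  exact (key Finset.univ).congr (by simp)

theorem guard {φ : W → A → Prop} {R : Fam W A} (h : Test P φ) (hR : Prog P R) :
    Prog P (fun x c d => φ x c ∧ R x c d) := by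
  refine (comp h hR).congr fun x c d => ⟨fun h => ⟨c, ⟨rfl, h.1⟩, h.2⟩, ?_⟩
  rintro ⟨e, ⟨rfl, h1⟩, h2⟩
  exact ⟨h1, h2⟩

theorem ensure {φ : W → A → Prop} {R : Fam W A} (hR : Prog P R) (h : Test P φ) :
    Prog P (fun x c d => R x c d ∧ φ x d) := by
  refine (comp hR h).congr fun x c d => ⟨fun h => ⟨d, h.1, rfl, h.2⟩, ?_⟩
  rintro ⟨e, h1, rfl, h2⟩
  exact ⟨h1, h2⟩

theorem converse (hP : ∀ R, P R → Prog P (fun x c d => R x d c)) {R : Fam W A} (h : Prog P R) :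
    Prog P (fun x c d => R x d c) := by
  induction h with
  | base h => exact hP _ h
  | idle => exact idle.congr fun _ _ _ => eq_comm
  | empty => exact empty
  | comp _ _ h1 h2 => exact (comp h2 h1).congr fun x c d => by simp only [and_comm]
  | union _ _ h1 h2 => exact union h1 h2
  | star _ h =>
    refine (star h).congr fun x c d => ?_
    rw [← Relation.reflTransGen_swap]

theorem simulates_star {Φ : W → A → B → Prop} {R : Fam W A} {S : Fam W B}
    (h : Simulates Φ R S) :
    Simulates Φ (fun x => Relation.ReflTransGen (R x)) (fun x => Relation.ReflTransGen (S x)) := by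
  intro x c d hc
  constructor
  · intro c' h'
    induction h' with
    | refl => exact ⟨d, .refl, hc⟩
    | tail _ h2 ih =>
      obtain ⟨e, he, hΦ⟩ := ih
      obtain ⟨e', he', hΦ'⟩ := (h x _ _ hΦ).1 _ h2
      exact ⟨e', he.tail he', hΦ'⟩
  · intro c' h'
    induction h' with
    | refl => exact ⟨c, .refl, hc⟩
    | tail _ h2 ih =>
      obtain ⟨e, he, hΦ⟩ := ih
      obtain ⟨e', he', hΦ'⟩ := (h x _ _ hΦ).2 _ h2
      exact ⟨e', he.tail he', hΦ'⟩

theorem simulate {Φ : W → A → B → Prop}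
    (hP : ∀ R, P R → ∃ S, Prog Q S ∧ Simulates Φ R S) {R : Fam W A} (h : Prog P R) :
    ∃ S, Prog Q S ∧ Simulates Φ R S := by
  induction h with
  | base h => exact hP _ h
  | idle =>
    refine ⟨_, idle, fun x c d hc => ⟨?_, ?_⟩⟩
    · rintro _ rfl
      exact ⟨d, rfl, hc⟩
    · rintro _ rfl
      exact ⟨c, rfl, hc⟩
  | empty => exact ⟨_, empty, fun x c d hc => ⟨fun _ h => h.elim, fun _ h => h.elim⟩⟩
  | comp _ _ h1 h2 =>
    obtain ⟨S1, hS1, h1⟩ := h1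
    obtain ⟨S2, hS2, h2⟩ := h2
    refine ⟨_, comp hS1 hS2, fun x c d hc => ⟨?_, ?_⟩⟩
    · rintro c' ⟨e, he1, he2⟩
      obtain ⟨e', he', hΦ⟩ := (h1 x _ _ hc).1 _ he1
      obtain ⟨e'', he'', hΦ'⟩ := (h2 x _ _ hΦ).1 _ he2
      exact ⟨e'', ⟨e', he', he''⟩, hΦ'⟩
    · rintro c' ⟨e, he1, he2⟩
      obtain ⟨e', he', hΦ⟩ := (h1 x _ _ hc).2 _ he1
      obtain ⟨e'', he'', hΦ'⟩ := (h2 x _ _ hΦ).2 _ he2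
      exact ⟨e'', ⟨e', he', he''⟩, hΦ'⟩
  | union _ _ h1 h2 =>
    obtain ⟨S1, hS1, h1⟩ := h1
    obtain ⟨S2, hS2, h2⟩ := h2
    refine ⟨_, union hS1 hS2, fun x c d hc => ⟨?_, ?_⟩⟩
    · rintro c' (h | h)
      · obtain ⟨e, he, hΦ⟩ := (h1 x _ _ hc).1 _ h
        exact ⟨e, .inl he, hΦ⟩
      · obtain ⟨e, he, hΦ⟩ := (h2 x _ _ hc).1 _ h
        exact ⟨e, .inr he, hΦ⟩
    · rintro c' (h | h)
      · obtain ⟨e, he, hΦ⟩ := (h1 x _ _ hc).2 _ h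
        exact ⟨e, .inl he, hΦ⟩
      · obtain ⟨e, he, hΦ⟩ := (h2 x _ _ hc).2 _ h
        exact ⟨e, .inr he, hΦ⟩
  | star _ h =>
    obtain ⟨S, hS, h⟩ := h
    exact ⟨_, star hS, simulates_star h⟩

end Prog

namespace Test

variable {W A : Type} {P : Fam W A → Prop} {φ ψ : W → A → Prop}

theorem congr (h : Test P φ) (e : ∀ x c, ψ x c ↔ φ x c) : Test P ψ :=
  Prog.congr h fun x c d => by rw [e]

theorem true : Test P (fun _ _ => True) :=
  Prog.idle.congr fun x c d => by simp

theorem false : Test P (fun _ _ => False) :=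
  Prog.empty.congr fun x c d => by simp

theorem const (p : Prop) : Test P (fun _ _ => p) := by
  by_cases h : p
  · exact true.congr (by simp [h])
  · exact false.congr (by simp [h])

theorem and (h1 : Test P φ) (h2 : Test P ψ) : Test P (fun x c => φ x c ∧ ψ x c) :=
  (Prog.guard h1 h2).congr fun x c d => by tauto

theorem exists_finite {I : Type*} [Finite I] {f : I → W → A → Prop} (h : ∀ i, Test P (f i)) :
    Test P (fun x c => ∃ i, f i x c) :=
  (Prog.exists_finite h).congr fun x c d => by simp

theorem forall_finite {I : Type*} [Finite I] {f : I → W → A → Prop} (h : ∀ i, Test P (f i)) :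
    Test P (fun x c => ∀ i, f i x c) := by
  classical
  have := Fintype.ofFinite I
  have key : ∀ s : Finset I, Test P (fun x c => ∀ i ∈ s, f i x c) := by
    intro s
    induction s using Finset.induction_on with
    | empty => exact true.congr (by simp)
    | insert a s _ ih => exact ((h a).and ih).congr (by simp)
  exact (key Finset.univ).congr (by simp)

end Test

section StateElimination

variable {W A F : Type}

/-- Nonempty paths through the graph on `A × F` with labels `E`, all of whose intermediate
states belong to `s`. -/
inductive PathThrough (E : F → F → A → A → Prop) (s : Set F) : F → A → F → A → Prop
  | single {f g c d} : E f g c d → PathThrough E s f c g d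
  | cons {f g h c d e} : E f g c d → g ∈ s → PathThrough E s g d h e → PathThrough E s f c h e

namespace PathThrough

variable {E : F → F → A → A → Prop} {s t : Set F}

theorem mono (hst : s ⊆ t) {f c g d} (h : PathThrough E s f c g d) : PathThrough E t f c g d := by
  induction h with
  | single h => exact .single h
  | cons h hg _ ih => exact .cons h (hst hg) ih

theorem append {f c g d h e} (h1 : PathThrough E s f c g d) (hg : g ∈ s)
    (h2 : PathThrough E s g d h e) : PathThrough E s f c h e := by
  induction h1 with
  | single h => exact .cons h hg h2
  | cons h hg' _ ih => exact .cons h hg' (ih hg h2)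

theorem insert_iff {z f g : F} {c d : A} :
    PathThrough E (insert z s) f c g d ↔
      PathThrough E s f c g d ∨
        ∃ a, PathThrough E s f c z a ∧
          ∃ b, Relation.ReflTransGen (fun a b => PathThrough E s z a z b) a b ∧
            PathThrough E s z b g d := by
  constructor
  · intro h
    induction h with
    | single h => exact .inl (.single h)
    | @cons f g h c d e h1 hg _ ih =>
      rcases ih with ih | ⟨a, ha, b, hab, hb⟩
      · rcases hg with rfl | hg
        · exact .inr ⟨d, .single h1, d, .refl, ih⟩
        · exact .inl (.cons h1 hg ih)
      · rcases hg with rfl | hg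
        · exact .inr ⟨d, .single h1, b, .head ha hab, hb⟩
        · exact .inr ⟨a, .cons h1 hg ha, b, hab, hb⟩
  · have hs : s ⊆ insert z s := Set.subset_insert z s
    have hz : z ∈ insert z s := Set.mem_insert z s
    rintro (h | ⟨a, ha, b, hab, hb⟩)
    · exact h.mono hs
    · refine append (g := z) (d := b) ?_ hz (hb.mono hs)
      clear hb
      induction hab with
      | refl => exact ha.mono hs
      | tail _ h ih => exact ih.append hz (h.mono hs)

theorem reflTransGen_iff {f g : F} {c d : A} :
    Relation.ReflTransGen (fun a b : A × F => E a.2 b.2 a.1 b.1) (c, f) (d, g) ↔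
      (c = d ∧ f = g) ∨ PathThrough E Set.univ f c g d := by
  constructor
  · intro h
    generalize hp : (c, f) = p at h
    induction h using Relation.ReflTransGen.head_induction_on generalizing c f with
    | refl =>
      cases hp
      exact .inl ⟨rfl, rfl⟩
    | head h1 _ ih =>
      subst hp
      rcases ih rfl with ⟨h, h'⟩ | h
      · right
        simp only [h, h'] at h1
        exact .single h1
      · exact .inr (.cons h1 trivial h)
  · rintro (⟨rfl, rfl⟩ | h)
    · exact .refl
    · induction h with
      | single h => exact .single h
      | cons h _ _ ih => exact .head h ih

end PathThrough

namespace Prog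

variable {P : Fam W A → Prop} [Finite F]

theorem pathThrough {E : F → F → Fam W A} (hE : ∀ f g, Prog P (E f g)) (s : Set F) (f g : F) :
    Prog P (fun x c d => PathThrough (fun f g => E f g x) s f c g d) := by
  induction s, s.toFinite using Set.Finite.induction_on generalizing f g with
  | empty =>
    refine (hE f g).congr fun x c d => ⟨fun h => ?_, fun h => .single h⟩
    cases h with
    | single h => exact h
    | cons _ h _ => exact h.elim
  | insert _ _ ih =>
    exact ((ih f g).union ((ih f _).comp ((ih _ _).star.comp (ih _ g)))).congr fun x c d =>
      PathThrough.insert_iff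

theorem reflTransGen_finite {E : F → F → Fam W A} (hE : ∀ f g, Prog P (E f g)) (f g : F) :
    Prog P (fun x c d =>
      Relation.ReflTransGen (fun a b : A × F => E a.2 b.2 x a.1 b.1) (c, f) (d, g)) := by
  have h : Prog P (fun _ c d => c = d ∧ f = g) := Test.const (f = g)
  exact (h.union (pathThrough hE Set.univ f g)).congr fun x c d =>
    PathThrough.reflTransGen_iff (E := fun f g => E f g x)

end Prog

end StateElimination

theorem reflTransGen_iff_exists {A : Type} {R : A → A → Prop} {T : ℕ → A → A → Prop}
    (h0 : ∀ c d, T 0 c d ↔ c = d) (hs : ∀ t c d, T (t + 1) c d ↔ ∃ e, T t c e ∧ R e d) {c d : A} :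
    Relation.ReflTransGen R c d ↔ ∃ t, T t c d := by
  constructor
  · intro h
    induction h with
    | refl => exact ⟨0, (h0 _ _).2 rfl⟩
    | tail _ h ih =>
      obtain ⟨t, ht⟩ := ih
      exact ⟨t + 1, (hs _ _ _).2 ⟨_, ht, h⟩⟩
  · rintro ⟨t, ht⟩
    induction t generalizing d with
    | zero => exact (h0 _ _).1 ht ▸ .refl
    | succ t ih =>
      obtain ⟨e, he, h⟩ := (hs _ _ _).1 ht
      exact (ih he).tail h

/-- Inputs of type `W`, each presented as a row of `size x` labelled cells. -/
structure LabelledCycle (W : Type) where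
  Γ : Type
  finite : Finite Γ
  size : W → ℕ
  size_pos : ∀ x, 0 < size x
  lab : W → ℕ → Γ

namespace LabelledCycle

variable {W : Type} (S : LabelledCycle W) {ι κ : Type} [DecidableEq ι] [DecidableEq κ]

attribute [instance] LabelledCycle.finite

/-- Everything a head sees: a label, and whether it is on the first, the second or the last cell. -/
abbrev Full := S.Γ × Prop × Prop × Prop

/-- What is seen at cell `p`. -/
def full (x : W) (p : ℕ) : S.Full := (S.lab x p, p = 0, p = 1, p + 1 = S.size x)

variable (ι) in
/-- Elementary instructions for machines with heads indexed by `ι`. -/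
inductive Heads : Fam W (ι → ℕ) → Prop
  | inc (i : ι) :
    Heads (fun x c d => c i + 1 < S.size x ∧ d = Function.update c i (c i + 1))
  | dec (i : ι) :
    Heads (fun x c d => d i + 1 < S.size x ∧ c = Function.update d i (d i + 1))
  | test (i : ι) (T : Set S.Full) :
    Heads (fun x c d => c = d ∧ S.full x (c i) ∈ T)

variable (ι) in
/-- Some nondeterministic machine with heads indexed by `ι` accepts precisely the inputs
satisfying `L`. -/
def Recognizes (L : W → Prop) : Prop :=
  ∃ R, Prog (S.Heads ι) R ∧ ∀ x, L x ↔ ∃ d, R x (fun _ => 0) d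

variable {S}

theorem test_full (i : ι) (T : Set S.Full) :
    Test (S.Heads ι) (fun x c => S.full x (c i) ∈ T) :=
  .base (.test i T)

theorem test_lab (i : ι) (T : Set S.Γ) : Test (S.Heads ι) (fun x c => S.lab x (c i) ∈ T) :=
  test_full i {a | a.1 ∈ T}

theorem test_zero (i : ι) : Test (S.Heads ι) (fun _ c => c i = 0) :=
  test_full i {a | a.2.1}

theorem test_max (i : ι) : Test (S.Heads ι) (fun x c => c i + 1 = S.size x) :=
  test_full i {a | a.2.2.2}

omit [DecidableEq κ] in
theorem test_joint [Finite κ] (f : κ → ι) (T : Set (κ → S.Full)) :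
    Test (S.Heads ι) (fun x c => (fun j => S.full x (c (f j))) ∈ T) := by
  refine Test.congr (Test.exists_finite fun a : T =>
    Test.forall_finite fun j => test_full (f j) {a.1 j}) fun x c => ?_
  simp only [Set.mem_singleton_iff, Subtype.exists, exists_prop, ← funext_iff, exists_eq_right']

theorem Heads.converse {R : Fam W (ι → ℕ)} (h : S.Heads ι R) :
    Prog (S.Heads ι) (fun x c d => R x d c) := by
  cases h with
  | inc i => exact .base (.dec i)
  | dec i => exact .base (.inc i)
  | test i T =>
    refine Prog.congr (test_full i T) fun x c d => ?_
    constructor <;> · rintro ⟨rfl, h⟩; exact ⟨rfl, h⟩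

theorem converse {R : Fam W (ι → ℕ)} (h : Prog (S.Heads ι) R) :
    Prog (S.Heads ι) (fun x c d => R x d c) :=
  h.converse fun _ h => h.converse

theorem prog_reset (i : ι) :
    Prog (S.Heads ι) (fun x c d => c i < S.size x ∧ d = Function.update c i 0) := by
  refine (Prog.ensure (Prog.base (.dec i)).star (test_zero i)).congr fun x c d => ?_
  rw [reflTransGen_iff_exists
    (T := fun t c d => (t = 0 ∨ c i < S.size x) ∧ c = Function.update d i (d i + t))]
  · constructor
    · rintro ⟨h, rfl⟩
      exact ⟨⟨c i, .inr h, by simp⟩, by simp⟩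
    · rintro ⟨⟨t, h, rfl⟩, h0⟩
      refine ⟨?_, by simp [← h0]⟩
      rcases h with rfl | h
      · simpa [h0] using S.size_pos x
      · exact h
  · intro c d
    simp
  · intro t c d
    constructor
    · rintro ⟨h, rfl⟩
      have h : d i + (t + 1) < S.size x := by simpa using h
      refine ⟨Function.update d i (d i + 1), ⟨.inr (by simpa), ?_⟩, by omega, rfl⟩
      simp [add_assoc, add_comm 1 t]
    · rintro ⟨e, ⟨h, rfl⟩, h', rfl⟩
      simp only [Function.update_self, Function.update_idem] at h ⊢
      refine ⟨.inr ?_, by rw [add_assoc, add_comm 1 t]⟩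
      omega

/-- Head `a` can be moved by a distance `τ` that a spare head `b` recognizes. -/
theorem prog_shift {a b : ι} (hab : a ≠ b) (T : Set S.Full) (τ : W → ℕ) (hτ : ∀ x, 0 < τ x)
    (hT : ∀ x p, p < S.size x → (S.full x p ∈ T ↔ p = τ x)) :
    Prog (S.Heads ι) (fun x c d => c b = 0 ∧ c a + τ x < S.size x ∧
      d = Function.update c a (c a + τ x)) := by
  have walk := (Prog.comp (Prog.base (Heads.inc (S := S) a)) (Prog.base (Heads.inc b))).star
  refine ((Prog.ensure (Prog.guard (test_zero (S := S) b) walk) (test_full b T)).comp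
    (prog_reset b)).congr fun x c d => ?_
  have key : ∀ x (c d : ι → ℕ), Relation.ReflTransGen (fun c d : ι → ℕ =>
      ∃ e, (c a + 1 < S.size x ∧ e = Function.update c a (c a + 1)) ∧
        (e b + 1 < S.size x ∧ d = Function.update e b (e b + 1))) c d ↔
      ∃ t, (t = 0 ∨ c a + t < S.size x ∧ c b + t < S.size x) ∧
        d = Function.update (Function.update c a (c a + t)) b (c b + t) := by
    intro x c d
    refine reflTransGen_iff_exists (T := fun t (c d : ι → ℕ) =>
      (t = 0 ∨ c a + t < S.size x ∧ c b + t < S.size x) ∧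
        d = Function.update (Function.update c a (c a + t)) b (c b + t)) ?_ ?_
    · intro c d
      simp [eq_comm]
    · intro t c d
      constructor
      · rintro ⟨h, rfl⟩
        have h : c a + (t + 1) < S.size x ∧ c b + (t + 1) < S.size x := by simpa using h
        refine ⟨_, ⟨.inr ?_, rfl⟩, _, ⟨?_, rfl⟩, ?_, ?_⟩
        · omega
        · simp [hab]; omega
        · simp [hab.symm]; omega
        · ext i
          by_cases hb : i = b
          · subst hb; simp [hab.symm, add_assoc]
          · by_cases ha : i = a
            · subst ha; simp [hab, add_assoc]
            · simp [ha, hb]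
      · rintro ⟨e, ⟨h, rfl⟩, f, ⟨h1, rfl⟩, h2, rfl⟩
        simp [hab, hab.symm] at h1 h2
        refine ⟨.inr (by omega), ?_⟩
        ext i
        by_cases hb : i = b
        · subst hb; simp [hab.symm, add_assoc]
        · by_cases ha : i = a
          · subst ha; simp [hab, add_assoc]
          · simp [ha, hb]
  simp only [key]
  constructor
  · rintro ⟨h0, h, rfl⟩
    refine ⟨Function.update (Function.update c a (c a + τ x)) b (c b + τ x),
      ⟨⟨h0, τ x, .inr ⟨h, by omega⟩, rfl⟩, ?_⟩, ?_, ?_⟩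
    · simp only [Function.update_self, h0]
      exact (hT _ _ (by omega)).2 (by simp)
    · simp; omega
    · ext i
      by_cases hb : i = b
      · subst hb; simp [hab.symm, h0]
      · simp [hb]
  · rintro ⟨e, ⟨⟨h0, t, h, rfl⟩, h1⟩, h2, rfl⟩
    simp only [Function.update_self] at h1 h2
    have := (hT _ _ h2).1 h1
    simp only [h0, zero_add] at this h2 h
    subst this
    refine ⟨h0, ?_, ?_⟩
    · have := hτ x
      omega
    · ext i
      by_cases hb : i = b
      · subst hb; simp [hab.symm, h0]
      · simp [hb]

theorem prog_embed {g : κ → ι} (hg : Function.Injective g) {R : Fam W (κ → ℕ)}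
    (h : Prog (S.Heads κ) R) :
    Prog (S.Heads ι)
      (fun x c d => R x (c ∘ g) (d ∘ g) ∧ ∀ i ∉ Set.range g, d i = c i) := by
  have ext_g : ∀ (e : κ → ℕ) (c : ι → ℕ), Function.extend g e c ∘ g = e := fun e c => by
    ext j; simp [hg.extend_apply]
  have ext_out : ∀ (e : κ → ℕ) (c : ι → ℕ) i, i ∉ Set.range g → Function.extend g e c i = c i :=
    fun e c i hi => Function.extend_apply' _ _ _ hi
  have eq_of : ∀ c d : ι → ℕ, c ∘ g = d ∘ g → (∀ i ∉ Set.range g, d i = c i) → c = d := by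
    intro c d h1 h2
    ext i
    by_cases hi : i ∈ Set.range g
    · obtain ⟨j, rfl⟩ := hi
      exact congrFun h1 j
    · exact (h2 i hi).symm
  have upd : ∀ (c d : ι → ℕ) (j : κ) (n : ℕ), d = Function.update c (g j) n ↔
      d ∘ g = Function.update (c ∘ g) j n ∧ ∀ i ∉ Set.range g, d i = c i := by
    intro c d j n
    constructor
    · rintro rfl
      refine ⟨Function.update_comp_eq_of_injective _ hg _ _, fun i hi => ?_⟩
      exact Function.update_of_ne (fun h => hi ⟨j, h.symm⟩) _ _
    · rintro ⟨h1, h2⟩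
      symm
      refine eq_of _ _ ?_ fun i hi => ?_
      · rw [Function.update_comp_eq_of_injective _ hg, h1]
      · rw [h2 i hi, Function.update_of_ne (fun h => hi ⟨j, h.symm⟩)]
  induction h with
  | base h =>
    cases h with
    | inc j =>
      refine (Prog.base (Heads.inc (g j))).congr fun x c d => ?_
      rw [upd]
      simp [and_assoc]
    | dec j =>
      refine (Prog.base (Heads.dec (g j))).congr fun x c d => ?_
      rw [upd]
      simp only [Function.comp_apply, and_assoc, eq_comm]
    | test j T =>
      refine (Prog.base (Heads.test (g j) T)).congr fun x c d => ?_
      constructor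
      · rintro ⟨⟨h1, h⟩, h2⟩
        exact ⟨eq_of _ _ h1 h2, h⟩
      · rintro ⟨rfl, h⟩
        exact ⟨⟨rfl, h⟩, fun _ _ => rfl⟩
  | idle =>
    refine Prog.idle.congr fun x c d => ⟨fun h => eq_of _ _ h.1 h.2, ?_⟩
    rintro rfl
    exact ⟨rfl, fun _ _ => rfl⟩
  | empty => exact Prog.empty.congr (by simp)
  | comp _ _ h1 h2 =>
    refine (h1.comp h2).congr fun x c d => ⟨?_, ?_⟩
    · rintro ⟨⟨e, he, hf⟩, hi⟩
      refine ⟨Function.extend g e c, ⟨?_, ext_out e c⟩, ?_, ?_⟩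
      · rwa [ext_g]
      · rwa [ext_g]
      · intro i h
        rw [hi i h, ext_out _ _ _ h]
    · rintro ⟨e, ⟨h1, h1'⟩, h2, h2'⟩
      exact ⟨⟨_, h1, h2⟩, fun i hi => (h2' i hi).trans (h1' i hi)⟩
  | union _ _ h1 h2 =>
    exact (h1.union h2).congr fun x c d => by tauto
  | @star R _ h =>
    refine h.star.congr fun x c d => ⟨?_, ?_⟩
    · rintro ⟨h1, h2⟩
      have : ∀ e, Relation.ReflTransGen (R x) (c ∘ g) e → Relation.ReflTransGen (fun c d =>
          R x (c ∘ g) (d ∘ g) ∧ ∀ i ∉ Set.range g, d i = c i) c (Function.extend g e c) := by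
        intro e he
        induction he with
        | refl =>
          convert Relation.ReflTransGen.refl
          exact eq_of _ _ (ext_g _ _) fun i hi => (ext_out _ _ _ hi).symm
        | tail _ h3 ih =>
          refine ih.tail ⟨by rwa [ext_g, ext_g], fun i hi => ?_⟩
          rw [ext_out _ _ _ hi, ext_out _ _ _ hi]
      convert this _ h1
      symm
      exact eq_of _ _ (ext_g _ _) fun i hi => by rw [h2 i hi, ext_out _ _ _ hi]
    · intro h
      induction h with
      | refl => exact ⟨.refl, fun _ _ => rfl⟩
      | tail _ h3 ih => exact ⟨ih.1.tail h3.1, fun i hi => (h3.2 i hi).trans (ih.2 i hi)⟩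

theorem Recognizes.mono {g : κ → ι} (hg : Function.Injective g) {L : W → Prop}
    (h : S.Recognizes κ L) : S.Recognizes ι L := by
  obtain ⟨R, hR, hL⟩ := h
  refine ⟨_, prog_embed hg hR, fun x => (hL x).trans ⟨?_, ?_⟩⟩
  · rintro ⟨d, hd⟩
    refine ⟨Function.extend g d fun _ => 0, ?_, fun i hi => Function.extend_apply' _ _ _ hi⟩
    have : Function.extend g d (fun _ => 0) ∘ g = d := by
      ext j
      simp [hg.extend_apply]
    rwa [this]
  · rintro ⟨d, hd, -⟩
    exact ⟨_, hd⟩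

theorem Recognizes.of_simulation {T : LabelledCycle W} {L : W → Prop} (h : S.Recognizes ι L)
    (Φ : W → (ι → ℕ) → (κ → ℕ) → Prop) (h0 : ∀ x, Φ x (fun _ => 0) (fun _ => 0))
    (hΦ : ∀ R, S.Heads ι R → ∃ R', Prog (T.Heads κ) R' ∧ Simulates Φ R R') :
    T.Recognizes κ L := by
  obtain ⟨R, hR, hL⟩ := h
  obtain ⟨R', hR', hs⟩ := hR.simulate hΦ
  refine ⟨R', hR', fun x => (hL x).trans ⟨?_, ?_⟩⟩
  · rintro ⟨d, hd⟩
    obtain ⟨e, he, -⟩ := (hs x _ _ (h0 x)).1 d hd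
    exact ⟨e, he⟩
  · rintro ⟨d, hd⟩
    obtain ⟨e, he, -⟩ := (hs x _ _ (h0 x)).2 d hd
    exact ⟨e, he⟩

end LabelledCycle

/-- The number with base `m` digits `c`, least significant first. -/
def posVal (m : ℕ) {r : ℕ} (c : Fin r → ℕ) : ℕ := ∑ i, c i * m ^ (i : ℕ)

section Digits

variable {m r : ℕ} {c : Fin r → ℕ}

theorem posVal_eq (hc : ∀ i, c i < m) :
    posVal m c = (finFunctionFinEquiv fun i => (⟨c i, hc i⟩ : Fin m) : ℕ) := by
  rw [finFunctionFinEquiv_apply]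
  rfl

theorem posVal_lt (hc : ∀ i, c i < m) : posVal m c < m ^ r := by
  rw [posVal_eq hc]
  exact Fin.is_lt _

theorem digit_posVal (hc : ∀ i, c i < m) (i : Fin r) : posVal m c / m ^ (i : ℕ) % m = c i := by
  rw [posVal_eq hc]
  have := congrFun (finFunctionFinEquiv.symm_apply_apply fun i => (⟨c i, hc i⟩ : Fin m)) i
  exact congrArg Fin.val this

theorem posVal_digit {p : ℕ} (hp : p < m ^ r) :
    posVal m (fun i : Fin r => p / m ^ (i : ℕ) % m) = p := by
  have h := congrArg Fin.val (finFunctionFinEquiv.apply_symm_apply (⟨p, hp⟩ : Fin (m ^ r)))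
  rw [finFunctionFinEquiv_apply] at h
  exact h

theorem posVal_update (j : Fin r) (a : ℕ) :
    posVal m (Function.update c j a) + c j * m ^ (j : ℕ) = posVal m c + a * m ^ (j : ℕ) := by
  unfold posVal
  rw [← Finset.add_sum_erase _ _ (Finset.mem_univ j),
    ← Finset.add_sum_erase (a := j) _ (fun i => c i * m ^ (i : ℕ)) (Finset.mem_univ j)]
  rw [Finset.sum_congr rfl (g := fun i => c i * m ^ (i : ℕ))]
  · simp
    ring
  · intro i hi
    rw [Function.update_of_ne (Finset.ne_of_mem_erase hi)]

theorem posVal_inc (j : Fin r) :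
    posVal m (Function.update c j (c j + 1)) = posVal m c + m ^ (j : ℕ) := by
  have := posVal_update (m := m) (c := c) j (c j + 1)
  linarith

theorem posVal_injective {d : Fin r → ℕ} (hc : ∀ i, c i < m) (hd : ∀ i, d i < m)
    (h : posVal m c = posVal m d) : c = d := by
  ext i
  rw [← digit_posVal hc, h, digit_posVal hd]

theorem posVal_single (j : Fin r) :
    posVal m (Function.update (fun _ => 0) j 1) = m ^ (j : ℕ) := by
  simpa [posVal] using posVal_inc (m := m) (c := fun _ : Fin r => 0) j

theorem posVal_succ (c : Fin (r + 1) → ℕ) :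
    posVal m c = c 0 + m * posVal m (fun i => c i.succ) := by
  simp only [posVal, Fin.sum_univ_succ, Finset.mul_sum, Fin.val_zero, pow_zero, mul_one,
    Fin.val_succ, pow_succ]
  congr 1
  exact Finset.sum_congr rfl fun i _ => by ring

theorem posVal_max (hm : 0 < m) : posVal m (fun _ : Fin r => m - 1) + 1 = m ^ r := by
  induction r with
  | zero => simp [posVal]
  | succ r ih =>
    rw [posVal_succ, pow_succ, ← ih]
    obtain ⟨m, rfl⟩ := Nat.exists_eq_add_of_lt hm
    simp
    ring

theorem posVal_carry (j : Fin r) (hj : ∀ i < j, c i + 1 = m) :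
    posVal m (fun i => if i < j then 0 else if i = j then c i + 1 else c i) = posVal m c + 1 := by
  induction r with
  | zero => exact j.elim0
  | succ r ih =>
    induction j using Fin.cases with
    | zero =>
      have : (fun i : Fin (r + 1) => if i < 0 then 0 else if i = 0 then c i + 1 else c i) =
          Function.update c 0 (c 0 + 1) := by
        ext i
        by_cases h : i = 0
        · subst h; simp
        · simp [h]
      rw [this, posVal_inc]
      simp
    | succ j =>
      have h := ih (c := fun i => c i.succ) j fun i hi => hj _ (Fin.succ_lt_succ_iff.2 hi)
      rw [posVal_succ, posVal_succ c]
      simp only [Fin.succ_lt_succ_iff, Fin.succ_inj, h, Fin.succ_pos, if_true]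
      have := hj 0 (Fin.succ_pos j)
      rw [mul_add, mul_one, zero_add]
      omega

end Digits

namespace LabelledCycle

variable {W : Type} {S T : LabelledCycle W} {ι κ : Type} [DecidableEq ι] [DecidableEq κ]

/-- Machines on `S` can be simulated by machines on `T` along a faithful encoding of tuples of
positions. -/
theorem Recognizes.of_encoding {L : W → Prop} (h : S.Recognizes ι L)
    (enc : W → (ι → ℕ) → κ → ℕ) (V : W → (κ → ℕ) → Prop)
    (h0 : ∀ x, enc x (fun _ => 0) = fun _ => 0)
    (hV : ∀ x c, (∀ i, c i < S.size x) → V x (enc x c))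
    (hsurj : ∀ x d, V x d → ∃ c, (∀ i, c i < S.size x) ∧ enc x c = d)
    (hinj : ∀ x c c', (∀ i, c i < S.size x) → (∀ i, c' i < S.size x) →
      enc x c = enc x c' → c = c')
    (htest : ∀ i (B : Set S.Full), ∃ φ, Test (T.Heads κ) φ ∧
      ∀ x c, (∀ i, c i < S.size x) → (φ x (enc x c) ↔ S.full x (c i) ∈ B))
    (hinc : ∀ i, ∃ R, Prog (T.Heads κ) R ∧ (∀ x d d', R x d d' → (V x d ↔ V x d')) ∧
      ∀ x c d, (∀ i, c i < S.size x) → (R x (enc x c) d ↔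
        c i + 1 < S.size x ∧ d = enc x (Function.update c i (c i + 1)))) :
    T.Recognizes κ L := by
  refine h.of_simulation (fun x c d => (∀ i, c i < S.size x) ∧ d = enc x c)
    (fun x => ⟨fun _ => S.size_pos x, (h0 x).symm⟩) fun R hR => ?_
  have hb : ∀ x (c : ι → ℕ) i, (∀ i, c i < S.size x) → c i + 1 < S.size x →
      ∀ j, Function.update c i (c i + 1) j < S.size x := by
    intro x c i hc hi j
    by_cases h : j = i
    · subst h; simpa
    · simp [h, hc]
  cases hR with
  | inc i =>
    obtain ⟨R, hR, -, h2⟩ := hinc i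
    refine ⟨R, hR, ?_⟩
    rintro x c _ ⟨hc, rfl⟩
    constructor
    · rintro _ ⟨hi, rfl⟩
      exact ⟨_, (h2 x c _ hc).2 ⟨hi, rfl⟩, hb x c i hc hi, rfl⟩
    · intro d hd
      obtain ⟨hi, rfl⟩ := (h2 x c _ hc).1 hd
      exact ⟨_, ⟨hi, rfl⟩, hb x c i hc hi, rfl⟩
  | dec i =>
    obtain ⟨R, hR, h1, h2⟩ := hinc i
    refine ⟨_, converse hR, ?_⟩
    rintro x c _ ⟨hc, rfl⟩
    constructor
    · rintro c' ⟨hi, rfl⟩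
      have hc' : ∀ i, c' i < S.size x := by
        intro j
        by_cases h : j = i
        · subst h; omega
        · simpa [h] using hc j
      exact ⟨_, (h2 x c' _ hc').2 ⟨hi, rfl⟩, hc', rfl⟩
    · intro d hd
      obtain ⟨c', hc', rfl⟩ := hsurj x d ((h1 _ _ _ hd).2 (hV _ _ hc))
      obtain ⟨hi, he⟩ := (h2 x c' _ hc').1 hd
      exact ⟨c', ⟨hi, hinj x _ _ hc (hb x c' i hc' hi) he⟩, hc', rfl⟩
  | test i B =>
    obtain ⟨φ, hφ, h⟩ := htest i B
    refine ⟨_, hφ, ?_⟩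
    rintro x c _ ⟨hc, rfl⟩
    constructor
    · rintro _ ⟨rfl, hi⟩
      exact ⟨_, ⟨rfl, (h x c hc).2 hi⟩, hc, rfl⟩
    · rintro _ ⟨rfl, hi⟩
      exact ⟨_, ⟨rfl, (h x c hc).1 hi⟩, hc, rfl⟩

end LabelledCycle

section Digits

variable {m r : ℕ} {c : Fin r → ℕ}

theorem posVal_zero : posVal m (fun _ : Fin r => 0) = 0 := by
  simp [posVal]

theorem posVal_eq_zero_iff (hc : ∀ i, c i < m) : posVal m c = 0 ↔ ∀ i, c i = 0 := by
  constructor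
  · intro h i
    have := posVal_injective (d := fun _ => 0) hc
      (fun i => Nat.zero_lt_of_lt (hc i)) (by rw [h, posVal_zero])
    exact congrFun this i
  · intro h
    rw [← posVal_zero (m := m) (r := r)]
    congr
    exact funext h

theorem posVal_eq_max_iff (hm : 0 < m) (hc : ∀ i, c i < m) :
    posVal m c + 1 = m ^ r ↔ ∀ i, c i + 1 = m := by
  constructor
  · intro h i
    have := posVal_injective (d := fun _ => m - 1) hc
      (fun i => by omega) (by have := posVal_max (r := r) hm; omega)
    rw [congrFun this i]
    omega
  · intro h
    rw [← posVal_max (r := r) hm]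
    congr
    ext i
    have := h i
    omega

theorem posVal_eq_single_iff (hc : ∀ i, c i < m) (j : Fin r) :
    posVal m c = m ^ (j : ℕ) ↔ c j = 1 ∧ ∀ i, i ≠ j → c i = 0 := by
  constructor
  · intro h
    have hm : 1 < m := by
      by_contra hm
      obtain rfl : m = 1 := by have := hc j; omega
      have : posVal 1 c = 0 := (posVal_eq_zero_iff hc).2 fun i => by have := hc i; omega
      simp [this] at h
    have := posVal_injective (d := Function.update (fun _ => 0) j 1) hc (fun i => by
      by_cases h : i = j
      · subst h; simpa
      · simp [h]; omega) (by rw [h, posVal_single])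
    subst this
    simp +contextual
  · rintro ⟨h1, h2⟩
    rw [← posVal_single]
    congr
    ext i
    by_cases h : i = j
    · subst h; simpa
    · simp [h, h2]

theorem digit_mod_pow (m a : ℕ) {s t : ℕ} (h : s < t) : a % m ^ t / m ^ s % m = a / m ^ s % m := by
  obtain ⟨u, rfl⟩ := Nat.exists_eq_add_of_lt h
  rw [add_assoc, pow_add m s, Nat.mod_mul_right_div_self,
    Nat.mod_mod_of_dvd _ (dvd_pow_self m (Nat.succ_ne_zero u))]

end Digits

namespace LabelledCycle

variable {W : Type} {S T : LabelledCycle W} {ι κ : Type} [DecidableEq ι] [DecidableEq κ]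

theorem full_eq_iff_zero {x : W} {p : ℕ} : (S.full x p).2.1 ↔ p = 0 := Iff.rfl

/-- The `r`-fold power of `S`: its positions are the `r`-digit numbers in base `S.size x`. -/
def pad (r : ℕ) (S : LabelledCycle W) : LabelledCycle W where
  Γ := Fin r → S.Full
  finite := inferInstance
  size x := S.size x ^ r
  size_pos x := Nat.pow_pos (S.size_pos x)
  lab x p i := S.full x (p / S.size x ^ (i : ℕ) % S.size x)

/-- What a head on a power sees, in terms of what can be seen at the digits of its position. -/
def padFull {r : ℕ} (a : Fin r → S.Full) : (pad r S).Full :=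
  (a, (∀ i, (a i).2.1), (∃ j : Fin r, (j : ℕ) = 0 ∧ (a j).2.2.1 ∧ ∀ i, i ≠ j → (a i).2.1),
    ∀ i, (a i).2.2.2)

theorem full_pad {r : ℕ} {x : W} {c : Fin r → ℕ} (hc : ∀ i, c i < S.size x) :
    (pad r S).full x (posVal (S.size x) c) = padFull fun i => S.full x (c i) := by
  refine Prod.ext ?_ (Prod.ext (propext ?_) (Prod.ext (propext ?_) (propext ?_)))
  · funext i
    simp only [full, pad, padFull, digit_posVal hc]
  · exact posVal_eq_zero_iff hc
  · constructor
    · intro h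
      rcases r with - | r
      · simp [full, posVal] at h
      · exact ⟨0, rfl, (posVal_eq_single_iff hc 0).1 (by simpa [full] using h)⟩
    · rintro ⟨j, hj, h⟩
      have := (posVal_eq_single_iff hc j).2 h
      simp only [hj, pow_zero] at this
      exact this
  · exact posVal_eq_max_iff (S.size_pos x) hc

theorem full_pad_digits {r : ℕ} {x : W} {p : ℕ} (hp : p < S.size x ^ r) :
    (pad r S).full x p =
      padFull fun i : Fin r => S.full x (p / S.size x ^ (i : ℕ) % S.size x) := by
  conv_lhs => rw [← posVal_digit hp]
  exact full_pad fun _ => Nat.mod_lt _ (S.size_pos x)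

theorem Recognizes.transfer {L : W → Prop} (h : S.Recognizes ι L)
    (hs : ∀ x, T.size x = S.size x) (f : T.Full → S.Γ)
    (hf : ∀ x p, p < S.size x → S.lab x p = f (T.full x p)) : T.Recognizes ι L := by
  refine h.of_encoding (fun _ c => c) (fun x d => ∀ i, d i < S.size x) (fun _ => rfl)
    (fun _ _ h => h) (fun x d h => ⟨d, h, rfl⟩) (fun _ _ _ _ _ h => h) (fun i B => ?_)
    fun i => ?_
  · refine ⟨_, test_full i {a | ((f a, a.2) : S.Full) ∈ B}, fun x c hc => ?_⟩
    simp only [full, Set.mem_ofPred_eq, hf x _ (hc i), hs]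
  · refine ⟨_, .base (.inc i), ?_, fun x c d hc => by rw [hs]⟩
    rintro x c _ ⟨h, rfl⟩
    rw [hs] at h
    constructor
    · intro hc j
      by_cases hj : j = i
      · subst hj; simpa
      · simpa [hj] using hc j
    · intro hc j
      by_cases hj : j = i
      · subst hj; omega
      · simpa [hj] using hc j

theorem Recognizes.pad_mul {r t : ℕ} {L : W → Prop} (h : (pad (r * t) S).Recognizes ι L) :
    (pad r (pad t S)).Recognizes ι L := by
  refine h.transfer (fun x => ?_) (fun a i => ((a.1 i.divNat).1 i.modNat)) fun x p _ => ?_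
  · simp only [pad]
    rw [mul_comm, pow_mul]
  · funext i
    refine congrArg (S.full x) ?_
    simp only [pad, Fin.coe_divNat, Fin.coe_modNat]
    have hi : 0 < t := Nat.pos_of_mul_pos_left (Nat.zero_lt_of_lt i.isLt)
    rw [← pow_mul, digit_mod_pow _ _ (Nat.mod_lt _ hi), Nat.div_div_eq_div_mul, ← pow_add,
      Nat.div_add_mod]

theorem digit_lt_size {r : ℕ} (x : W) (i : Fin r) (p : ℕ) :
    p / S.size x ^ (i : ℕ) % S.size x < S.size x := Nat.mod_lt _ (S.size_pos x)

theorem test_digit {r : ℕ} (a : ι) (i : Fin r) (B : Set S.Full) :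
    Test ((pad r S).Heads ι) (fun x c => S.full x (c a / S.size x ^ (i : ℕ) % S.size x) ∈ B) :=
  test_lab (S := pad r S) a {u : Fin r → S.Full | u i ∈ B}

theorem test_digit_not_max {r : ℕ} (a : ι) (i : Fin r) :
    Test ((pad r S).Heads ι) (fun x c => c a / S.size x ^ (i : ℕ) % S.size x + 1 ≠ S.size x) :=
  test_digit (S := S) a i {u | ¬ u.2.2.2}

/-- Test whether the head `a` on a power is at the position whose only nonzero digit is a one
at `j`. -/
theorem pad_full_single {r : ℕ} {x : W} {p : ℕ} (hp : p < S.size x ^ r) (j : Fin r) :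
    (pad r S).full x p ∈ {a : (pad r S).Full | (a.1 j).2.2.1 ∧ ∀ i, i ≠ j → (a.1 i).2.1} ↔
      p = S.size x ^ (j : ℕ) := by
  conv_rhs => rw [← posVal_digit hp]
  exact (posVal_eq_single_iff (fun i => digit_lt_size x i p) j).symm

/-- Machines with `k * r` heads can be simulated by machines with `k + 1` heads on the power. -/
theorem Recognizes.pack {k r : ℕ} {L : W → Prop} (h : S.Recognizes (Fin k × Fin r) L) :
    (pad r S).Recognizes (Option (Fin k)) L := by
  refine h.of_encoding
    (fun x c o => o.elim 0 fun j => posVal (S.size x) fun i => c (j, i))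
    (fun x d => d none = 0 ∧ ∀ j, d (some j) < S.size x ^ r) ?_ ?_ ?_ ?_ ?_ ?_
  · intro x
    funext o
    cases o <;> simp [posVal_zero]
  · intro x c hc
    exact ⟨rfl, fun j => posVal_lt fun i => hc (j, i)⟩
  · rintro x d ⟨h1, h2⟩
    refine ⟨fun a => d (some a.1) / S.size x ^ (a.2 : ℕ) % S.size x,
      fun a => digit_lt_size x _ _, ?_⟩
    funext o
    cases o with
    | none => exact h1.symm
    | some j => exact posVal_digit (h2 j)
  · intro x c c' hc hc' h
    funext ⟨j, i⟩
    have := congrFun h (some j)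
    exact congrFun (posVal_injective (fun i => hc (j, i)) (fun i => hc' (j, i)) this) i
  · rintro ⟨j, i⟩ B
    refine ⟨_, test_digit (some j) i B, fun x c hc => ?_⟩
    simp only [Option.elim_some, digit_posVal (c := fun i => c (j, i)) (fun i => hc (j, i))]
  · rintro ⟨j, i⟩
    refine ⟨_, Prog.guard (test_digit_not_max (some j) i)
      (prog_shift (a := some j) (b := none) (by simp) _ (fun x => S.size x ^ (i : ℕ))
      (fun x => Nat.pow_pos (S.size_pos x)) fun x p hp => pad_full_single hp i), ?_, ?_⟩
    · rintro x d _ ⟨-, h0, h1, rfl⟩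
      have h1 : d (some j) + S.size x ^ (i : ℕ) < S.size x ^ r := h1
      simp only [ne_eq, reduceCtorEq, not_false_eq_true, Function.update_of_ne]
      refine and_congr_right fun _ => ⟨fun h a => ?_, fun h a => ?_⟩
      · by_cases ha : a = j
        · subst ha; simpa
        · simpa [ha] using h a
      · by_cases ha : a = j
        · subst ha; omega
        · simpa [ha] using h a
    · intro x c d hc
      have hcj : ∀ i, (fun i => c (j, i)) i < S.size x := fun i => hc (j, i)
      have hupd : (fun i' => Function.update c (j, i) (c (j, i) + 1) (j, i')) =
          Function.update (fun i' => c (j, i')) i (c (j, i) + 1) := by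
        funext i'
        by_cases h : i' = i
        · subst h; simp
        · simp [h]
      have hval := posVal_inc (m := S.size x) (c := fun i => c (j, i)) i
      have henc : (fun o : Option (Fin k) => o.elim 0 fun j' => posVal (S.size x) fun i' =>
            Function.update c (j, i) (c (j, i) + 1) (j', i')) =
          Function.update (fun o : Option (Fin k) => o.elim 0 fun j' => posVal (S.size x) fun i' =>
            c (j', i')) (some j) ((posVal (S.size x) fun i => c (j, i)) + S.size x ^ (i : ℕ)) := by
        funext o
        cases o with
        | none => simp
        | some a =>
          by_cases ha : a = j
          · subst ha
            simp [hupd, hval]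
          · simp [ha]
      rw [henc]
      simp only [Option.elim_some, Option.elim_none, digit_posVal hcj, true_and]
      constructor
      · rintro ⟨h1, -, rfl⟩
        have := hc (j, i)
        exact ⟨by omega, rfl⟩
      · rintro ⟨h1, rfl⟩
        refine ⟨by omega, ?_, rfl⟩
        rw [← hval]
        refine posVal_lt fun i' => ?_
        by_cases h : i' = i
        · subst h; simpa
        · simpa [h] using hcj i'

end LabelledCycle

namespace LabelledCycle

variable {W : Type} {S T : LabelledCycle W} {ι κ : Type} [DecidableEq ι] [DecidableEq κ]

theorem succ_div_mod_of_lt {p n : ℕ} (h : p % n + 1 < n) :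
    (p + 1) / n = p / n ∧ (p + 1) % n = p % n + 1 := by
  rw [Nat.div_mod_unique (by omega)]
  exact ⟨by rw [add_right_comm, Nat.mod_add_div], h⟩

theorem succ_div_mod_of_eq {p n : ℕ} (h : p % n + 1 = n) :
    (p + 1) / n = p / n + 1 ∧ (p + 1) % n = 0 := by
  rw [Nat.div_mod_unique (by omega)]
  refine ⟨?_, by omega⟩
  have := Nat.mod_add_div p n
  rw [mul_add, mul_one]
  omega

theorem forall_update_lt_iff {n a : ℕ} {c : ι → ℕ} {i : ι} (hi : c i < n) (ha : a < n) :
    (∀ j, Function.update c i a j < n) ↔ ∀ j, c j < n := by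
  refine ⟨fun h j => ?_, fun h j => ?_⟩
  · by_cases hj : j = i
    · exact hj ▸ hi
    · simpa [hj] using h j
  · by_cases hj : j = i
    · subst hj; simpa
    · simpa [hj] using h j

theorem prog_reset_finset (s : Finset ι) :
    Prog (S.Heads ι) (fun x c d => (∀ i ∈ s, c i < S.size x) ∧
      d = fun i => if i ∈ s then 0 else c i) := by
  induction s using Finset.induction_on with
  | empty => exact Prog.idle.congr fun x c d => by simp [eq_comm]
  | insert a s ha ih =>
    refine (ih.comp (prog_reset a)).congr fun x c d => ?_
    constructor
    · rintro ⟨h, rfl⟩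
      refine ⟨_, ⟨fun i hi => h i (Finset.mem_insert_of_mem hi), rfl⟩, ?_, ?_⟩
      · simpa [ha] using h a (Finset.mem_insert_self a s)
      · ext i
        by_cases hi : i = a
        · subst hi; simp
        · simp [hi]
    · rintro ⟨_, ⟨h, rfl⟩, h', rfl⟩
      constructor
      · simp only [ha, if_false] at h'
        simpa [h'] using h
      · ext i
        by_cases hi : i = a
        · subst hi; simp
        · simp [hi]

/-- Machines with heads `ι` on the power can be simulated by machines with heads `ι × Fin r`. -/
theorem Recognizes.unpack {r : ℕ} {L : W → Prop} (h : (pad r S).Recognizes ι L) :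
    S.Recognizes (ι × Fin r) L := by
  refine h.of_encoding
    (fun x c a => c a.1 / S.size x ^ (a.2 : ℕ) % S.size x)
    (fun x d => ∀ a, d a < S.size x) ?_ ?_ ?_ ?_ ?_ ?_
  · intro x
    simp
  · intro x c _ a
    exact digit_lt_size x _ _
  · intro x d hd
    refine ⟨fun j => posVal (S.size x) fun i => d (j, i), fun j => posVal_lt fun i => hd (j, i), ?_⟩
    funext ⟨j, i⟩
    exact digit_posVal (c := fun i => d (j, i)) (fun i => hd (j, i)) i
  · intro x c c' hc hc' h
    funext j
    rw [← posVal_digit (hc j), ← posVal_digit (hc' j)]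
    congr
    funext i
    exact congrFun h (j, i)
  · intro j B
    refine ⟨_, test_joint (fun i => (j, i)) {u | padFull u ∈ B}, fun x c hc => ?_⟩
    rw [full_pad_digits (hc j)]
    rfl
  · intro j
    refine ⟨fun x c d => ∃ i : Fin r, (∀ i' < i, c (j, i') + 1 = S.size x) ∧
      c (j, i) + 1 < S.size x ∧ d = fun a => if a.1 = j then
        if a.2 < i then 0 else if a.2 = i then c a + 1 else c a else c a, ?_, ?_, ?_⟩
    · refine Prog.exists_finite fun i => ?_
      have h1 : Test (S.Heads (ι × Fin r))
          (fun x c => ∀ i' : Fin r, i' < i → c (j, i') + 1 = S.size x) := by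
        refine Test.forall_finite fun i' => ?_
        by_cases hi : i' < i
        · simpa [hi] using test_max (j, i')
        · simpa [hi] using Test.true
      let s : Finset (ι × Fin r) := (Finset.univ.filter fun a => a < i).image fun i' => (j, i')
      have hs : ∀ a, a ∈ s ↔ a.1 = j ∧ a.2 < i := by
        rintro ⟨j', i'⟩
        simp [s, and_comm, eq_comm]
      refine (Prog.guard h1 ((prog_reset_finset s).comp (.base (.inc (j, i))))).congr
        fun x c d => and_congr_right fun h2 => ?_
      have h3 : ∀ a ∈ s, c a < S.size x := by
        rintro ⟨j', i'⟩ ha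
        obtain ⟨rfl, hi⟩ := (hs _).1 ha
        have := h2 i' hi
        dsimp only at this ⊢
        omega
      have h4 : (fun a : ι × Fin r => if a.1 = j then
          if a.2 < i then 0 else if a.2 = i then c a + 1 else c a else c a) =
          Function.update (fun a => if a ∈ s then 0 else c a) (j, i) (c (j, i) + 1) := by
        funext ⟨j', i'⟩
        by_cases hj : j' = j
        · subst hj
          by_cases hi : i' = i
          · subst hi; simp
          · simp [hs, hi]
        · simp [hs, hj]
      have h5 : (j, i) ∉ s := by simp [hs]
      rw [h4]
      constructor
      · rintro ⟨h6, rfl⟩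
        exact ⟨_, ⟨h3, rfl⟩, by simpa [h5], by simp [h5]⟩
      · rintro ⟨_, ⟨-, rfl⟩, h6, rfl⟩
        simp only [h5, if_false] at h6 ⊢
        exact ⟨h6, trivial⟩
    · rintro x c _ ⟨i, h1, h2, rfl⟩
      constructor
      · intro h a
        have := h a
        dsimp only
        split_ifs with h3 h4 h5
        · omega
        · rwa [show a = (j, i) from Prod.ext h3 h5]
        · exact this
        · exact this
      · rintro h ⟨j', i'⟩
        have := h (j', i')
        dsimp only at this
        split_ifs at this with h3 h4 h5
        · have := h1 i' h4
          subst h3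
          omega
        · omega
        · exact this
        · exact this
    · intro x c d hc
      have hdig : ∀ i : Fin r, (fun i : Fin r => c j / S.size x ^ (i : ℕ) % S.size x) i <
        S.size x := fun i => digit_lt_size x _ _
      have hval := posVal_digit (hc j)
      have hcarry : ∀ i : Fin r,
          (∀ i' < i, c j / S.size x ^ (i' : ℕ) % S.size x + 1 = S.size x) →
          c j / S.size x ^ (i : ℕ) % S.size x + 1 < S.size x →
          c j + 1 < S.size x ^ r ∧
          (fun a : ι × Fin r => if a.1 = j then
            if a.2 < i then 0
            else if a.2 = i then c a.1 / S.size x ^ (a.2 : ℕ) % S.size x + 1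
            else c a.1 / S.size x ^ (a.2 : ℕ) % S.size x
            else c a.1 / S.size x ^ (a.2 : ℕ) % S.size x) =
          fun a => Function.update c j (c j + 1) a.1 / S.size x ^ (a.2 : ℕ) % S.size x := by
        intro i h1 h2
        have h := posVal_carry i h1
        rw [hval] at h
        have hb : ∀ a, (fun a : Fin r => if a < i then 0
            else if a = i then c j / S.size x ^ (a : ℕ) % S.size x + 1
            else c j / S.size x ^ (a : ℕ) % S.size x) a < S.size x := by
          intro a
          have := hdig a
          dsimp only at this ⊢
          split_ifs with h4 h5
          · omega
          · rwa [h5]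
          · exact this
        refine ⟨h ▸ posVal_lt hb, ?_⟩
        funext ⟨j', i'⟩
        by_cases hj : j' = j
        · subst hj
          have h3 := digit_posVal hb i'
          rw [h] at h3
          simp [h3]
        · simp [hj]
      constructor
      · rintro ⟨i, h1, h2, rfl⟩
        exact hcarry i h1 h2
      · rintro ⟨h, rfl⟩
        have hne : ∃ i : Fin r, c j / S.size x ^ (i : ℕ) % S.size x + 1 ≠ S.size x := by
          by_contra hne
          push Not at hne
          have := (posVal_eq_max_iff (S.size_pos x) hdig).2 hne
          rw [hval] at this
          have h : c j + 1 < S.size x ^ r := h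
          omega
        obtain ⟨i, hi, hmin⟩ := WellFounded.has_min (wellFounded_lt (α := Fin r))
          {i | c j / S.size x ^ (i : ℕ) % S.size x + 1 ≠ S.size x} hne
        have h1 : ∀ i' < i, c j / S.size x ^ (i' : ℕ) % S.size x + 1 = S.size x := by
          intro i' hi'
          by_contra h
          exact hmin i' h hi'
        have h2 : c j / S.size x ^ (i : ℕ) % S.size x + 1 < S.size x := by
          have h3 := hdig i
          have h4 : c j / S.size x ^ (i : ℕ) % S.size x + 1 ≠ S.size x := hi
          dsimp only at h3
          omega
        exact ⟨i, h1, h2, (hcarry i h1 h2).2.symm⟩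

/-- Low digits `a`, followed by the digit of `b` at `j`. -/
def joinDigits {k : ℕ} (j : Fin k) (a b : Fin k → S.Full) (i : Fin (k + 1)) : S.Full :=
  if h : (i : ℕ) < k then a ⟨i, h⟩ else b j

theorem Recognizes.lend {k : ℕ} {L : W → Prop} (h : (pad (k + 1) S).Recognizes (Fin k) L) :
    (pad k S).Recognizes (Option (Fin k)) L := by
  have hpos : ∀ x, 0 < S.size x ^ k := fun x => Nat.pow_pos (S.size_pos x)
  have hdiv : ∀ x p, p < S.size x ^ (k + 1) → p / S.size x ^ k < S.size x := fun x p hp =>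
    Nat.div_lt_of_lt_mul (by rwa [← pow_succ])
  refine h.of_encoding
    (fun x c o => o.elim (posVal (S.size x) fun j => c j / S.size x ^ k)
      fun j => c j % S.size x ^ k)
    (fun x d => ∀ o, d o < S.size x ^ k) ?_ ?_ ?_ ?_ ?_ ?_
  · intro x
    funext o
    cases o <;> simp [posVal_zero]
  · intro x c hc o
    cases o with
    | none => exact posVal_lt fun i => hdiv x _ (hc i)
    | some j => exact Nat.mod_lt _ (hpos x)
  · intro x d hd
    have h1 : ∀ j, (d (some j) + S.size x ^ k * (d none / S.size x ^ (j : ℕ) % S.size x)) /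
        S.size x ^ k = d none / S.size x ^ (j : ℕ) % S.size x := fun j => by
      rw [Nat.add_mul_div_left _ _ (hpos x), Nat.div_eq_of_lt (hd _), zero_add]
    refine ⟨fun j => d (some j) + S.size x ^ k * (d none / S.size x ^ (j : ℕ) % S.size x),
      fun j => ?_, ?_⟩
    · have h2 := digit_lt_size (S := S) x j (d none)
      have h3 : d (some j) < S.size x ^ k := hd (some j)
      have h4 := Nat.mul_le_mul_left (S.size x ^ k) (Nat.succ_le_of_lt h2)
      rw [Nat.mul_succ] at h4
      calc _ < S.size x ^ k * S.size x := by dsimp only; omega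
        _ = _ := (pow_succ _ _).symm
    · funext o
      cases o with
      | none =>
        simp only [Option.elim_none, h1]
        exact posVal_digit (hd none)
      | some j =>
        simp only [Option.elim_some, Nat.add_mul_mod_self_left]
        exact Nat.mod_eq_of_lt (hd _)
  · intro x c c' hc hc' h
    funext j
    rw [← Nat.div_add_mod (c j) (S.size x ^ k), ← Nat.div_add_mod (c' j) (S.size x ^ k)]
    have h1 := congrFun (posVal_injective (fun i => hdiv x _ (hc i)) (fun i => hdiv x _ (hc' i))
      (congrFun h none)) j
    have h2 : c j % S.size x ^ k = c' j % S.size x ^ k := congrFun h (some j)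
    rw [show c j / S.size x ^ k = c' j / S.size x ^ k from h1, h2]
  · intro j B
    refine ⟨_, test_joint (S := pad k S) (fun b : Bool => if b then some j else none)
      {u | padFull (joinDigits j (u true).1 (u false).1) ∈ B}, fun x c hc => ?_⟩
    rw [full_pad_digits (hc j)]
    refine iff_of_eq (congrArg (padFull · ∈ B) ?_)
    funext i
    by_cases hi : (i : ℕ) < k
    · simp only [joinDigits, hi, dif_pos]
      exact congrArg (S.full x) (digit_mod_pow _ _ hi)
    · have hi' : (i : ℕ) = k := by omega
      unfold joinDigits
      rw [dif_neg hi, hi', Nat.mod_eq_of_lt (hdiv x _ (hc j))]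
      exact congrArg (S.full x) (digit_posVal (fun i => hdiv x _ (hc i)) j)
  · intro j
    have shift := prog_shift (S := pad k S) (a := none) (b := some j) (by simp) _
      (fun x => S.size x ^ (j : ℕ))
      (fun x => Nat.pow_pos (S.size_pos x)) fun x p hp => pad_full_single hp j
    refine ⟨_, (Prog.base (.inc (some j))).union (Prog.guard ((test_max (some j)).and
      (test_digit_not_max none j)) ((prog_reset (some j)).comp shift)), ?_, ?_⟩
    · rintro x c d (⟨h, rfl⟩ | ⟨⟨h1, h2⟩, _, ⟨-, rfl⟩, h3, h4, rfl⟩)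
      · exact (forall_update_lt_iff (Nat.lt_of_succ_lt h) h).symm
      · have h4 : Function.update c (some j) 0 none + S.size x ^ (j : ℕ) < S.size x ^ k := h4
        exact ((forall_update_lt_iff (lt_of_le_of_lt (Nat.le_add_right _ _) h4) h4).trans
          (forall_update_lt_iff (lt_of_lt_of_eq (Nat.lt_succ_self _) h1) (hpos x))).symm
    · intro x c d hc
      have hdigit := digit_posVal (fun i => hdiv x _ (hc i)) j
      have hlt : c j % S.size x ^ k < S.size x ^ k := Nat.mod_lt _ (hpos x)
      have hsucc : c j + 1 < S.size x ^ (k + 1) ↔ c j % S.size x ^ k + 1 < S.size x ^ k ∨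
          c j % S.size x ^ k + 1 = S.size x ^ k ∧ c j / S.size x ^ k + 1 ≠ S.size x := by
        have h := hdiv x _ (hc j)
        rw [pow_succ, mul_comm, ← Nat.div_lt_iff_lt_mul (hpos x)]
        rcases Nat.lt_or_ge (c j % S.size x ^ k + 1) (S.size x ^ k) with h1 | h1
        · simp only [succ_div_mod_of_lt h1, h, h1, true_or]
        · have h1 : c j % S.size x ^ k + 1 = S.size x ^ k := by omega
          rw [(succ_div_mod_of_eq h1).1]
          omega
      have henc1 : c j % S.size x ^ k + 1 < S.size x ^ k →
          (fun o : Option (Fin k) => o.elim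
            (posVal (S.size x) fun j' => Function.update c j (c j + 1) j' / S.size x ^ k)
            fun j' => Function.update c j (c j + 1) j' % S.size x ^ k) =
          Function.update (fun o : Option (Fin k) => o.elim
            (posVal (S.size x) fun j' => c j' / S.size x ^ k)
            fun j' => c j' % S.size x ^ k) (some j) (c j % S.size x ^ k + 1) := by
        intro h
        obtain ⟨h1, h2⟩ := succ_div_mod_of_lt h
        funext o
        cases o with
        | none =>
          simp only [Option.elim_none, ne_eq, reduceCtorEq, not_false_eq_true,
            Function.update_of_ne]
          congr 1
          funext i
          by_cases hi : i = j
          · subst hi; simp [h1]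
          · simp [hi]
        | some i =>
          by_cases hi : i = j
          · subst hi; simp [h2]
          · simp [hi]
      have henc2 : c j % S.size x ^ k + 1 = S.size x ^ k →
          (fun o : Option (Fin k) => o.elim
            (posVal (S.size x) fun j' => Function.update c j (c j + 1) j' / S.size x ^ k)
            fun j' => Function.update c j (c j + 1) j' % S.size x ^ k) =
          Function.update (Function.update (fun o : Option (Fin k) => o.elim
            (posVal (S.size x) fun j' => c j' / S.size x ^ k)
            fun j' => c j' % S.size x ^ k) (some j) 0) none
            ((posVal (S.size x) fun j' => c j' / S.size x ^ k) + S.size x ^ (j : ℕ)) := by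
        intro h
        obtain ⟨h1, h2⟩ := succ_div_mod_of_eq h
        funext o
        cases o with
        | none =>
          simp only [Option.elim_none, Function.update_self, ← posVal_inc]
          congr 1
          funext i
          by_cases hi : i = j
          · subst hi; simp [h1]
          · simp [hi]
        | some i =>
          by_cases hi : i = j
          · subst hi; simp [h2]
          · simp [hi]
      constructor
      · rintro (⟨h, rfl⟩ | ⟨⟨h1, h2⟩, _, ⟨-, rfl⟩, h3, h4, rfl⟩)
        · exact ⟨hsucc.2 (.inl h), (henc1 h).symm⟩
        · refine ⟨hsucc.2 (.inr ⟨h1, ?_⟩), (henc2 h1).symm⟩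
          rw [← hdigit]
          exact h2
      · rintro ⟨h, rfl⟩
        rcases hsucc.1 h with h | ⟨h, h'⟩
        · exact .inl ⟨h, henc1 h⟩
        · refine .inr ⟨⟨h, ?_⟩, _, ⟨?_, rfl⟩, ?_, ?_, ?_⟩
          · rw [← hdigit] at h'
            exact h'
          · exact Nat.mod_lt _ (hpos x)
          · simp
          · simp only [ne_eq, reduceCtorEq, not_false_eq_true, Function.update_of_ne,
              Option.elim_none, ← posVal_inc]
            refine posVal_lt fun i => ?_
            revert i
            have h3 := hdiv x _ (hc j)
            exact (forall_update_lt_iff (c := fun i => c i / S.size x ^ k) h3 (by omega)).2 fun i => hdiv x _ (hc i)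
          · exact henc2 h

end LabelledCycle

namespace LabelledCycle

variable {W : Type} {S : LabelledCycle W} {ι κ : Type} [DecidableEq ι] [DecidableEq κ]

theorem Recognizes.of_card_le [Fintype ι] [Fintype κ] {L : W → Prop} (h : S.Recognizes κ L)
    (hc : Fintype.card κ ≤ Fintype.card ι) : S.Recognizes ι L := by
  obtain ⟨f⟩ := Function.Embedding.nonempty_of_card_le hc
  exact h.mono f.injective

/-- If the last of `k + 1` heads is always dispensable, then so are all but boundedly many. -/
theorem Recognizes.collapse {k : ℕ} (hk : 1 ≤ k)
    (H : ∀ (T : LabelledCycle W) (L : W → Prop),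
      T.Recognizes (Fin (k + 1)) L → T.Recognizes (Fin k) L)
    {L : W → Prop} {n : ℕ} (h : S.Recognizes (Fin n) L) :
    S.Recognizes (Fin (k * k * (k + 1))) L := by
  have H' : ∀ T : LabelledCycle W, T.Recognizes (Option (Fin k)) L → T.Recognizes (Fin k) L :=
    fun T hT => H T L (hT.of_card_le (by simp))
  have step : ∀ t, S.Recognizes (Fin k × Fin ((k + 1) * t)) L →
      S.Recognizes ((Fin k × Fin k) × Fin t) L :=
    fun t ht => (H' _ (H' _ ht.pack.pad_mul).lend).unpack.unpack
  induction n using Nat.strong_induction_on with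
  | _ n ih =>
    rcases Nat.lt_or_ge (k * k * (k + 1)) n with hn | hn
    · set q := n / (k * (k + 1)) with hq
      have h1 : k * (k + 1) * q ≤ n := Nat.mul_div_le _ _
      have h2 : n < k * (k + 1) * (q + 1) := by
        rw [mul_comm, ← Nat.div_lt_iff_lt_mul (by positivity)]
        exact Nat.lt_succ_self _
      refine ih (k * k * (q + 1)) ?_ ((step (q + 1) (h.of_card_le ?_)).of_card_le (by simp))
      · nlinarith
      · simp only [Fintype.card_fin, Fintype.card_prod]
        nlinarith
    · exact h.of_card_le (by simpa using hn)

end LabelledCycle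

namespace LabelledCycle

variable {W : Type} (S : LabelledCycle W) {m : ℕ}

/-- Number of letters used to spell out a cell. -/
noncomputable def width : ℕ := Nat.card S.Full + 1

noncomputable def code (a : S.Full) : ℕ := Finite.equivFin S.Full a

/-- The symbol at the offset `o` in the word spelling out a cell where `a` is seen. -/
noncomputable def sym (a : S.Full) (o : ℕ) : Option Bool :=
  open Classical in if a.2.1 ∧ o = 0 then none else some (decide (o = S.code a + 1))

/-- A word spelling out the row of cells presented by `S` on input `x`. -/
noncomputable def word (x : W) : List Bool :=
  List.ofFn fun i : Fin (S.width * S.size x - 1) =>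
    decide (((i : ℕ) + 1) % S.width = S.code (S.full x (((i : ℕ) + 1) / S.width)) + 1)

variable {S}

theorem width_pos : 0 < S.width := Nat.succ_pos _

theorem code_lt (a : S.Full) : S.code a + 1 < S.width :=
  Nat.succ_lt_succ (Fin.is_lt _)

theorem code_injective : Function.Injective S.code :=
  Fin.val_injective.comp (Finite.equivFin S.Full).injective

theorem length_word (x : W) : (S.word x).length + 1 = S.width * S.size x := by
  have := Nat.mul_pos (width_pos (S := S)) (S.size_pos x)
  simp only [word, List.length_ofFn]
  omega

theorem symbolAt_word (x : W) {y : ℕ} (hy : y < S.width * S.size x) :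
    symbolAt (S.word x) (y : ZMod ((S.word x).length + 1)) =
      S.sym (S.full x (y / S.width)) (y % S.width) := by
  have hval : (y : ZMod ((S.word x).length + 1)).val = y := by
    rw [ZMod.val_natCast, length_word, Nat.mod_eq_of_lt hy]
  have h0 : y = 0 ↔ (S.full x (y / S.width)).2.1 ∧ y % S.width = 0 := by
    constructor
    · rintro rfl
      simp [full]
    · rintro ⟨h1, h2⟩
      have h1 : y / S.width = 0 := h1
      rw [← Nat.div_add_mod y S.width, h1, h2, mul_zero]
  unfold symbolAt sym
  rw [hval]
  by_cases h : y = 0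
  · rw [if_pos h, if_pos (h0.1 h)]
  · rw [if_neg h, if_neg (mt h0.2 h)]
    have h1 : y - 1 < S.width * S.size x - 1 := by omega
    have h2 : y - 1 + 1 = y := by omega
    simp [word, List.getD_eq_getElem?_getD, h1, h2]

/-- The heads of an automaton, as offsets `o` in cells `c`. -/
noncomputable def place (x : W) (c : Fin m → ℕ) (o : Fin m → Fin S.width) :
    Fin m → ZMod ((S.word x).length + 1) :=
  fun j => ((S.width * c j + o j : ℕ) : ZMod _)

theorem place_lt {x : W} {p o : ℕ} (hp : p < S.size x) (ho : o < S.width) :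
    S.width * p + o < S.width * S.size x := by
  have := Nat.mul_le_mul_left S.width (Nat.succ_le_of_lt hp)
  rw [Nat.mul_succ] at this
  omega

theorem place_injective {x : W} {c d : Fin m → ℕ} {o o' : Fin m → Fin S.width}
    (hc : ∀ j, c j < S.size x) (hd : ∀ j, d j < S.size x) (h : place x c o = place x d o') :
    c = d ∧ o = o' := by
  have key : ∀ j, c j = d j ∧ (o j : ℕ) = o' j := by
    intro j
    have h := congrFun h j
    simp only [place] at h
    rw [ZMod.natCast_eq_natCast_iff', length_word,
      Nat.mod_eq_of_lt (place_lt (hc j) (o j).isLt),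
      Nat.mod_eq_of_lt (place_lt (hd j) (o' j).isLt)] at h
    have h1 := congrArg (· / S.width) h
    have h2 := congrArg (· % S.width) h
    simp only [Nat.mul_add_div (width_pos (S := S)), Nat.div_eq_of_lt (Fin.is_lt _), add_zero,
      Nat.mul_add_mod, Nat.mod_eq_of_lt (Fin.is_lt _)] at h1 h2
    exact ⟨h1, h2⟩
  exact ⟨funext fun j => (key j).1, funext fun j => Fin.ext (key j).2⟩

theorem place_surjective (x : W) (p : Fin m → ZMod ((S.word x).length + 1)) :
    ∃ (c : Fin m → ℕ) (o : Fin m → Fin S.width), (∀ j, c j < S.size x) ∧ place x c o = p := by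
  refine ⟨fun j => (p j).val / S.width,
    fun j => ⟨(p j).val % S.width, Nat.mod_lt _ width_pos⟩, fun j => ?_, funext fun j => ?_⟩
  · refine Nat.div_lt_of_lt_mul ?_
    rw [← length_word]
    exact ZMod.val_lt _
  · simp only [place, Nat.div_add_mod]
    exact ZMod.natCast_zmod_val _

theorem symbolAt_place {x : W} {c : Fin m → ℕ} {o : Fin m → Fin S.width}
    (hc : ∀ j, c j < S.size x) (j : Fin m) :
    symbolAt (S.word x) (place x c o j) = S.sym (S.full x (c j)) (o j) := by
  simp only [place]
  rw [symbolAt_word x (place_lt (hc j) (o j).isLt), Nat.mul_add_div width_pos,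
    Nat.div_eq_of_lt (Fin.is_lt _), add_zero, Nat.mul_add_mod, Nat.mod_eq_of_lt (Fin.is_lt _)]

/-- Moving the head `i` one letter to the right changes the offsets from `o` to `o'`. -/
def Right (i : Fin m) (o o' : Fin m → Fin S.width) : Fam W (Fin m → ℕ) := fun x c d =>
  (∃ h : (o i : ℕ) + 1 < S.width, o' = Function.update o i ⟨o i + 1, h⟩ ∧ c = d) ∨
  ((o i : ℕ) + 1 = S.width ∧ o' = Function.update o i ⟨0, width_pos⟩ ∧
    ((c i + 1 < S.size x ∧ d = Function.update c i (c i + 1)) ∨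
      (c i + 1 = S.size x ∧ c i < S.size x ∧ d = Function.update c i 0)))

theorem prog_right (i : Fin m) (o o' : Fin m → Fin S.width) :
    Prog (S.Heads (Fin m)) (Right i o o') := by
  have h1 := Prog.guard (Test.const (P := S.Heads (Fin m))
    (∃ h : (o i : ℕ) + 1 < S.width, o' = Function.update o i ⟨o i + 1, h⟩)) Prog.idle
  have h2 := Prog.guard (Test.const (P := S.Heads (Fin m))
    ((o i : ℕ) + 1 = S.width ∧ o' = Function.update o i ⟨0, width_pos⟩))
    ((Prog.base (.inc i)).union (Prog.guard (test_max i) (prog_reset i)))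
  refine (h1.union h2).congr fun x c d => ?_
  simp only [Right, exists_and_right, and_assoc]

theorem Right.bounded {i : Fin m} {o o' : Fin m → Fin S.width} {x : W} {c d : Fin m → ℕ}
    (h : Right i o o' x c d) : (∀ j, c j < S.size x) ↔ ∀ j, d j < S.size x := by
  rcases h with ⟨_, _, rfl⟩ | ⟨_, _, ⟨h, rfl⟩ | ⟨h, h', rfl⟩⟩
  · rfl
  · exact (forall_update_lt_iff (Nat.lt_of_succ_lt h) h).symm
  · exact (forall_update_lt_iff h' (S.size_pos x)).symm

theorem Right.place_eq {i : Fin m} {o o' : Fin m → Fin S.width} {x : W} {c d : Fin m → ℕ}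
    (h : Right i o o' x c d) :
    place x d o' = Function.update (place x c o) i (place x c o i + 1) := by
  rcases h with ⟨h, rfl, rfl⟩ | ⟨h, rfl, ⟨-, rfl⟩ | ⟨h1, -, rfl⟩⟩ <;> funext j <;>
    by_cases hj : j = i
  · subst hj
    simp only [place, Function.update_self]
    push_cast
    ring
  · simp [place, hj]
  · subst hj
    simp only [place, Function.update_self]
    rw [← Nat.cast_succ, Nat.mul_succ, add_zero, Nat.succ_eq_add_one, add_assoc, h]
  · simp [place, hj]
  · subst hj
    simp only [place, Function.update_self]
    have h2 : S.width * c j + o j + 1 = (S.word x).length + 1 := by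
      rw [length_word, ← h1, Nat.mul_succ, add_assoc, h]
    rw [← Nat.cast_succ, Nat.succ_eq_add_one, h2, ZMod.natCast_self]
    simp
  · simp [place, hj]

theorem right_iff {i : Fin m} {o o' : Fin m → Fin S.width} {x : W} {c d : Fin m → ℕ}
    (hc : ∀ j, c j < S.size x) (hd : ∀ j, d j < S.size x) :
    Right i o o' x c d ↔
      place x d o' = Function.update (place x c o) i (place x c o i + 1) := by
  refine ⟨Right.place_eq, fun h => ?_⟩
  have : ∃ d'' o'', Right i o o'' x c d'' := by
    rcases Nat.lt_or_ge ((o i : ℕ) + 1) S.width with h1 | h1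
    · exact ⟨c, _, .inl ⟨h1, rfl, rfl⟩⟩
    · have h1 : (o i : ℕ) + 1 = S.width := by omega
      rcases Nat.lt_or_ge (c i + 1) (S.size x) with h2 | h2
      · exact ⟨_, _, .inr ⟨h1, rfl, .inl ⟨h2, rfl⟩⟩⟩
      · have := hc i
        exact ⟨_, _, .inr ⟨h1, rfl, .inr ⟨by omega, this, rfl⟩⟩⟩
  obtain ⟨d'', o'', hright⟩ := this
  obtain ⟨rfl, rfl⟩ := place_injective hd (hright.bounded.1 hc) (h.trans hright.place_eq.symm)
  exact hright

/-- A step of the automaton `M` which changes the state and the offsets from `f` to `g`. -/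
def SlicedStep (M : TwoWayAutomaton m) (f g : Fin M.n × (Fin m → Fin S.width)) :
    Fam W (Fin m → ℕ) := fun x c d =>
  ∃ t : (Fin m → Option Bool) × Fin m × Bool,
    ((t.1, f.1), (t.2, g.1)) ∈ M.trans ∧
    (∀ j, S.full x (c j) ∈ {a | S.sym a (f.2 j) = t.1 j}) ∧
    if t.2.2 then Right t.2.1 f.2 g.2 x c d else Right t.2.1 g.2 f.2 x d c

theorem prog_slicedStep (M : TwoWayAutomaton m) (f g : Fin M.n × (Fin m → Fin S.width)) :
    Prog (S.Heads (Fin m)) (SlicedStep M f g) := by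
  refine Prog.exists_finite fun t => Prog.guard (Test.const _)
    (Prog.guard (Test.forall_finite fun j => test_full j _) ?_)
  cases t.2.2
  · exact (converse (prog_right t.2.1 g.2 f.2)).congr fun x c d => by simp
  · exact (prog_right t.2.1 f.2 g.2).congr fun x c d => by simp

theorem slicedStep_bounded {M : TwoWayAutomaton m} {f g : Fin M.n × (Fin m → Fin S.width)}
    {x : W} {c d : Fin m → ℕ} (hc : ∀ j, c j < S.size x) (h : SlicedStep M f g x c d) :
    ∀ j, d j < S.size x := by
  obtain ⟨t, -, -, h⟩ := h
  split_ifs at h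
  · exact h.bounded.1 hc
  · exact h.bounded.2 hc

theorem slicedStep_iff {M : TwoWayAutomaton m} {f g : Fin M.n × (Fin m → Fin S.width)}
    {x : W} {c d : Fin m → ℕ} (hc : ∀ j, c j < S.size x) (hd : ∀ j, d j < S.size x) :
    SlicedStep M f g x c d ↔
      Step M (S.word x) (place x c f.2, f.1) (place x d g.2, g.1) := by
  have hmove : ∀ (i : Fin m) (e : Bool), (if e then Right i f.2 g.2 x c d else Right i g.2 f.2 x d c) ↔
      place x d g.2 = Function.update (place x c f.2) i
        (place x c f.2 i + if e then 1 else -1) := by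
    intro i e
    cases e
    · simp only [Bool.false_eq_true, if_false]
      rw [right_iff hd hc]
      constructor
      · intro h
        rw [h]
        simp
      · intro h
        rw [h]
        simp
    · simp only [if_true]
      exact right_iff hc hd
  constructor
  · rintro ⟨⟨s, i, e⟩, h1, h2, h3⟩
    refine ⟨s, i, e, g.1, h1, fun j => ?_, Prod.ext ((hmove i e).1 h3) rfl⟩
    rw [symbolAt_place hc]
    exact h2 j
  · rintro ⟨s, i, e, q, h1, h2, h3⟩
    obtain ⟨h3, rfl⟩ := Prod.ext_iff.1 h3
    refine ⟨(s, i, e), h1, fun j => ?_, (hmove i e).2 h3⟩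
    have := h2 j
    rwa [symbolAt_place hc] at this

/-- Nonacceptance by a two-way automaton on the words `S.word x` is recognized by a machine on `S`
with as many heads. -/
theorem recognizes_not_accepts (S : LabelledCycle W) (M : TwoWayAutomaton m) :
    S.Recognizes (Fin m) (fun x => ¬ Accepts M (S.word x)) := by
  refine ⟨_, Prog.exists_finite fun o : Fin m → Fin S.width =>
    Prog.reflTransGen_finite (prog_slicedStep M) (M.init, fun _ => ⟨0, width_pos⟩) (M.reject, o),
    fun x => ?_⟩
  refine not_not.trans ?_
  constructor
  · rintro ⟨⟨p, q⟩, h, rfl⟩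
    have key : ∀ r, Relation.ReflTransGen (Step M (S.word x)) (fun _ => 0, M.init) r →
        ∀ d o, (∀ j, d j < S.size x) → place x d o = r.1 →
        Relation.ReflTransGen
          (fun a b : (Fin m → ℕ) × Fin M.n × (Fin m → Fin S.width) =>
            SlicedStep M a.2 b.2 x a.1 b.1)
          (fun _ => 0, (M.init, fun _ => ⟨0, width_pos⟩)) (d, (r.2, o)) := by
      intro r hr
      induction hr with
      | refl =>
        intro d o hd h
        obtain ⟨rfl, rfl⟩ := place_injective (d := fun _ => 0) (o' := fun _ => ⟨0, width_pos⟩) hd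
          (fun _ => S.size_pos x) (h.trans (by funext j; simp [place]))
        exact .refl
      | @tail r r' _ hs ih =>
        intro d' o' hd' h'
        obtain ⟨d, o, hd, h⟩ := place_surjective x r.1
        refine (ih d o hd h).tail ?_
        refine (slicedStep_iff (f := (r.2, o)) (g := (r'.2, o')) hd hd').2 ?_
        rw [h, h']
        exact hs
    obtain ⟨d, o, hd, h'⟩ := place_surjective x p
    exact ⟨d, o, key _ h d o hd h'⟩
  · rintro ⟨d, o, h⟩
    have key : ∀ r : (Fin m → ℕ) × Fin M.n × (Fin m → Fin S.width),
        Relation.ReflTransGen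
          (fun a b : (Fin m → ℕ) × Fin M.n × (Fin m → Fin S.width) =>
            SlicedStep M a.2 b.2 x a.1 b.1)
          (fun _ => 0, (M.init, fun _ => ⟨0, width_pos⟩)) r →
        (∀ j, r.1 j < S.size x) ∧ Relation.ReflTransGen (Step M (S.word x)) (fun _ => 0, M.init)
          (place x r.1 r.2.2, r.2.1) := by
      intro r hr
      induction hr with
      | refl =>
        refine ⟨fun _ => S.size_pos x, ?_⟩
        convert Relation.ReflTransGen.refl
        simp [place]
      | @tail r r' _ hs ih =>
        have hd' := slicedStep_bounded ih.1 hs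
        exact ⟨hd', ih.2.tail ((slicedStep_iff ih.1 hd').1 hs)⟩
    exact ⟨_, (key _ h).2, rfl⟩

end LabelledCycle

section Network

variable {W A Q Q' : Type}

/-- Steps in a network whose edges are labelled by families of relations. -/
def NetStep (E : Q → Q → Fam W A → Prop) (x : W) (p p' : A × Q) : Prop :=
  ∃ R, E p.2 p'.2 R ∧ R x p.1 p'.1

namespace NetStep

theorem lift {E : Q → Q → Fam W A → Prop} {E' : Q' → Q' → Fam W A → Prop} {f : Q → Q'}
    (h : ∀ q r R, E q r R → E' (f q) (f r) R) {x : W} {c d : A} {q r : Q}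
    (hp : Relation.ReflTransGen (NetStep E x) (c, q) (d, r)) :
    Relation.ReflTransGen (NetStep E' x) (c, f q) (d, f r) := by
  refine hp.lift (fun p : A × Q => (p.1, f p.2)) ?_
  rintro p p' ⟨R, h1, h2⟩
  exact ⟨R, h _ _ _ h1, h2⟩

/-- The edges of the sequential composition of two networks. -/
inductive CompEdge (E : Q → Q → Fam W A → Prop) (b : Q) (E' : Q' → Q' → Fam W A → Prop) (a : Q') :
    Q ⊕ Q' → Q ⊕ Q' → Fam W A → Prop
  | left {q r R} : E q r R → CompEdge E b E' a (.inl q) (.inl r) R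
  | right {q r R} : E' q r R → CompEdge E b E' a (.inr q) (.inr r) R
  | link : CompEdge E b E' a (.inl b) (.inr a) (fun _ c d => c = d)

/-- The edges of the union of two networks. -/
inductive UnionEdge (E : Q → Q → Fam W A → Prop) (a b : Q) (E' : Q' → Q' → Fam W A → Prop)
    (a' b' : Q') : Bool ⊕ Q ⊕ Q' → Bool ⊕ Q ⊕ Q' → Fam W A → Prop
  | left {q r R} : E q r R → UnionEdge E a b E' a' b' (.inr (.inl q)) (.inr (.inl r)) R
  | right {q r R} : E' q r R → UnionEdge E a b E' a' b' (.inr (.inr q)) (.inr (.inr r)) R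
  | enter_left : UnionEdge E a b E' a' b' (.inl false) (.inr (.inl a)) (fun _ c d => c = d)
  | enter_right : UnionEdge E a b E' a' b' (.inl false) (.inr (.inr a')) (fun _ c d => c = d)
  | leave_left : UnionEdge E a b E' a' b' (.inr (.inl b)) (.inl true) (fun _ c d => c = d)
  | leave_right : UnionEdge E a b E' a' b' (.inr (.inr b')) (.inl true) (fun _ c d => c = d)

/-- The edges of the iteration of a network. -/
inductive StarEdge (E : Q → Q → Fam W A → Prop) (a b : Q) :
    Option Q → Option Q → Fam W A → Prop
  | inside {q r R} : E q r R → StarEdge E a b (some q) (some r) R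
  | enter : StarEdge E a b none (some a) (fun _ c d => c = d)
  | leave : StarEdge E a b (some b) none (fun _ c d => c = d)

theorem comp_iff {E : Q → Q → Fam W A → Prop} {a b : Q} {E' : Q' → Q' → Fam W A → Prop} {a' b' : Q'}
    {x : W} {c d : A} :
    Relation.ReflTransGen (NetStep (CompEdge E b E' a') x) (c, .inl a) (d, .inr b') ↔
      ∃ e, Relation.ReflTransGen (NetStep E x) (c, a) (e, b) ∧
        Relation.ReflTransGen (NetStep E' x) (e, a') (d, b') := by
  constructor
  · have key : ∀ p, Relation.ReflTransGen (NetStep (CompEdge E b E' a') x) (c, .inl a) p →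
        p.2.elim (fun q => Relation.ReflTransGen (NetStep E x) (c, a) (p.1, q))
          (fun q => ∃ e, Relation.ReflTransGen (NetStep E x) (c, a) (e, b) ∧
            Relation.ReflTransGen (NetStep E' x) (e, a') (p.1, q)) := by
      intro p hp
      induction hp with
      | refl => exact .refl
      | @tail p p' _ hs ih =>
        obtain ⟨c1, q1⟩ := p
        obtain ⟨c2, q2⟩ := p'
        obtain ⟨R, h1, h2⟩ := hs
        cases h1 with
        | left h => exact ih.tail ⟨R, h, h2⟩
        | right h =>
          obtain ⟨e, h3, h4⟩ := ih
          exact ⟨e, h3, h4.tail ⟨R, h, h2⟩⟩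
        | link =>
          cases h2
          exact ⟨_, ih, .refl⟩
    exact key _
  · rintro ⟨e, h1, h2⟩
    exact ((lift (E' := CompEdge E b E' a') (fun _ _ _ => .left) h1).tail
      ⟨_, .link, rfl⟩).trans (lift (fun _ _ _ => .right) h2)

theorem union_iff {E : Q → Q → Fam W A → Prop} {a b : Q} {E' : Q' → Q' → Fam W A → Prop}
    {a' b' : Q'} {x : W} {c d : A} :
    Relation.ReflTransGen (NetStep (UnionEdge E a b E' a' b') x) (c, .inl false) (d, .inl true) ↔
      Relation.ReflTransGen (NetStep E x) (c, a) (d, b) ∨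
        Relation.ReflTransGen (NetStep E' x) (c, a') (d, b') := by
  constructor
  · have key : ∀ p,
        Relation.ReflTransGen (NetStep (UnionEdge E a b E' a' b') x) (c, .inl false) p →
        match p.2 with
        | .inl false => p.1 = c
        | .inl true => Relation.ReflTransGen (NetStep E x) (c, a) (p.1, b) ∨
            Relation.ReflTransGen (NetStep E' x) (c, a') (p.1, b')
        | .inr (.inl q) => Relation.ReflTransGen (NetStep E x) (c, a) (p.1, q)
        | .inr (.inr q) => Relation.ReflTransGen (NetStep E' x) (c, a') (p.1, q) := by
      intro p hp
      induction hp with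
      | refl => rfl
      | @tail p p' _ hs ih =>
        obtain ⟨c1, q1⟩ := p
        obtain ⟨c2, q2⟩ := p'
        obtain ⟨R, h1, h2⟩ := hs
        cases h1 with
        | left h => exact ih.tail ⟨R, h, h2⟩
        | right h => exact ih.tail ⟨R, h, h2⟩
        | enter_left =>
          cases h2
          cases ih
          exact .refl
        | enter_right =>
          cases h2
          cases ih
          exact .refl
        | leave_left =>
          cases h2
          exact .inl ih
        | leave_right =>
          cases h2
          exact .inr ih
    exact key _
  · rintro (h | h)
    · exact (Relation.ReflTransGen.head ⟨_, .enter_left, rfl⟩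
        (lift (E' := UnionEdge E a b E' a' b') (f := fun q => .inr (.inl q))
          (fun _ _ _ => .left) h)).tail ⟨_, .leave_left, rfl⟩
    · exact (Relation.ReflTransGen.head ⟨_, .enter_right, rfl⟩
        (lift (E' := UnionEdge E a b E' a' b') (f := fun q => .inr (.inr q))
          (fun _ _ _ => .right) h)).tail ⟨_, .leave_right, rfl⟩

theorem star_iff {E : Q → Q → Fam W A → Prop} {a b : Q} {x : W} {c d : A} :
    Relation.ReflTransGen (NetStep (StarEdge E a b) x) (c, none) (d, none) ↔
      Relation.ReflTransGen
        (fun c d => Relation.ReflTransGen (NetStep E x) (c, a) (d, b)) c d := by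
  constructor
  · have key : ∀ p, Relation.ReflTransGen (NetStep (StarEdge E a b) x) (c, none) p →
        match p.2 with
        | none => Relation.ReflTransGen
            (fun c d => Relation.ReflTransGen (NetStep E x) (c, a) (d, b)) c p.1
        | some q => ∃ e, Relation.ReflTransGen
            (fun c d => Relation.ReflTransGen (NetStep E x) (c, a) (d, b)) c e ∧
              Relation.ReflTransGen (NetStep E x) (e, a) (p.1, q) := by
      intro p hp
      induction hp with
      | refl => exact .refl
      | @tail p p' _ hs ih =>
        obtain ⟨c1, q1⟩ := p
        obtain ⟨c2, q2⟩ := p'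
        obtain ⟨R, h1, h2⟩ := hs
        cases h1 with
        | inside h =>
          obtain ⟨e, h3, h4⟩ := ih
          exact ⟨e, h3, h4.tail ⟨R, h, h2⟩⟩
        | enter =>
          cases h2
          exact ⟨_, ih, .refl⟩
        | leave =>
          cases h2
          obtain ⟨e, h3, h4⟩ := ih
          exact h3.tail h4
    exact key _
  · intro h
    induction h with
    | refl => exact .refl
    | tail _ h ih =>
      exact (ih.tail ⟨_, .enter, rfl⟩).trans
        ((lift (E' := StarEdge E a b) (f := some) (fun _ _ _ => .inside) h).tail
          ⟨_, .leave, rfl⟩)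

end NetStep

/-- Regular operations are realized by finite networks. -/
theorem Prog.exists_network {P : Fam W A → Prop} {R : Fam W A} (h : Prog P R) :
    ∃ (Q : Type) (_ : Finite Q) (E : Q → Q → Fam W A → Prop) (a b : Q),
      (∀ q r T, E q r T → T = (fun _ c d => c = d) ∨ P T) ∧
      ∀ x c d, R x c d ↔ Relation.ReflTransGen (NetStep E x) (c, a) (d, b) := by
  induction h with
  | @base R h =>
    refine ⟨Bool, inferInstance, fun q r T => q = false ∧ r = true ∧ T = R, false, true, ?_, ?_⟩
    · rintro q r T ⟨-, -, rfl⟩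
      exact .inr h
    · intro x c d
      constructor
      · intro h
        exact .single ⟨R, ⟨rfl, rfl, rfl⟩, h⟩
      · intro h
        rcases Relation.ReflTransGen.cases_head h with h | ⟨p, ⟨_, ⟨h1, h2, rfl⟩, h3⟩, h⟩
        · cases h
        · rcases Relation.ReflTransGen.cases_head h with h | ⟨p', ⟨_, ⟨h4, -, -⟩, -⟩, -⟩
          · subst h
            exact h3
          · rw [h2] at h4
            cases h4
  | idle =>
    refine ⟨Unit, inferInstance, fun _ _ _ => False, (), (), by simp, fun x c d => ?_⟩
    constructor
    · rintro rfl
      exact .refl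
    · intro h
      rcases Relation.ReflTransGen.cases_head h with h | ⟨p, ⟨_, h, -⟩, -⟩
      · cases h
        rfl
      · exact h.elim
  | empty =>
    refine ⟨Bool, inferInstance, fun _ _ _ => False, false, true, by simp, fun x c d => ?_⟩
    constructor
    · exact False.elim
    · intro h
      rcases Relation.ReflTransGen.cases_head h with h | ⟨p, ⟨_, h, -⟩, -⟩
      · cases h
      · exact h
  | comp _ _ h1 h2 =>
    obtain ⟨Q, _, E, a, b, hE, h⟩ := h1
    obtain ⟨Q', _, E', a', b', hE', h'⟩ := h2
    refine ⟨Q ⊕ Q', inferInstance, NetStep.CompEdge E b E' a', .inl a, .inr b', ?_, ?_⟩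
    · intro q r T hT
      cases hT with
      | left h => exact hE _ _ _ h
      | right h => exact hE' _ _ _ h
      | link => exact .inl rfl
    · intro x c d
      rw [NetStep.comp_iff]
      simp only [h, h']
  | union _ _ h1 h2 =>
    obtain ⟨Q, _, E, a, b, hE, h⟩ := h1
    obtain ⟨Q', _, E', a', b', hE', h'⟩ := h2
    refine ⟨Bool ⊕ Q ⊕ Q', inferInstance, NetStep.UnionEdge E a b E' a' b', .inl false,
      .inl true, ?_, ?_⟩
    · intro q r T hT
      cases hT with
      | left h => exact hE _ _ _ h
      | right h => exact hE' _ _ _ h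
      | _ => exact .inl rfl
    · intro x c d
      rw [NetStep.union_iff]
      simp only [h, h']
  | star _ h =>
    obtain ⟨Q, _, E, a, b, hE, h⟩ := h
    refine ⟨Option Q, inferInstance, NetStep.StarEdge E a b, none, none, ?_, ?_⟩
    · intro q r T hT
      cases hT with
      | inside h => exact hE _ _ _ h
      | _ => exact .inl rfl
    · intro x c d
      rw [NetStep.star_iff]
      have : (fun c d => Relation.ReflTransGen (NetStep E x) (c, a) (d, b)) = _ :=
        funext₂ fun c d => propext (h x c d).symm
      rw [this]

end Network

namespace LabelledCycle

variable {W : Type} (S : LabelledCycle W) {m : ℕ}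

variable (m) in
/-- Elementary instructions for heads moving on `ℤ`, reading the words `S.word x` periodically. -/
inductive Letterwise : Fam W (Fin m → ℤ) → Prop
  | move (i : Fin m) (e : Bool) :
    Letterwise (fun _ c d => d = Function.update c i (c i + if e then 1 else -1))
  | read (i : Fin m) (s : Option Bool) :
    Letterwise (fun x c d =>
      c = d ∧ symbolAt (S.word x) (c i : ZMod ((S.word x).length + 1)) = s)

variable {S}

theorem prog_move_right (i : Fin m) (n : ℕ) :
    Prog (S.Letterwise m) (fun _ c d => d = Function.update c i (c i + n)) := by
  induction n with
  | zero => exact Prog.idle.congr fun x c d => by simp [eq_comm]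
  | succ n ih =>
    refine (ih.comp (.base (.move i true))).congr fun x c d => ?_
    simp [add_assoc]

theorem prog_move_left (i : Fin m) (n : ℕ) :
    Prog (S.Letterwise m) (fun _ c d => d = Function.update c i (c i - n)) := by
  induction n with
  | zero => exact Prog.idle.congr fun x c d => by simp [eq_comm]
  | succ n ih =>
    refine (ih.comp (.base (.move i false))).congr fun x c d => ?_
    simp [sub_eq_add_neg, add_assoc, add_comm]

theorem test_code (i : Fin m) (T : Set S.Full) :
    Test (S.Letterwise m) (fun x c => ∃ a ∈ T, symbolAt (S.word x)
      ((c i + (S.code a + 1 : ℕ) : ℤ) : ZMod ((S.word x).length + 1)) = some true) := by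
  refine Test.congr (Test.exists_finite (f := fun (a : T) x (c : Fin m → ℤ) => symbolAt (S.word x)
    ((c i + (S.code a + 1 : ℕ) : ℤ) : ZMod ((S.word x).length + 1)) = some true) fun a => ?_)
    fun x c => by simp only [Subtype.exists, exists_prop]
  refine ((prog_move_right i (S.code a.1 + 1)).comp
    (((Prog.base (.read i (some true))).comp (prog_move_left i (S.code a.1 + 1))))).congr
    fun x c d => ?_
  constructor
  · rintro ⟨rfl, h⟩
    exact ⟨_, rfl, _, ⟨rfl, by simpa using h⟩, by simp⟩
  · rintro ⟨_, rfl, _, ⟨rfl, h⟩, rfl⟩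
    exact ⟨by simp, by simpa using h⟩

theorem symbolAt_code {x : W} {p : ℕ} (hp : p < S.size x) (a : S.Full) :
    symbolAt (S.word x) ((((S.width * p : ℕ) : ℤ) + (S.code a + 1 : ℕ) : ℤ) :
      ZMod ((S.word x).length + 1)) = some true ↔ S.full x p = a := by
  have := symbolAt_word x (place_lt hp (code_lt a))
  rw [Nat.mul_add_div width_pos, Nat.div_eq_of_lt (code_lt a), add_zero, Nat.mul_add_mod,
    Nat.mod_eq_of_lt (code_lt a)] at this
  rw [← Nat.cast_add, Int.cast_natCast, this]
  simp only [sym, Nat.succ_ne_zero, and_false, if_false, Option.some.injEq, decide_eq_true_eq,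
    Nat.add_right_cancel_iff]
  exact ⟨fun h => (code_injective h).symm, fun h => by rw [h]⟩

/-- Machines on `S` are simulated by letterwise ones. -/
theorem exists_letterwise {R : Fam W (Fin m → ℕ)} (h : Prog (S.Heads (Fin m)) R) :
    ∃ T, Prog (S.Letterwise m) T ∧ ∀ x, (∃ d, R x (fun _ => 0) d) ↔ ∃ d, T x (fun _ => 0) d := by
  let Φ : W → (Fin m → ℕ) → (Fin m → ℤ) → Prop := fun x c d =>
    (∀ j, c j < S.size x) ∧ d = fun j => ((S.width * c j : ℕ) : ℤ)
  have hΦ : ∀ x c d (T : Set S.Full) i, Φ x c d → ((∃ a ∈ T, symbolAt (S.word x)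
      ((d i + (S.code a + 1 : ℕ) : ℤ) : ZMod ((S.word x).length + 1)) = some true) ↔
        S.full x (c i) ∈ T) := by
    rintro x c _ T i ⟨hc, rfl⟩
    simp only [symbolAt_code (hc i), exists_eq_right']
  obtain ⟨T, hT, h⟩ := h.simulate (Q := S.Letterwise m) (Φ := Φ) (by
    rintro _ (i | i | ⟨i, T⟩)
    · refine ⟨_, Prog.guard (test_code i {a | ¬ a.2.2.2}) (prog_move_right i S.width),
        fun x c d hc => ?_⟩
      simp only [hΦ x c d _ i hc]
      obtain ⟨hc, rfl⟩ := hc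
      have key : c i + 1 < S.size x → Φ x (Function.update c i (c i + 1))
          (Function.update (fun j => ((S.width * c j : ℕ) : ℤ)) i
            (((S.width * c i : ℕ) : ℤ) + S.width)) := by
        intro h
        refine ⟨(forall_update_lt_iff (hc i) h).2 hc, funext fun j => ?_⟩
        by_cases hj : j = i
        · subst hj
          simp [mul_add]
        · simp [hj]
      constructor
      · rintro _ ⟨h, rfl⟩
        exact ⟨_, ⟨h.ne, rfl⟩, key h⟩
      · rintro _ ⟨h, rfl⟩
        have h : c i + 1 < S.size x := lt_of_le_of_ne (hc i) h
        exact ⟨_, ⟨h, rfl⟩, key h⟩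
    · refine ⟨_, Prog.guard (test_code i {a | ¬ a.2.1}) (prog_move_left i S.width),
        fun x c d hc => ?_⟩
      simp only [hΦ x c d _ i hc]
      obtain ⟨hc, rfl⟩ := hc
      have key : ∀ d, d i + 1 < S.size x → c = Function.update d i (d i + 1) → Φ x d
          (Function.update (fun j => ((S.width * c j : ℕ) : ℤ)) i
            (((S.width * c i : ℕ) : ℤ) - S.width)) := by
        rintro d h rfl
        refine ⟨(forall_update_lt_iff (Nat.lt_of_succ_lt h) h).1 hc, funext fun j => ?_⟩
        by_cases hj : j = i
        · subst hj
          simp [mul_add]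
        · simp [hj]
      constructor
      · rintro d ⟨h, rfl⟩
        exact ⟨_, ⟨by simp [full], rfl⟩, key d h rfl⟩
      · rintro _ ⟨h, rfl⟩
        have h : c i ≠ 0 := h
        have h1 : c i - 1 + 1 = c i := by omega
        have h2 := hc i
        refine ⟨Function.update c i (c i - 1), ⟨?_, ?_⟩, key _ ?_ ?_⟩ <;> simp [h1, h2]
    · refine ⟨_, test_code i T, fun x c d hc => ?_⟩
      simp only [hΦ x c d _ i hc]
      constructor
      · rintro _ ⟨rfl, h⟩
        exact ⟨d, ⟨rfl, h⟩, hc⟩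
      · rintro _ ⟨rfl, h⟩
        exact ⟨c, ⟨rfl, h⟩, hc⟩)
  refine ⟨T, hT, fun x => ?_⟩
  have h0 : Φ x (fun _ => 0) (fun _ => 0) := ⟨fun _ => S.size_pos x, by simp⟩
  constructor
  · rintro ⟨d, hd⟩
    obtain ⟨d', h, -⟩ := (h x _ _ h0).1 _ hd
    exact ⟨d', h⟩
  · rintro ⟨d, hd⟩
    obtain ⟨d', h, -⟩ := (h x _ _ h0).2 _ hd
    exact ⟨d', h⟩

section Automaton

variable {Q : Type} (E : Q → Q → Fam W (Fin (m + 1) → ℤ) → Prop)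

/-- Transitions of the automaton realizing a network: an edge not labelled by a move becomes a move
of the first head back and forth. -/
inductive NetTrans (S : LabelledCycle W) : (Fin (m + 1) → Option Bool) → Q ⊕ Q →
    Fin (m + 1) × Bool → Q ⊕ Q → Prop
  | move {s q r i e} : E q r (fun _ c d => d = Function.update c i (c i + if e then 1 else -1)) →
    NetTrans S s (.inl q) (i, e) (.inl r)
  | idle {s q r} : E q r (fun _ c d => c = d) → NetTrans S s (.inl q) (0, true) (.inr r)
  | read {s q r i} : E q r (fun x c d =>
      c = d ∧ symbolAt (S.word x) (c i : ZMod ((S.word x).length + 1)) = s i) →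
    NetTrans S s (.inl q) (0, true) (.inr r)
  | back {s r} : NetTrans S s (.inr r) (0, false) (.inl r)

/-- The automaton realizing a network. -/
def netAutomaton (S : LabelledCycle W) {n : ℕ} (e : Q ⊕ Q ≃ Fin n) (a b : Q) :
    TwoWayAutomaton (m + 1) where
  n := n
  init := e (.inl a)
  accept := e (.inl a)
  reject := e (.inl b)
  trans := {t | NetTrans E S t.1.1 (e.symm t.1.2) t.2.1 (e.symm t.2.2)}

variable {E}

theorem netAutomaton_step_iff {n : ℕ} {e : Q ⊕ Q ≃ Fin n} {a b : Q} {x : W}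
    {p p' : Fin (m + 1) → ZMod ((S.word x).length + 1)} {q q' : Q ⊕ Q} :
    Step (netAutomaton E S e a b) (S.word x) (p, e q) (p', e q') ↔
      ∃ i d, NetTrans E S (fun j => symbolAt (S.word x) (p j)) q (i, d) q' ∧
        p' = Function.update p i (p i + if d then 1 else -1) := by
  constructor
  · rintro ⟨s, i, d, q'', h1, h2, h3⟩
    obtain rfl : s = _ := (funext h2).symm
    obtain ⟨h3, rfl⟩ := Prod.ext_iff.1 h3
    refine ⟨i, d, ?_, h3⟩
    have h1 : NetTrans E S _ (e.symm (e q)) (i, d) (e.symm (e q')) := h1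
    simpa using h1
  · rintro ⟨i, d, h, rfl⟩
    refine ⟨_, i, d, e q', ?_, fun _ => rfl, rfl⟩
    change NetTrans E S _ (e.symm (e q)) (i, d) (e.symm (e q'))
    simpa using h

theorem netAutomaton_not_accepts {n : ℕ} {e : Q ⊕ Q ≃ Fin n} {a b : Q}
    (hE : ∀ q r T, E q r T → T = (fun _ c d => c = d) ∨ S.Letterwise (m + 1) T) (x : W) :
    ¬ Accepts (netAutomaton E S e a b) (S.word x) ↔
      ∃ d, Relation.ReflTransGen (NetStep E x) (fun _ => 0, a) (d, b) := by
  refine not_not.trans ?_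
  have hcast : ∀ (c : Fin (m + 1) → ℤ) i (t : Bool),
      (fun j => ((Function.update c i (c i + if t then 1 else -1) : Fin (m + 1) → ℤ) j :
        ZMod ((S.word x).length + 1))) =
      Function.update (fun j => (c j : ZMod ((S.word x).length + 1))) i
        ((c i : ZMod ((S.word x).length + 1)) + if t then 1 else -1) := by
    intro c i t
    funext j
    by_cases hj : j = i
    · subst hj
      cases t <;> simp
    · simp [hj]
  constructor
  · have key : ∀ r, Relation.ReflTransGen (Step (netAutomaton E S e a b) (S.word x))
        (fun _ => 0, (netAutomaton E S e a b).init) r → ∃ c : Fin (m + 1) → ℤ,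
          match e.symm r.2 with
          | .inl q => r.1 = (fun j => (c j : ZMod ((S.word x).length + 1))) ∧
            Relation.ReflTransGen (NetStep E x) (fun _ => 0, a) (c, q)
          | .inr q => r.1 = Function.update (fun j => (c j : ZMod ((S.word x).length + 1))) 0
              ((c 0 : ZMod ((S.word x).length + 1)) + 1) ∧
            Relation.ReflTransGen (NetStep E x) (fun _ => 0, a) (c, q) := by
      intro r hr
      induction hr with
      | refl => exact ⟨fun _ => 0, by simpa [netAutomaton] using .refl⟩
      | @tail r r' _ hs ih =>
        obtain ⟨p, q⟩ := r
        obtain ⟨p', q'⟩ := r'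
        obtain ⟨q, rfl⟩ := e.surjective q
        obtain ⟨q', rfl⟩ := e.surjective q'
        obtain ⟨i, d, h, rfl⟩ := netAutomaton_step_iff.1 hs
        simp only [Equiv.symm_apply_apply] at ih ⊢
        obtain ⟨c, hc⟩ := ih
        cases h with
        | move h =>
          obtain ⟨rfl, hc⟩ := hc
          exact ⟨Function.update c i (c i + if d then 1 else -1), (hcast c i d).symm,
            hc.tail ⟨_, h, rfl⟩⟩
        | idle h =>
          obtain ⟨rfl, hc⟩ := hc
          exact ⟨c, rfl, hc.tail ⟨_, h, rfl⟩⟩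
        | read h =>
          obtain ⟨rfl, hc⟩ := hc
          exact ⟨c, rfl, hc.tail ⟨_, h, rfl, rfl⟩⟩
        | back =>
          obtain ⟨rfl, hc⟩ := hc
          exact ⟨c, by simp, hc⟩
    rintro ⟨⟨p, q⟩, h, rfl⟩
    obtain ⟨c, hc⟩ := key _ h
    simp only [netAutomaton, Equiv.symm_apply_apply] at hc
    exact ⟨c, hc.2⟩
  · rintro ⟨d, hd⟩
    have key : ∀ r, Relation.ReflTransGen (NetStep E x) (fun _ => 0, a) r →
        Relation.ReflTransGen (Step (netAutomaton E S e a b) (S.word x))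
          (fun _ => 0, (netAutomaton E S e a b).init)
          (fun j => (r.1 j : ZMod ((S.word x).length + 1)), e (.inl r.2)) := by
      intro r hr
      induction hr with
      | refl => simpa [netAutomaton] using .refl
      | @tail r r' _ hs ih =>
        obtain ⟨c, q⟩ := r
        obtain ⟨c', q'⟩ := r'
        obtain ⟨T, hT, hs⟩ := hs
        have stay : c = c' → NetTrans E S
            (fun j => symbolAt (S.word x) (c j : ZMod ((S.word x).length + 1))) (.inl q)
            (0, true) (.inr q') →
            Relation.ReflTransGen (Step (netAutomaton E S e a b) (S.word x))
              (fun _ => 0, (netAutomaton E S e a b).init)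
              (fun j => (c' j : ZMod ((S.word x).length + 1)), e (.inl q')) := by
          rintro rfl h
          refine (ih.tail (netAutomaton_step_iff.2 ⟨_, _, h, rfl⟩)).tail
            (netAutomaton_step_iff.2 ⟨_, _, .back, ?_⟩)
          simp
        rcases hE _ _ _ hT with rfl | h
        · exact stay hs (.idle hT)
        · cases h with
          | move i d =>
            refine ih.tail (netAutomaton_step_iff.2 ⟨_, _, .move hT, ?_⟩)
            obtain rfl : c' = _ := hs
            exact hcast c i d
          | read i s =>
            obtain ⟨hc, rfl⟩ := hs
            exact stay hc (.read (i := i) hT)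
    exact ⟨_, key _ hd, rfl⟩

end Automaton

/-- Recognition by machines reduces to nonacceptance by automata. -/
theorem Recognizes.exists_automaton {L : W → Prop} (h : S.Recognizes (Fin (m + 1)) L) :
    ∃ M : TwoWayAutomaton (m + 1), ∀ x, L x ↔ ¬ Accepts M (S.word x) := by
  obtain ⟨R, hR, h⟩ := h
  obtain ⟨T, hT, h'⟩ := exists_letterwise hR
  obtain ⟨Q, _, E, a, b, hE, hQ⟩ := hT.exists_network
  refine ⟨netAutomaton E S (Finite.equivFin (Q ⊕ Q)) a b, fun x => ?_⟩
  rw [netAutomaton_not_accepts hE, h, h']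
  simp only [hQ]

/-- If `k + 1` heads can be replaced with `k` heads for automata, then so they can for machines. -/
theorem Recognizes.spare_head {k : ℕ} (H : co2NFA (k + 1) ⊆ co2NFA k) {L : W → Prop}
    (h : S.Recognizes (Fin (k + 1)) L) : S.Recognizes (Fin k) L := by
  obtain ⟨M, hM⟩ := h.exists_automaton
  obtain ⟨M', hM'⟩ := H (show {w | Accepts M w} ∈ co2NFA (k + 1) from ⟨M, fun w => Iff.rfl⟩)
  have hL : L = fun x => ¬ Accepts M' (S.word x) := by
    funext x
    rw [hM x, ← hM']
    rfl
  rw [hL]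
  exact recognizes_not_accepts S M'

end LabelledCycle

/-- Inputs of type `W`, each presented as a square table of labels. -/
structure LabelledSquare (W : Type) where
  Γ : Type
  size : W → ℕ
  size_pos : ∀ x, 0 < size x
  lab : W → ℕ → ℕ → Γ
  /-- The labels found on the diagonal. -/
  diag : Set Γ
  lab_mem_diag : ∀ x a b, a < size x → b < size x → (lab x a b ∈ diag ↔ a = b)

namespace LabelledSquare

variable {W : Type} (B : LabelledSquare W) {V V' κ κ' τ : Type} [DecidableEq κ'] [DecidableEq κ]

variable (V κ) in
/-- Elementary instructions for machines with parameters indexed by `V` and registers indexed by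
`κ`, which hold positions in a table. -/
inductive Registers : Fam (W × (V → ℕ)) (κ → ℕ) → Prop
  | assign (k : κ) : Registers (fun x z z' => ∃ t < B.size x.1, z' = Function.update z k t)
  | test (i j : V ⊕ κ) (T : Set B.Γ) :
    Registers (fun x z z' =>
      z = z' ∧ B.lab x.1 (Sum.elim x.2 z i) (Sum.elim x.2 z j) ∈ T)

variable {B}

theorem registers_bounded {R : Fam (W × (V → ℕ)) (κ → ℕ)} (h : Prog (B.Registers V κ) R)
    {x : W × (V → ℕ)} {z z' : κ → ℕ} (hR : R x z z') (hz : ∀ k, z k < B.size x.1) :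
    ∀ k, z' k < B.size x.1 := by
  induction h generalizing z z' with
  | base h =>
    cases h with
    | assign k =>
      obtain ⟨t, ht, rfl⟩ := hR
      exact (LabelledCycle.forall_update_lt_iff (hz k) ht).2 hz
    | test i j T => exact hR.1 ▸ hz
  | idle => exact hR ▸ hz
  | empty => exact hR.elim
  | comp _ _ h1 h2 =>
    obtain ⟨e, he, he'⟩ := hR
    exact h2 he' (h1 he hz)
  | union _ _ h1 h2 => exact hR.elim (fun h => h1 h hz) fun h => h2 h hz
  | star _ h =>
    induction hR with
    | refl => exact hz
    | tail _ h' ih => exact h h' ih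

/-- Running a machine on some of the registers, where other registers may serve as parameters. -/
def Frame (g : κ → κ') (h : V → V' ⊕ κ') (R : Fam (W × (V → ℕ)) (κ → ℕ)) :
    Fam (W × (V' → ℕ)) (κ' → ℕ) := fun x z z' =>
  R (x.1, fun v => Sum.elim x.2 z (h v)) (z ∘ g) (z' ∘ g) ∧ ∀ k ∉ Set.range g, z' k = z k

section Frame

variable {g : κ → κ'} {h : V → V' ⊕ κ'} {z z' : κ' → ℕ}

omit [DecidableEq κ] [DecidableEq κ'] in
theorem eq_of_comp_eq (h1 : z' ∘ g = z ∘ g) (h2 : ∀ k ∉ Set.range g, z' k = z k) : z' = z := by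
  ext k
  by_cases hk : k ∈ Set.range g
  · obtain ⟨j, rfl⟩ := hk
    exact congrFun h1 j
  · exact h2 k hk

omit [DecidableEq κ] [DecidableEq κ'] in
theorem extend_comp' (hg : Function.Injective g) (e : κ → ℕ) : Function.extend g e z ∘ g = e := by
  ext j; simp [hg.extend_apply]

omit [DecidableEq κ] [DecidableEq κ'] in
theorem frame_parameters (hh : ∀ v k, h v = .inr k → k ∉ Set.range g)
    (h2 : ∀ k ∉ Set.range g, z' k = z k) (y : V' → ℕ) :
    (fun v => Sum.elim y z' (h v)) = fun v => Sum.elim y z (h v) := by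
  funext v
  rcases hv : h v with w | k
  · rfl
  · exact h2 k (hh v k hv)

omit [DecidableEq κ] [DecidableEq κ'] in
theorem exists_frame (hg : Function.Injective g) {R : Fam (W × (V → ℕ)) (κ → ℕ)}
    {x : W × (V' → ℕ)} :
    (∃ z', Frame g h R x z z') ↔ ∃ w, R (x.1, fun v => Sum.elim x.2 z (h v)) (z ∘ g) w := by
  constructor
  · rintro ⟨z', h, -⟩
    exact ⟨_, h⟩
  · rintro ⟨w, hw⟩
    refine ⟨Function.extend g w z, ?_, fun k hk => Function.extend_apply' _ _ _ hk⟩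
    rwa [extend_comp' hg]

theorem prog_frame (hg : Function.Injective g) (hh : ∀ v k, h v = .inr k → k ∉ Set.range g)
    {R : Fam (W × (V → ℕ)) (κ → ℕ)} (hR : Prog (B.Registers V κ) R) :
    Prog (B.Registers V' κ') (Frame g h R) := by
  have ext_out : ∀ (e : κ → ℕ) (z : κ' → ℕ) k, k ∉ Set.range g → Function.extend g e z k = z k :=
    fun e z k hk => Function.extend_apply' _ _ _ hk
  induction hR with
  | base hR =>
    cases hR with
    | assign k =>
      refine (Prog.base (.assign (g k))).congr fun x z z' => ?_
      constructor
      · rintro ⟨⟨t, ht, h1⟩, h2⟩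
        refine ⟨t, ht, eq_of_comp_eq (g := g) ?_ fun j hj => ?_⟩
        · rw [h1, Function.update_comp_eq_of_injective _ hg]
        · rw [h2 j hj, Function.update_of_ne (fun e => hj ⟨k, e.symm⟩)]
      · rintro ⟨t, ht, rfl⟩
        refine ⟨⟨t, ht, Function.update_comp_eq_of_injective _ hg _ _⟩, fun j hj => ?_⟩
        exact Function.update_of_ne (fun e => hj ⟨k, e.symm⟩) _ _
    | test i j T =>
      have key : ∀ (y : V' → ℕ) (z : κ' → ℕ) i, Sum.elim (fun v => Sum.elim y z (h v)) (z ∘ g) i =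
          Sum.elim y z (Sum.elim h (fun k => .inr (g k)) i) := by
        rintro y z (v | k) <;> rfl
      refine (Prog.base (.test (Sum.elim h (fun k => .inr (g k)) i)
        (Sum.elim h (fun k => .inr (g k)) j) T)).congr fun x z z' => ?_
      simp only [Frame, key]
      constructor
      · rintro ⟨⟨h1, h3⟩, h2⟩
        exact ⟨(eq_of_comp_eq h1.symm h2).symm, h3⟩
      · rintro ⟨rfl, h⟩
        exact ⟨⟨rfl, h⟩, fun _ _ => rfl⟩
  | idle =>
    refine Prog.idle.congr fun x z z' => ⟨fun h => (eq_of_comp_eq h.1.symm h.2).symm, ?_⟩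
    rintro rfl
    exact ⟨rfl, fun _ _ => rfl⟩
  | empty => exact Prog.empty.congr fun x z z' => by simp [Frame]
  | comp _ _ h1 h2 =>
    refine (h1.comp h2).congr fun x z z' => ⟨?_, ?_⟩
    · rintro ⟨⟨e, he, hf⟩, hi⟩
      refine ⟨Function.extend g e z, ⟨?_, ext_out e z⟩, ?_, ?_⟩
      · rwa [extend_comp' hg]
      · rwa [extend_comp' hg, frame_parameters hh (ext_out e z)]
      · intro k hk
        rw [hi k hk, ext_out _ _ _ hk]
    · rintro ⟨e, ⟨h1, h1'⟩, h2, h2'⟩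
      rw [frame_parameters hh h1'] at h2
      exact ⟨⟨_, h1, h2⟩, fun i hi => (h2' i hi).trans (h1' i hi)⟩
  | union _ _ h1 h2 =>
    refine (h1.union h2).congr fun x z z' => ?_
    simp only [Frame, or_and_right]
  | @star R _ hs =>
    refine hs.star.congr fun x z z' => ⟨?_, ?_⟩
    · rintro ⟨h1, h2⟩
      have : ∀ e, Relation.ReflTransGen (R (x.1, fun v => Sum.elim x.2 z (h v))) (z ∘ g) e →
          Relation.ReflTransGen (Frame g h R x) z (Function.extend g e z) := by
        intro e he
        induction he with
        | refl =>
          rw [show Function.extend g (z ∘ g) z = z from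
            eq_of_comp_eq (extend_comp' hg _) (ext_out _ z)]
        | @tail e e' _ h3 ih =>
          refine ih.tail ⟨?_, fun i hi => ?_⟩
          · rwa [extend_comp' hg, extend_comp' hg, frame_parameters hh (ext_out e z)]
          · rw [ext_out _ _ _ hi, ext_out _ _ _ hi]
      convert this _ h1
      refine eq_of_comp_eq (g := g) (extend_comp' hg _).symm fun k hk => ?_
      rw [h2 k hk, ext_out _ _ _ hk]
    · intro hr
      induction hr with
      | refl => exact ⟨.refl, fun _ _ => rfl⟩
      | tail _ h3 ih =>
        obtain ⟨h3, h3'⟩ := h3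
        rw [frame_parameters hh ih.2] at h3
        exact ⟨ih.1.tail h3, fun k hk => (h3' k hk).trans (ih.2 k hk)⟩

end Frame

theorem prog_assign [Finite τ] {g : τ → κ} :
    Prog (B.Registers V κ) (fun x z z' =>
      (∀ i, z' (g i) < B.size x.1) ∧ ∀ k ∉ Set.range g, z' k = z k) := by
  classical
  have := Fintype.ofFinite τ
  have key : ∀ s : Finset τ, Prog (B.Registers V κ) (fun x z z' =>
      (∀ i ∈ s, z' (g i) < B.size x.1) ∧ ∀ k, (∀ i ∈ s, g i ≠ k) → z' k = z k) := by
    intro s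
    induction s using Finset.induction_on with
    | empty =>
      refine Prog.idle.congr fun x z z' => ?_
      simp [funext_iff, eq_comm]
    | insert a s ha ih =>
      refine (ih.comp (.base (.assign (g a)))).congr fun x z z' => ⟨?_, ?_⟩
      · rintro ⟨h1, h2⟩
        refine ⟨fun k => if ∃ i ∈ s, g i = k then z' k else z k, ⟨fun i hi => ?_, fun k hk => ?_⟩,
          z' (g a), h1 a (Finset.mem_insert_self a s), ?_⟩
        · have : ∃ j ∈ s, g j = g i := ⟨i, hi, rfl⟩
          simp only [this, if_true]
          exact h1 i (Finset.mem_insert_of_mem hi)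
        · have : ¬ ∃ i ∈ s, g i = k := fun ⟨i, hi, h⟩ => hk i hi h
          simp only [this, if_false]
        · funext k
          by_cases hk : k = g a
          · subst hk
            simp
          · rw [Function.update_of_ne hk]
            split_ifs with h
            · rfl
            · refine h2 k fun i hi e => ?_
              rcases Finset.mem_insert.1 hi with rfl | hi
              · exact hk e.symm
              · exact h ⟨i, hi, e⟩
      · rintro ⟨e, ⟨h1, h2⟩, t, ht, rfl⟩
        constructor
        · intro i hi
          by_cases hk : g i = g a
          · rw [hk, Function.update_self]
            exact ht
          · rw [Function.update_of_ne hk]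
            rcases Finset.mem_insert.1 hi with rfl | hi
            · exact absurd rfl hk
            · exact h1 i hi
        · intro k hk
          rw [Function.update_of_ne (hk a (Finset.mem_insert_self a s)).symm]
          exact h2 k fun i hi => hk i (Finset.mem_insert_of_mem hi)
  refine (key Finset.univ).congr fun x z z' => ?_
  simp

omit [DecidableEq κ] in
theorem test_eq (f g : τ → V ⊕ κ) {x : W × (V → ℕ)} {z z' : κ → ℕ}
    (hx : ∀ v, x.2 v < B.size x.1) (hz : ∀ k, z k < B.size x.1) :
    (z = z' ∧ ∀ i, B.lab x.1 (Sum.elim x.2 z (f i)) (Sum.elim x.2 z (g i)) ∈ B.diag) ↔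
      z = z' ∧ ∀ i, Sum.elim x.2 z (f i) = Sum.elim x.2 z (g i) := by
  have key : ∀ i, Sum.elim x.2 z i < B.size x.1 := by
    rintro (v | k)
    · exact hx v
    · exact hz k
  simp only [B.lab_mem_diag x.1 _ _ (key _) (key _)]

end LabelledSquare

/-- A notion of definable predicate on tuples of bounded positions, closed under positive
connectives, existential quantifiers, and transitive closures. -/
structure PositiveLogic (W : Type) where
  size : W → ℕ
  size_pos : ∀ x, 0 < size x
  Def : ∀ {V : Type}, (W → (V → ℕ) → Prop) → Prop
  congr : ∀ {V : Type} {P Q : W → (V → ℕ) → Prop}, Def P →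
    (∀ x c, (∀ v, c v < size x) → (Q x c ↔ P x c)) → Def Q
  const : ∀ {V : Type} (p : Prop), Def (fun _ (_ : V → ℕ) => p)
  and : ∀ {V : Type} {P Q : W → (V → ℕ) → Prop}, Def P → Def Q → Def (fun x c => P x c ∧ Q x c)
  or : ∀ {V : Type} {P Q : W → (V → ℕ) → Prop}, Def P → Def Q → Def (fun x c => P x c ∨ Q x c)
  subst : ∀ {V V' : Type} {P : W → (V → ℕ) → Prop} (g : V → V'), Def P →
    Def (fun x c => P x (c ∘ g))
  ex : ∀ {V τ : Type} [Finite τ] {P : W → (V ⊕ τ → ℕ) → Prop}, Def P →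
    Def (fun x c => ∃ t : τ → ℕ, (∀ i, t i < size x) ∧ P x (Sum.elim c t))
  tc : ∀ {V τ : Type} [Finite τ] {P : W → (V ⊕ τ ⊕ τ → ℕ) → Prop}, Def P →
    Def (fun x (c : V ⊕ τ ⊕ τ → ℕ) => Relation.ReflTransGen
      (fun s t => (∀ i, t i < size x) ∧ P x (Sum.elim (c ∘ .inl) (Sum.elim s t)))
      (c ∘ .inr ∘ .inl) (c ∘ .inr ∘ .inr))

namespace LabelledSquare

variable {W : Type} (B : LabelledSquare W) {V V' κ κ' τ : Type} [DecidableEq κ'] [DecidableEq κ]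

/-- The predicates decided by machines with finitely many registers. -/
def Testable (P : W → (V → ℕ) → Prop) : Prop :=
  ∃ (κ : Type) (_ : Finite κ) (_ : DecidableEq κ) (R : Fam (W × (V → ℕ)) (κ → ℕ)),
    Prog (B.Registers V κ) R ∧ ∀ x c z, (∀ v, c v < B.size x) → (∀ k, z k < B.size x) →
      (P x c ↔ ∃ z', R (x, c) z z')

variable {B}

theorem exists_prog_copy [Finite τ] (f : τ → V ⊕ κ) {g : τ → κ}
    (hf : ∀ i k, f i = .inr k → k ∉ Set.range g) :
    ∃ R, Prog (B.Registers V κ) R ∧ ∀ x z z', (∀ v, x.2 v < B.size x.1) →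
      (∀ k, z k < B.size x.1) → (R x z z' ↔
        (∀ i, z' (g i) = Sum.elim x.2 z (f i)) ∧ ∀ k ∉ Set.range g, z' k = z k) := by
  have htest : Prog (B.Registers V κ) (fun x z z' =>
      z = z' ∧ ∀ i, B.lab x.1 (Sum.elim x.2 z (.inr (g i))) (Sum.elim x.2 z (f i)) ∈ B.diag) :=
    Test.forall_finite fun i => .base (.test (.inr (g i)) (f i) B.diag)
  refine ⟨_, (prog_assign (g := g)).comp htest, fun x z z' hx hz => ?_⟩
  have hfz : ∀ i, Sum.elim x.2 z (f i) < B.size x.1 := by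
    intro i
    rcases f i with v | k
    · exact hx v
    · exact hz k
  have keep : ∀ e : κ → ℕ, (∀ k ∉ Set.range g, e k = z k) →
      ∀ i, Sum.elim x.2 e (f i) = Sum.elim x.2 z (f i) := by
    intro e he i
    rcases hi : f i with v | k
    · rfl
    · exact he k (hf i k hi)
  have bounded : ∀ e : κ → ℕ, (∀ i, e (g i) < B.size x.1) → (∀ k ∉ Set.range g, e k = z k) →
      ∀ k, e k < B.size x.1 := by
    intro e h1 h2 k
    by_cases hk : k ∈ Set.range g
    · obtain ⟨i, rfl⟩ := hk
      exact h1 i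
    · exact h2 k hk ▸ hz k
  constructor
  · rintro ⟨e, ⟨h1, h2⟩, h3⟩
    obtain ⟨rfl, h4⟩ := (test_eq (fun i => .inr (g i)) f hx (bounded e h1 h2)).1 h3
    exact ⟨fun i => (h4 i).trans (keep e h2 i), h2⟩
  · rintro ⟨h1, h2⟩
    have h3 : ∀ i, z' (g i) < B.size x.1 := fun i => h1 i ▸ hfz i
    refine ⟨z', ⟨h3, h2⟩, (test_eq (fun i => .inr (g i)) f hx (bounded z' h3 h2)).2 ⟨rfl, ?_⟩⟩
    exact fun i => (h1 i).trans (keep z' h2 i).symm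

theorem Testable.and {P Q : W → (V → ℕ) → Prop} (hP : B.Testable P) (hQ : B.Testable Q) :
    B.Testable (fun x c => P x c ∧ Q x c) := by
  obtain ⟨κ, _, _, R, hR, hP⟩ := hP
  obtain ⟨κ', _, _, S, hS, hQ⟩ := hQ
  refine ⟨κ ⊕ κ', inferInstance, inferInstance, _,
    (prog_frame (h := .inl) (V' := V) Sum.inl_injective (by simp) hR).comp
      (prog_frame (h := .inl) (V' := V) Sum.inr_injective (by simp) hS), fun x c z hc hz => ?_⟩
  have hfr : ∀ e : κ ⊕ κ' → ℕ, (∀ k ∉ Set.range Sum.inl, e k = z k) → e ∘ Sum.inr = z ∘ Sum.inr := by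
    intro e he
    funext k
    exact he _ (by simp)
  have hl : P x c ↔ ∃ w, Frame (g := Sum.inl (β := κ')) (h := .inl) (V' := V) R (x, c) z w := by
    rw [exists_frame Sum.inl_injective]
    exact hP x c _ hc fun k => hz _
  have hr : ∀ e, (∀ k ∉ Set.range Sum.inl, e k = z k) →
      (Q x c ↔ ∃ w, Frame (g := Sum.inr (α := κ)) (h := .inl) (V' := V) S (x, c) e w) := by
    intro e he
    rw [exists_frame Sum.inr_injective, hfr e he]
    exact hQ x c _ hc fun k => hz _
  constructor
  · rintro ⟨h1, h2⟩
    obtain ⟨e, he⟩ := hl.1 h1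
    obtain ⟨w, hw⟩ := (hr e he.2).1 h2
    exact ⟨w, e, he, hw⟩
  · rintro ⟨w, e, he, hw⟩
    exact ⟨hl.2 ⟨e, he⟩, (hr e he.2).2 ⟨w, hw⟩⟩

theorem Testable.or {P Q : W → (V → ℕ) → Prop} (hP : B.Testable P) (hQ : B.Testable Q) :
    B.Testable (fun x c => P x c ∨ Q x c) := by
  obtain ⟨κ, _, _, R, hR, hP⟩ := hP
  obtain ⟨κ', _, _, S, hS, hQ⟩ := hQ
  refine ⟨κ ⊕ κ', inferInstance, inferInstance, _,
    (prog_frame (h := .inl) (V' := V) Sum.inl_injective (by simp) hR).union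
      (prog_frame (h := .inl) (V' := V) Sum.inr_injective (by simp) hS), fun x c z hc hz => ?_⟩
  rw [exists_or, exists_frame Sum.inl_injective, exists_frame Sum.inr_injective]
  exact or_congr (hP x c _ hc fun k => hz _) (hQ x c _ hc fun k => hz _)

theorem Testable.ex [Finite τ] {P : W → (V ⊕ τ → ℕ) → Prop} (hP : B.Testable P) :
    B.Testable (fun x c => ∃ t : τ → ℕ, (∀ i, t i < B.size x) ∧ P x (Sum.elim c t)) := by
  classical
  obtain ⟨κ, _, _, R, hR, hP⟩ := hP
  refine ⟨τ ⊕ κ, inferInstance, inferInstance, _,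
    (prog_assign (g := Sum.inl)).comp (prog_frame (V' := V)
      (h := Sum.elim .inl (Sum.inr ∘ Sum.inl)) Sum.inr_injective ?_ hR), fun x c z hc hz => ?_⟩
  · rintro (v | t) k h
    · cases h
    · cases h
      simp
  have key : ∀ e : τ ⊕ κ → ℕ, (fun v => Sum.elim c e (Sum.elim .inl (Sum.inr ∘ Sum.inl) v)) =
      Sum.elim c (e ∘ Sum.inl) := by
    intro e
    funext v
    rcases v with v | t <;> rfl
  constructor
  · rintro ⟨t, ht, h⟩
    rw [hP x _ (z ∘ Sum.inr) (by rintro (v | i); exacts [hc v, ht i]) fun k => hz _] at h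
    have h' : ∃ w, R (x, fun v => Sum.elim c (Sum.elim t (z ∘ Sum.inr))
        (Sum.elim .inl (Sum.inr ∘ Sum.inl) v)) (Sum.elim t (z ∘ Sum.inr) ∘ Sum.inr) w := by
      rwa [key]
    obtain ⟨w, hw⟩ := (exists_frame (x := (x, c)) Sum.inr_injective).2 h'
    refine ⟨w, _, ⟨ht, ?_⟩, hw⟩
    rintro (i | k) hk
    · exact absurd ⟨i, rfl⟩ hk
    · rfl
  · rintro ⟨w, e, ⟨h1, h2⟩, hw⟩
    obtain ⟨w, hw⟩ := (exists_frame (x := (x, c)) Sum.inr_injective).1 ⟨w, hw⟩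
    simp only [key] at hw
    refine ⟨_, h1, (hP x _ (e ∘ Sum.inr) (by rintro (v | i); exacts [hc v, h1 i]) fun k => ?_).2
      ⟨w, hw⟩⟩
    exact lt_of_eq_of_lt (h2 (.inr k) (by simp)) (hz _)

theorem Testable.tc [Finite τ] {P : W → (V ⊕ τ ⊕ τ → ℕ) → Prop} (hP : B.Testable P) :
    B.Testable (fun x (c : V ⊕ τ ⊕ τ → ℕ) => Relation.ReflTransGen
      (fun s t => (∀ i, t i < B.size x) ∧ P x (Sum.elim (c ∘ Sum.inl) (Sum.elim s t)))
      (c ∘ Sum.inr ∘ Sum.inl) (c ∘ Sum.inr ∘ Sum.inr)) := by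
  classical
  obtain ⟨κ, _, _, R, hR, hP⟩ := hP
  obtain ⟨I, hI, hI'⟩ := exists_prog_copy (B := B) (τ := τ) (V := V ⊕ τ ⊕ τ) (κ := τ ⊕ τ ⊕ κ)
    (fun i => .inl (.inr (.inl i))) (g := Sum.inl) (by simp)
  obtain ⟨N, hN, hN'⟩ := exists_prog_copy (B := B) (τ := τ) (V := V ⊕ τ ⊕ τ) (κ := τ ⊕ τ ⊕ κ)
    (fun i => .inr (.inr (.inl i))) (g := Sum.inl)
    (by rintro i k h; cases h; simp)
  have htest : Prog (B.Registers (V ⊕ τ ⊕ τ) (τ ⊕ τ ⊕ κ)) (fun x z z' =>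
      z = z' ∧ ∀ i, B.lab x.1 (Sum.elim x.2 z (.inr (.inl i)))
        (Sum.elim x.2 z (.inl (.inr (.inr i)))) ∈ B.diag) :=
    Test.forall_finite fun i =>
      .base (.test (Sum.inr (Sum.inl i)) (Sum.inl (Sum.inr (Sum.inr i))) B.diag)
  have hF := prog_frame (B := B) (V' := V ⊕ τ ⊕ τ) (κ' := τ ⊕ τ ⊕ κ) (g := Sum.inr ∘ Sum.inr)
    (h := Sum.elim (Sum.inl ∘ Sum.inl) (Sum.elim (Sum.inr ∘ Sum.inl) (Sum.inr ∘ Sum.inr ∘ Sum.inl)))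
    (Sum.inr_injective.comp Sum.inr_injective)
    (by rintro (v | i | i) k h <;> cases h <;> simp) hR
  have hbody := ((prog_assign (B := B) (V := V ⊕ τ ⊕ τ) (κ := τ ⊕ τ ⊕ κ)
    (g := Sum.inr ∘ Sum.inl)).comp hF).comp hN
  refine ⟨τ ⊕ τ ⊕ κ, inferInstance, inferInstance, _, (hI.comp hbody.star).comp htest,
    fun x c z hc hz => ?_⟩
  set body := fun z z' : τ ⊕ τ ⊕ κ → ℕ => ∃ e, (∃ e_1, ((∀ i, e_1 ((Sum.inr ∘ Sum.inl) i) < B.size x) ∧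
    ∀ k ∉ Set.range (Sum.inr ∘ Sum.inl), e_1 k = z k) ∧ Frame (Sum.inr ∘ Sum.inr)
      (Sum.elim (Sum.inl ∘ Sum.inl) (Sum.elim (Sum.inr ∘ Sum.inl) (Sum.inr ∘ Sum.inr ∘ Sum.inl))) R (x, c) e_1 e) ∧
        N (x, c) e z' with hbody
  have key : ∀ e : τ ⊕ τ ⊕ κ → ℕ, (fun v => Sum.elim c e
      (Sum.elim (Sum.inl ∘ Sum.inl) (Sum.elim (Sum.inr ∘ Sum.inl) (Sum.inr ∘ Sum.inr ∘ Sum.inl)) v)) =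
      Sum.elim (c ∘ Sum.inl) (Sum.elim (e ∘ Sum.inl) (e ∘ Sum.inr ∘ Sum.inl)) := by
    intro e
    funext v
    rcases v with v | i | i <;> rfl
  set E : (τ → ℕ) → (τ → ℕ) → Prop :=
    fun s t => (∀ i, t i < B.size x) ∧ P x (Sum.elim (c ∘ Sum.inl) (Sum.elim s t)) with hE
  have forth : ∀ z z', (∀ k, z k < B.size x) → body z z' →
      (∀ k, z' k < B.size x) ∧ E (z ∘ Sum.inl) (z' ∘ Sum.inl) := by
    rintro z z' hz ⟨e', ⟨e, ⟨h1, h2⟩, h3⟩, h4⟩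
    have he : ∀ k, e k < B.size x := by
      rintro (i | i | k)
      · exact h2 (.inl i) (by simp) ▸ hz _
      · exact h1 i
      · exact h2 (.inr (.inr k)) (by simp) ▸ hz _
    have he' := registers_bounded hF h3 he
    have hz' := registers_bounded hN h4 he'
    rw [hN' (x, c) _ _ hc he'] at h4
    have e1 : z' ∘ Sum.inl = e ∘ Sum.inr ∘ Sum.inl := by
      funext i
      exact (h4.1 i).trans (h3.2 (.inr (.inl i)) (by simp))
    have e2 : z ∘ Sum.inl = e ∘ Sum.inl := by
      funext i
      exact (h2 (.inl i) (by simp)).symm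
    refine ⟨hz', fun i => hz' _, ?_⟩
    rw [e1, e2]
    refine (hP x _ (e ∘ Sum.inr ∘ Sum.inr) ?_ fun k => he _).2 ⟨e' ∘ Sum.inr ∘ Sum.inr, ?_⟩
    · rintro (v | i | i)
      exacts [hc _, he _, he _]
    · have := h3.1
      rwa [key] at this
  have back : ∀ z t, (∀ k, z k < B.size x) → E (z ∘ Sum.inl) t →
      ∃ z', body z z' ∧ z' ∘ Sum.inl = t := by
    rintro z t hz ⟨ht, h⟩
    rw [hP x _ (z ∘ Sum.inr ∘ Sum.inr) (by rintro (v | i | i); exacts [hc _, hz _, ht _])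
      fun k => hz _] at h
    set e : τ ⊕ τ ⊕ κ → ℕ := Sum.elim (z ∘ Sum.inl) (Sum.elim t (z ∘ Sum.inr ∘ Sum.inr)) with he
    have h' : ∃ w, R (x, fun v => Sum.elim c e
      (Sum.elim (Sum.inl ∘ Sum.inl) (Sum.elim (Sum.inr ∘ Sum.inl) (Sum.inr ∘ Sum.inr ∘ Sum.inl)) v))
        (e ∘ Sum.inr ∘ Sum.inr) w := by
      rw [key]
      exact h
    obtain ⟨e', he'⟩ := (exists_frame (x := (x, c))
      (Sum.inr_injective.comp Sum.inr_injective)).2 h'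
    have heb : ∀ k, e k < B.size x := by
      rintro (i | i | k)
      exacts [hz _, ht _, hz _]
    refine ⟨Sum.elim t (e' ∘ Sum.inr), ⟨e', ⟨e, ⟨ht, ?_⟩, he'⟩, ?_⟩, rfl⟩
    · rintro (i | i | k) hk
      · rfl
      · exact absurd ⟨i, rfl⟩ hk
      · rfl
    · rw [hN' (x, c) _ _ hc (registers_bounded hF he' heb)]
      refine ⟨fun i => (he'.2 (.inr (.inl i)) (by simp)).symm, ?_⟩
      rintro (i | k) hk
      · exact absurd ⟨i, rfl⟩ hk
      · rfl
  have star_forth : ∀ z z', (∀ k, z k < B.size x) → Relation.ReflTransGen body z z' →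
      (∀ k, z' k < B.size x) ∧ Relation.ReflTransGen E (z ∘ Sum.inl) (z' ∘ Sum.inl) := by
    intro z z' hz h
    induction h with
    | refl => exact ⟨hz, .refl⟩
    | tail _ h2 ih => exact ⟨(forth _ _ ih.1 h2).1, ih.2.tail (forth _ _ ih.1 h2).2⟩
  have star_back : ∀ z t, (∀ k, z k < B.size x) → Relation.ReflTransGen E (z ∘ Sum.inl) t →
      ∃ z', Relation.ReflTransGen body z z' ∧ z' ∘ Sum.inl = t := by
    intro z t hz h
    induction h with
    | refl => exact ⟨z, .refl, rfl⟩
    | tail _ h2 ih =>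
      obtain ⟨e, he, rfl⟩ := ih
      obtain ⟨z', h3, rfl⟩ := back e _ (star_forth z e hz he).1 h2
      exact ⟨z', he.tail h3, rfl⟩
  have test_iff : ∀ z z' : τ ⊕ τ ⊕ κ → ℕ, (∀ k, z k < B.size x) →
      ((z = z' ∧ ∀ i, B.lab x (Sum.elim c z (.inr (.inl i)))
        (Sum.elim c z (.inl (.inr (.inr i)))) ∈ B.diag) ↔
        z = z' ∧ ∀ i, z (.inl i) = c (.inr (.inr i))) := fun z z' hz =>
    test_eq (x := (x, c)) (fun i => .inr (.inl i)) (fun i => .inl (.inr (.inr i))) hc hz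
  constructor
  · intro h
    set z₀ : τ ⊕ τ ⊕ κ → ℕ := Sum.elim (c ∘ Sum.inr ∘ Sum.inl) (z ∘ Sum.inr) with hz₀
    have hz₀b : ∀ k, z₀ k < B.size x := by
      rintro (i | k)
      exacts [hc _, hz _]
    obtain ⟨w, hw, hw'⟩ := star_back z₀ _ hz₀b h
    refine ⟨w, w, ⟨z₀, (hI' (x, c) _ _ hc hz).2 ⟨fun i => rfl, ?_⟩, hw⟩, ?_⟩
    · rintro (i | k) hk
      · exact absurd ⟨i, rfl⟩ hk
      · rfl
    · exact (test_iff w w (star_forth _ _ hz₀b hw).1).2 ⟨rfl, congrFun hw'⟩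
  · rintro ⟨w, e, ⟨z₀, h1, h2⟩, h3⟩
    have hz₀ := registers_bounded hI h1 hz
    rw [hI' (x, c) _ _ hc hz] at h1
    obtain ⟨he, h4⟩ := star_forth z₀ e hz₀ h2
    obtain ⟨rfl, h5⟩ := (test_iff e w he).1 h3
    convert h4 using 1
    · funext i
      exact (h1.1 i).symm
    · funext i
      exact (h5 i).symm

variable (B) in
/-- The logic of the predicates decided by machines with finitely many registers. -/
def logic : PositiveLogic W where
  size := B.size
  size_pos := B.size_pos
  Def := B.Testable
  congr := by
    rintro V P Q ⟨κ, h1, h2, R, hR, h⟩ e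
    exact ⟨κ, h1, h2, R, hR, fun x c z hc hz => (e x c hc).trans (h x c z hc hz)⟩
  const p := by
    refine ⟨Empty, inferInstance, inferInstance, _, Test.const p, fun x c z _ _ => ?_⟩
    simp
  and := .and
  or := .or
  subst := by
    rintro V V' P g ⟨κ, _, _, R, hR, h⟩
    refine ⟨κ, inferInstance, inferInstance, _, prog_frame (V' := V') (h := Sum.inl ∘ g)
      Function.injective_id (by simp) hR, fun x c z hc hz => ?_⟩
    rw [exists_frame Function.injective_id]
    exact h x (c ∘ g) z (fun v => hc _) hz
  ex := .ex
  tc := .tc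

theorem testable_lab (i j : V) (T : Set B.Γ) :
    B.Testable (fun x c => B.lab x (c i) (c j) ∈ T) :=
  ⟨Empty, inferInstance, inferInstance, _, .base (.test (.inl i) (.inl j) T), by simp⟩

end LabelledSquare

namespace PositiveLogic

variable {W : Type} {L : PositiveLogic W} {V : Type}

theorem forall_finite {I : Type*} [Finite I] {P : I → W → (V → ℕ) → Prop}
    (h : ∀ i, L.Def (P i)) : L.Def (fun x c => ∀ i, P i x c) := by
  classical
  have := Fintype.ofFinite I
  have key : ∀ s : Finset I, L.Def (fun x c => ∀ i ∈ s, P i x c) := by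
    intro s
    induction s using Finset.induction_on with
    | empty => exact L.congr (L.const True) (by simp)
    | insert a s _ ih => exact L.congr (L.and (h a) ih) (by simp)
  exact L.congr (key Finset.univ) (by simp)

theorem exists_finite {I : Type*} [Finite I] {P : I → W → (V → ℕ) → Prop}
    (h : ∀ i, L.Def (P i)) : L.Def (fun x c => ∃ i, P i x c) := by
  classical
  have := Fintype.ofFinite I
  have key : ∀ s : Finset I, L.Def (fun x c => ∃ i ∈ s, P i x c) := by
    intro s
    induction s using Finset.induction_on with
    | empty => exact L.congr (L.const False) (by simp)
    | insert a s _ ih => exact L.congr (L.or (h a) ih) (by simp)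
  exact L.congr (key Finset.univ) (by simp)

theorem exists_lt {P : W → (V → ℕ) → ℕ → Prop}
    (h : L.Def (fun x (c : V ⊕ Unit → ℕ) => P x (c ∘ Sum.inl) (c (Sum.inr ())))) :
    L.Def (fun x c => ∃ t < L.size x, P x c t) := by
  refine L.congr (L.ex h) fun x c _ => ?_
  constructor
  · rintro ⟨t, ht, h⟩
    exact ⟨fun _ => t, fun _ => ht, h⟩
  · rintro ⟨t, ht, h⟩
    exact ⟨t (), ht (), h⟩

/-- Transitive closure of a relation between pairs of positions. -/
theorem tc_pair {P : W → (V → ℕ) → ℕ × ℕ → ℕ × ℕ → Prop}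
    (h : L.Def (fun x (c : V ⊕ Bool ⊕ Bool → ℕ) => P x (c ∘ Sum.inl)
      (c (Sum.inr (Sum.inl false)), c (Sum.inr (Sum.inl true)))
      (c (Sum.inr (Sum.inr false)), c (Sum.inr (Sum.inr true))))) (a b a' b' : V) :
    L.Def (fun x c => Relation.ReflTransGen
      (fun p q => (q.1 < L.size x ∧ q.2 < L.size x) ∧ P x c p q) (c a, c b) (c a', c b')) := by
  refine L.congr (L.subst (Sum.elim id (Sum.elim (Bool.rec a b) (Bool.rec a' b'))) (L.tc h))
    fun x c hc => ?_
  constructor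
  · intro h
    have := h.lift (p := fun s t : Bool → ℕ => (∀ i, t i < L.size x) ∧
      P x c (s false, s true) (t false, t true)) (fun p => (Bool.rec p.1 p.2 : Bool → ℕ)) ?_
    · convert this using 1
      · rfl
      · funext i
        cases i <;> rfl
      · funext i
        cases i <;> rfl
    · rintro p q ⟨⟨h1, h2⟩, h3⟩
      exact ⟨fun i => by cases i; exacts [h1, h2], h3⟩
  · intro h
    refine h.lift (fun s : Bool → ℕ => (s false, s true)) ?_
    rintro s t ⟨h1, h2⟩
    exact ⟨⟨h1 _, h1 _⟩, h2⟩

/-- The order structure on positions is definable. -/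
structure HasOrder (L : PositiveLogic W) : Prop where
  eq : ∀ {V : Type} (a b : V), L.Def (fun _ c => c a = c b)
  ne : ∀ {V : Type} (a b : V), L.Def (fun _ c => c a ≠ c b)
  zero : ∀ {V : Type} (a : V), L.Def (fun _ c => c a = 0)
  max : ∀ {V : Type} (a : V), L.Def (fun x c => c a + 1 = L.size x)
  succ : ∀ {V : Type} (a b : V), L.Def (fun _ c => c b = c a + 1)

theorem HasOrder.not_max (hL : L.HasOrder) (a : V) : L.Def (fun x c => c a + 1 < L.size x) := by
  refine L.congr (L.exists_lt (P := fun x c t => t = c a + 1) (hL.succ (Sum.inl a) (Sum.inr ())))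
    fun x c hc => ?_
  simp

theorem HasOrder.not_zero (hL : L.HasOrder) (a : V) : L.Def (fun _ c => c a ≠ 0) := by
  refine L.congr (L.exists_lt (P := fun x c t => c a = t + 1) (hL.succ (Sum.inr ()) (Sum.inl a)))
    fun x c hc => ?_
  constructor
  · intro h
    exact ⟨c a - 1, by have := hc a; omega, by omega⟩
  · rintro ⟨t, -, h⟩
    omega

theorem HasOrder.const (hL : L.HasOrder) (n : ℕ) (a : V) : L.Def (fun _ c => c a = n) := by
  induction n generalizing V with
  | zero => exact hL.zero a
  | succ n ih =>
    refine L.congr (L.exists_lt (P := fun x c t => t = n ∧ c a = t + 1)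
      (L.and (ih (V := V ⊕ Unit) (Sum.inr ())) (hL.succ (Sum.inr ()) (Sum.inl a)))) fun x c hc => ?_
    constructor
    · intro h
      exact ⟨n, by have := hc a; omega, rfl, h⟩
    · rintro ⟨t, -, rfl, h⟩
      exact h

/-- Both `P` and its negation are definable. -/
def Decides (L : PositiveLogic W) (P : W → (V → ℕ) → Prop) : Prop :=
  L.Def P ∧ L.Def (fun x c => ¬ P x c)

theorem Decides.congr {P Q : W → (V → ℕ) → Prop} (h : L.Decides P)
    (e : ∀ x c, (∀ v, c v < L.size x) → (Q x c ↔ P x c)) : L.Decides Q :=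
  ⟨L.congr h.1 e, L.congr h.2 fun x c hc => not_congr (e x c hc)⟩

theorem Decides.not {P : W → (V → ℕ) → Prop} (h : L.Decides P) :
    L.Decides (fun x c => ¬ P x c) :=
  ⟨h.2, L.congr h.1 fun _ _ _ => not_not⟩

theorem Decides.and {P Q : W → (V → ℕ) → Prop} (hP : L.Decides P) (hQ : L.Decides Q) :
    L.Decides (fun x c => P x c ∧ Q x c) :=
  ⟨L.and hP.1 hQ.1, L.congr (L.or hP.2 hQ.2) fun _ _ _ => not_and_or⟩

theorem Decides.or {P Q : W → (V → ℕ) → Prop} (hP : L.Decides P) (hQ : L.Decides Q) :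
    L.Decides (fun x c => P x c ∨ Q x c) :=
  ⟨L.or hP.1 hQ.1, L.congr (L.and hP.2 hQ.2) fun _ _ _ => not_or⟩

theorem Decides.forall_finite {I : Type*} [Finite I] {P : I → W → (V → ℕ) → Prop}
    (h : ∀ i, L.Decides (P i)) : L.Decides (fun x c => ∀ i, P i x c) :=
  ⟨L.forall_finite fun i => (h i).1,
    L.congr (L.exists_finite fun i => (h i).2) fun _ _ _ => not_forall⟩

theorem Decides.exists_finite {I : Type*} [Finite I] {P : I → W → (V → ℕ) → Prop}
    (h : ∀ i, L.Decides (P i)) : L.Decides (fun x c => ∃ i, P i x c) :=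
  ⟨L.exists_finite fun i => (h i).1,
    L.congr (L.forall_finite fun i => (h i).2) fun _ _ _ => not_exists⟩

theorem Decides.const (p : Prop) : L.Decides (fun _ (_ : V → ℕ) => p) :=
  ⟨L.const p, L.const _⟩

theorem HasOrder.decides_eq (hL : L.HasOrder) (a b : V) : L.Decides (fun _ c => c a = c b) :=
  ⟨hL.eq a b, hL.ne a b⟩

theorem HasOrder.decides_zero (hL : L.HasOrder) (a : V) : L.Decides (fun _ c => c a = 0) :=
  ⟨hL.zero a, hL.not_zero a⟩

theorem HasOrder.decides_max (hL : L.HasOrder) (a : V) :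
    L.Decides (fun x c => c a + 1 = L.size x) :=
  ⟨hL.max a, L.congr (hL.not_max a) fun x c hc => by have := hc a; omega⟩

theorem HasOrder.decides_succ (hL : L.HasOrder) (a b : V) :
    L.Decides (fun _ c => c b = c a + 1) := by
  refine ⟨hL.succ a b, L.congr (L.or (hL.max a) (L.exists_lt
    (P := fun x c t => t = c a + 1 ∧ c b ≠ t) (L.and (hL.succ (Sum.inl a) (Sum.inr ()))
      (hL.ne (Sum.inl b) (Sum.inr ()))))) fun x c hc => ?_⟩
  have ha := hc a
  have hb := hc b
  constructor
  · intro h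
    by_cases h' : c a + 1 = L.size x
    · exact .inl h'
    · exact .inr ⟨_, by omega, rfl, h⟩
  · rintro (h | ⟨t, ht, rfl, h⟩)
    · omega
    · exact h

theorem HasOrder.decides_const (hL : L.HasOrder) (n : ℕ) (a : V) :
    L.Decides (fun _ c => c a = n) := by
  induction n generalizing V with
  | zero => exact hL.decides_zero a
  | succ n ih =>
    refine ⟨hL.const (n + 1) a, L.congr (L.or (hL.zero a) (L.exists_lt
      (P := fun x c t => c a = t + 1 ∧ ¬ t = n) (L.and (hL.succ (Sum.inr ()) (Sum.inl a))
        (ih (V := V ⊕ Unit) (Sum.inr ())).2))) fun x c hc => ?_⟩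
    have ha := hc a
    constructor
    · intro h
      by_cases h' : c a = 0
      · exact .inl h'
      · exact .inr ⟨c a - 1, by omega, by omega, by omega⟩
    · rintro (h | ⟨t, ht, h, h'⟩) <;> omega

variable (L) in
/-- The same logic about tuples of positions, read as digits of numbers. -/
def pow (r : ℕ) : PositiveLogic W where
  size x := L.size x ^ r
  size_pos x := pow_pos (L.size_pos x) r
  Def {V} P := L.Def (V := V × Fin r)
    (fun x c => P x (fun v => posVal (L.size x) (fun i => c (v, i))))
  congr h e := L.congr h fun x c hc => e x _ fun v => posVal_lt fun i => hc (v, i)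
  const p := L.const p
  and := L.and
  or := L.or
  subst g h := L.subst (Prod.map g id) h
  ex {V τ} _ P h := by
    refine L.congr (L.ex (τ := τ × Fin r)
      (L.subst (Equiv.sumProdDistrib V τ (Fin r)) h)) fun x c hc => ?_
    have key : ∀ t : τ × Fin r → ℕ, (fun v => posVal (L.size x) fun i =>
        (Sum.elim c t ∘ Equiv.sumProdDistrib V τ (Fin r)) (v, i)) =
        Sum.elim (fun v => posVal (L.size x) fun i => c (v, i))
          (fun v => posVal (L.size x) fun i => t (v, i)) := by
      intro t
      funext v
      rcases v with v | v <;> rfl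
    simp only [key]
    constructor
    · rintro ⟨t, ht, h⟩
      refine ⟨fun p => t p.1 / L.size x ^ (p.2 : ℕ) % L.size x,
        fun p => Nat.mod_lt _ (L.size_pos x), ?_⟩
      convert h using 3 with v
      exact posVal_digit (ht v)
    · rintro ⟨t, ht, h⟩
      exact ⟨_, fun v => posVal_lt fun i => ht (v, i), h⟩
  tc {V τ} _ P h := by
    set e : (V ⊕ τ ⊕ τ) × Fin r → V × Fin r ⊕ τ × Fin r ⊕ τ × Fin r := fun p =>
      Sum.elim (fun v => Sum.inl (v, p.2)) (Sum.elim (fun v => Sum.inr (Sum.inl (v, p.2)))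
        (fun v => Sum.inr (Sum.inr (v, p.2)))) p.1 with he
    set e' : V × Fin r ⊕ τ × Fin r ⊕ τ × Fin r → (V ⊕ τ ⊕ τ) × Fin r :=
      Sum.elim (Prod.map Sum.inl id) (Sum.elim (Prod.map (Sum.inr ∘ Sum.inl) id)
        (Prod.map (Sum.inr ∘ Sum.inr) id)) with he'
    refine L.congr (L.subst e' (L.tc (τ := τ × Fin r) (L.subst e h))) fun x c hc => ?_
    let val : ∀ {U : Type}, (U × Fin r → ℕ) → U → ℕ :=
      fun c v => posVal (L.size x) fun i => c (v, i)
    let dig : ∀ {U : Type}, (U → ℕ) → U × Fin r → ℕ :=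
      fun t p => t p.1 / L.size x ^ (p.2 : ℕ) % L.size x
    have dig_val : ∀ t : τ × Fin r → ℕ, (∀ p, t p < L.size x) → dig (val t) = t := by
      intro t ht
      funext p
      exact digit_posVal (fun i => ht (p.1, i)) p.2
    have val_dig : ∀ t : τ → ℕ, (∀ i, t i < L.size x ^ r) → val (dig t) = t := by
      intro t ht
      funext i
      exact posVal_digit (ht i)
    have key : ∀ (d : V × Fin r → ℕ) (s t : τ × Fin r → ℕ),
        val (Sum.elim d (Sum.elim s t) ∘ e) = Sum.elim (val d) (Sum.elim (val s) (val t)) := by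
      intro d s t
      funext v
      rcases v with v | v | v <;> rfl
    have key' : ∀ s t : τ × Fin r → ℕ, P x (val (Sum.elim ((c ∘ e') ∘ Sum.inl) (Sum.elim s t) ∘ e)) ↔
        P x (Sum.elim (val c ∘ Sum.inl) (Sum.elim (val s) (val t))) := by
      intro s t
      rw [key]
      rfl
    constructor
    · intro h
      have : ∀ t, Relation.ReflTransGen (fun s t => (∀ i, t i < L.size x ^ r) ∧
            P x (Sum.elim (val c ∘ Sum.inl) (Sum.elim s t))) (val c ∘ Sum.inr ∘ Sum.inl) t →
          (∀ i, t i < L.size x ^ r) ∧ Relation.ReflTransGen (fun s t => (∀ i, t i < L.size x) ∧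
            P x (val (Sum.elim ((c ∘ e') ∘ Sum.inl) (Sum.elim s t) ∘ e)))
            ((c ∘ e') ∘ Sum.inr ∘ Sum.inl) (dig t) := by
        intro t ht
        induction ht with
        | refl =>
          refine ⟨fun i => posVal_lt fun j => hc _, ?_⟩
          convert Relation.ReflTransGen.refl using 1
          exact dig_val ((c ∘ e') ∘ Sum.inr ∘ Sum.inl) fun p => hc _
        | tail _ h2 ih =>
          refine ⟨h2.1, ih.2.tail ⟨fun p => Nat.mod_lt _ (L.size_pos x), ?_⟩⟩
          rw [key', val_dig _ ih.1, val_dig _ h2.1]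
          exact h2.2
      convert (this _ h).2 using 1
      exact (dig_val ((c ∘ e') ∘ Sum.inr ∘ Sum.inr) fun p => hc _).symm
    · intro h
      refine h.lift val ?_
      rintro s t ⟨h1, h2⟩
      exact ⟨fun i => posVal_lt fun j => h1 _, (key' s t).1 h2⟩

end PositiveLogic

theorem posVal_eq_succ_iff {m r : ℕ} {c d : Fin r → ℕ} (hm : 0 < m) (hc : ∀ i, c i < m)
    (hd : ∀ i, d i < m) : posVal m d = posVal m c + 1 ↔
      ∃ j, d j = c j + 1 ∧ (∀ i, i < j → c i + 1 = m ∧ d i = 0) ∧ ∀ i, j < i → d i = c i := by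
  constructor
  · intro h
    have hlt := posVal_lt hd
    have hmax : ∃ j, ¬ c j + 1 = m := by
      by_contra hmax
      push Not at hmax
      have := (posVal_eq_max_iff hm hc).2 hmax
      omega
    obtain ⟨j, hj, hmin⟩ := WellFounded.has_min (wellFounded_lt (α := Fin r)) {j | ¬ c j + 1 = m} hmax
    have hmin' : ∀ i < j, c i + 1 = m := fun i hi => by
      by_contra h'
      exact hmin i h' hi
    have hj' : c j + 1 < m := by
      have := hc j
      have : ¬ c j + 1 = m := hj
      omega
    have := posVal_injective hd (fun i => ?_) (h.trans (posVal_carry j hmin').symm)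
    · subst this
      refine ⟨j, by simp, fun i hi => ⟨hmin' i hi, by simp [hi]⟩, fun i hi => ?_⟩
      simp [hi.not_gt, hi.ne']
    · split_ifs with h1 h2
      · exact hm
      · subst h2
        exact hj'
      · exact hc i
  · rintro ⟨j, h1, h2, h3⟩
    rw [← posVal_carry j fun i hi => (h2 i hi).1]
    congr 1
    funext i
    rcases lt_trichotomy i j with h | rfl | h
    · rw [if_pos h, (h2 i h).2]
    · simp [h1]
    · rw [if_neg h.not_gt, if_neg h.ne', h3 i h]

namespace PositiveLogic

variable {W : Type} {L : PositiveLogic W} {V : Type}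

theorem imp {p : Prop} {P : W → (V → ℕ) → Prop} (h : p → L.Def P) :
    L.Def (fun x c => p → P x c) := by
  by_cases hp : p
  · exact L.congr (h hp) fun x c _ => by simp [hp]
  · exact L.congr (L.const True) fun x c _ => by simp [hp]

theorem HasOrder.pow (hL : L.HasOrder) (r : ℕ) : (L.pow r).HasOrder where
  eq {V} a b := by
    refine L.congr (L.forall_finite fun i : Fin r => hL.eq (a, i) (b, i)) fun x c hc => ?_
    constructor
    · intro h i
      exact congrFun (posVal_injective (fun i => hc (a, i)) (fun i => hc (b, i)) h) i
    · intro h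
      exact congrArg (posVal _) (funext h)
  ne {V} a b := by
    refine L.congr (L.exists_finite fun i : Fin r => hL.ne (a, i) (b, i)) fun x c hc => ?_
    constructor
    · intro h
      by_contra h'
      push Not at h'
      exact h (congrArg (posVal _) (funext h'))
    · rintro ⟨i, hi⟩ h
      exact hi (congrFun (posVal_injective (fun i => hc (a, i)) (fun i => hc (b, i)) h) i)
  zero {V} a := L.congr (L.forall_finite fun i : Fin r => hL.zero (a, i))
    fun x c hc => posVal_eq_zero_iff fun i => hc (a, i)
  max {V} a := L.congr (L.forall_finite fun i : Fin r => hL.max (a, i))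
    fun x c hc => posVal_eq_max_iff (L.size_pos x) fun i => hc (a, i)
  succ {V} a b := by
    refine L.congr (L.exists_finite fun j : Fin r => L.and (hL.succ (a, j) (b, j))
      (L.and (L.forall_finite fun i : Fin r => L.imp fun _ : i < j =>
        L.and (hL.max (a, i)) (hL.zero (b, i))) (L.forall_finite fun i : Fin r =>
          L.imp fun _ : j < i => hL.eq (b, i) (a, i)))) fun x c hc => ?_
    exact posVal_eq_succ_iff (L.size_pos x) (fun i => hc (a, i)) fun i => hc (b, i)

end PositiveLogic

section Counting

variable {E : ℕ → ℕ → Prop} {s N : ℕ}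

/-- The vertices reachable from `s` in at most `d` steps. -/
def Within (E : ℕ → ℕ → Prop) (s : ℕ) : ℕ → ℕ → Prop
  | 0, v => v = s
  | d + 1, v => Within E s d v ∨ ∃ u, Within E s d u ∧ E u v

theorem Within.reflTransGen {d v : ℕ} (h : Within E s d v) : Relation.ReflTransGen E s v := by
  induction d generalizing v with
  | zero => exact (show v = s from h) ▸ .refl
  | succ d ih =>
    rcases h with h | ⟨u, hu, h⟩
    · exact ih h
    · exact (ih hu).tail h

theorem Within.mono {d d' v : ℕ} (hd : d ≤ d') (h : Within E s d v) : Within E s d' v := by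
  induction hd with
  | refl => exact h
  | step _ ih => exact .inl ih

theorem Within.lt {d v K : ℕ} (hs : s < K) (hE : ∀ u v, E u v → v < K) (h : Within E s d v) :
    v < K := by
  induction d generalizing v with
  | zero => exact (show v = s from h) ▸ hs
  | succ d ih =>
    rcases h with h | ⟨u, hu, h⟩
    · exact ih h
    · exact hE _ _ h

theorem within_iff {d v : ℕ} (hs : s < N) (hE : ∀ u v, E u v → v < N) (hd : d < N) :
    Within E s d v ↔ Relation.ReflTransGen (fun p q : ℕ × ℕ =>
      (q.1 < N ∧ q.2 < N) ∧ q.2 = p.2 + 1 ∧ (p.1 = q.1 ∨ E p.1 q.1)) (s, 0) (v, d) := by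
  constructor
  · intro h
    induction d generalizing v with
    | zero => exact (show v = s from h) ▸ .refl
    | succ d ih =>
      rcases h with h | ⟨u, hu, h⟩
      · exact (ih (by omega) h).tail ⟨⟨h.lt hs hE, hd⟩, rfl, .inl rfl⟩
      · exact (ih (by omega) hu).tail ⟨⟨hE _ _ h, hd⟩, rfl, .inr h⟩
  · have : ∀ q, Relation.ReflTransGen (fun p q : ℕ × ℕ =>
        (q.1 < N ∧ q.2 < N) ∧ q.2 = p.2 + 1 ∧ (p.1 = q.1 ∨ E p.1 q.1)) (s, 0) q →
        Within E s q.2 q.1 := by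
      intro q h
      induction h with
      | refl => exact (rfl : s = s)
      | tail _ h ih =>
        obtain ⟨-, h1, h2⟩ := h
        rw [h1]
        rcases h2 with h2 | h2
        · exact .inl (h2 ▸ ih)
        · exact .inr ⟨_, ih, h2⟩
    exact this (v, d)

/-- Walking through the positions below `N - 1`, a counter is advanced at some positions
satisfying `P` and kept at some positions satisfying `P'`, and ends at `n`. -/
def Tally (N : ℕ) (P P' : ℕ → Prop) (n : ℕ) : Prop :=
  Relation.ReflTransGen (fun p q : ℕ × ℕ => (q.1 < N ∧ q.2 < N) ∧
    q.1 = p.1 + 1 ∧ (q.2 = p.2 + 1 ∧ P p.1 ∨ q.2 = p.2 ∧ P' p.1)) (0, 0) (N - 1, n)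

open Classical in
theorem Tally.le_count {P P' : ℕ → Prop} {n : ℕ} (h : Tally N P P' n) :
    n ≤ Nat.count P (N - 1) := by
  suffices ∀ q : ℕ × ℕ, Relation.ReflTransGen _ (0, 0) q → q.2 ≤ Nat.count P q.1 from this _ h
  intro q h
  induction h with
  | refl => simp
  | tail _ h ih =>
    obtain ⟨-, h1, h2⟩ := h
    rw [h1, Nat.count_succ]
    rcases h2 with ⟨h2, h3⟩ | ⟨h2, h3⟩
    · rw [if_pos h3]
      omega
    · omega

open Classical in
theorem Tally.eq_count {P P' : ℕ → Prop} {n : ℕ} (h : Tally N P P' n)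
    (hP : ∀ u, u + 1 < N → P' u → ¬ P u) : n = Nat.count P (N - 1) := by
  suffices ∀ q : ℕ × ℕ, Relation.ReflTransGen _ (0, 0) q → q.2 = Nat.count P q.1 from this _ h
  intro q h
  induction h with
  | refl => simp
  | tail _ h ih =>
    obtain ⟨h0, h1, h2⟩ := h
    rw [h1, Nat.count_succ]
    rcases h2 with ⟨h2, h3⟩ | ⟨h2, h3⟩
    · rw [if_pos h3]
      omega
    · rw [if_neg (hP _ (by omega) h3)]
      omega

open Classical in
theorem tally_count {P P' : ℕ → Prop} (hN : 0 < N) (hP : ∀ u, u + 1 < N → P u ∨ P' u) :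
    Tally N P P' (Nat.count P (N - 1)) := by
  have : ∀ u < N, Relation.ReflTransGen (fun p q : ℕ × ℕ => (q.1 < N ∧ q.2 < N) ∧
      q.1 = p.1 + 1 ∧ (q.2 = p.2 + 1 ∧ P p.1 ∨ q.2 = p.2 ∧ P' p.1)) (0, 0) (u, Nat.count P u) := by
    intro u hu
    induction u with
    | zero => simpa using Relation.ReflTransGen.refl
    | succ u ih =>
      refine (ih (by omega)).tail ⟨⟨hu, (Nat.count_le _).trans_lt hu⟩, rfl, ?_⟩
      simp only [Nat.count_succ]
      by_cases h : P u
      · exact .inl ⟨by rw [if_pos h], h⟩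
      · exact .inr ⟨by rw [if_neg h, add_zero], (hP u hu).resolve_left h⟩
  exact this _ (by omega)

open Classical in
/-- Knowing how many elements a set has, one may verify that all of them satisfy `Q`. -/
theorem tally_iff_forall {P Q : ℕ → Prop} (hN : 0 < N) (hP : ∀ u, P u → u + 1 < N) :
    Tally N (fun u => P u ∧ Q u) (fun _ => True) (Nat.count P (N - 1)) ↔ ∀ u, P u → Q u := by
  constructor
  · intro h u hu
    have := h.le_count
    by_contra hQ
    refine absurd this (not_le.2 ?_)
    · simp only [Nat.count_eq_card_filter_range]
      refine Finset.card_lt_card (Finset.ssubset_iff_of_subset ?_ |>.2 ⟨u, ?_, ?_⟩)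
      · intro v
        simp +contextual
      · have := hP u hu
        simp only [Finset.mem_filter, Finset.mem_range]
        exact ⟨by omega, hu⟩
      · simp [hQ]
  · intro h
    have : (fun u => P u ∧ Q u) = P := by
      funext u
      exact propext ⟨fun h => h.1, fun hu => ⟨hu, h u hu⟩⟩
    rw [this]
    exact tally_count hN fun _ _ => .inr trivial

open Classical in
theorem within_of_reflTransGen {K : ℕ} (hs : s < K) (hE : ∀ u v, E u v → v < K) {v : ℕ}
    (h : Relation.ReflTransGen E s v) : Within E s K v := by
  have closed : ∃ d ≤ K, ∀ u v, Within E s d u → E u v → Within E s d v := by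
    by_contra hc
    push Not at hc
    have grow : ∀ d ≤ K, d + 1 ≤ Nat.count (Within E s d) K := by
      intro d hd
      induction d with
      | zero =>
        rw [Nat.count_eq_card_filter_range]
        exact Finset.card_pos.2 ⟨s, by simpa using ⟨hs, rfl⟩⟩
      | succ d ih =>
        obtain ⟨u, v, h1, h2, h3⟩ := hc d (by omega)
        refine (Nat.succ_le_succ (ih (by omega))).trans ?_
        rw [Nat.succ_le_iff]
        simp only [Nat.count_eq_card_filter_range]
        refine Finset.card_lt_card (Finset.ssubset_iff_of_subset ?_ |>.2 ⟨v, ?_, ?_⟩)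
        · intro w
          simp only [Finset.mem_filter]
          exact fun hw => ⟨hw.1, .inl hw.2⟩
        · simpa using ⟨hE _ _ h2, .inr ⟨u, h1, h2⟩⟩
        · simp [h3]
    have := grow K le_rfl
    have := Nat.count_le (p := Within E s K) (n := K)
    omega
  obtain ⟨d, hd, hc⟩ := closed
  refine Within.mono hd ?_
  induction h with
  | refl => exact Within.mono (Nat.zero_le d) (rfl : s = s)
  | tail _ h ih => exact hc _ _ ih h

/-- All vertices within distance `d` of `s` satisfy `Q`, provided that there are `r` of them. -/
def AllWithin (N : ℕ) (E : ℕ → ℕ → Prop) (s d r : ℕ) (Q : ℕ → Prop) : Prop :=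
  Tally N (fun u => Within E s d u ∧ Q u) (fun _ => True) r

/-- Counting the vertices within distance `d` for larger and larger `d`. -/
def Census (N : ℕ) (E : ℕ → ℕ → Prop) (s r : ℕ) : Prop :=
  Relation.ReflTransGen (fun p q : ℕ × ℕ => (q.1 < N ∧ q.2 < N) ∧ q.1 = p.1 + 1 ∧
    Tally N (Within E s q.1) (fun v => AllWithin N E s p.1 p.2 fun u => u ≠ v ∧ ¬ E u v) q.2)
    (0, 1) (N - 1, r)

open Classical in
theorem allWithin_iff (hs : s + 1 < N) (hE : ∀ u v, E u v → v + 1 < N) {d : ℕ} {Q : ℕ → Prop} :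
    AllWithin N E s d (Nat.count (Within E s d) (N - 1)) Q ↔ ∀ u, Within E s d u → Q u :=
  tally_iff_forall (by omega) fun u hu => by
    have := hu.lt (K := N - 1) (by omega) (fun u v h => by have := hE u v h; omega)
    omega

open Classical in
theorem census_iff (hs : s + 1 < N) (hE : ∀ u v, E u v → v + 1 < N) {r : ℕ} :
    Census N E s r ↔ r = Nat.count (Within E s (N - 1)) (N - 1) := by
  have hAll : ∀ d v, AllWithin N E s d (Nat.count (Within E s d) (N - 1))
      (fun u => u ≠ v ∧ ¬ E u v) ↔ ¬ Within E s (d + 1) v := by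
    intro d v
    rw [allWithin_iff hs hE]
    constructor
    · rintro h (h1 | ⟨u, hu, h1⟩)
      · exact (h v h1).1 rfl
      · exact (h u hu).2 h1
    · intro h u hu
      refine ⟨?_, fun h1 => h (.inr ⟨u, hu, h1⟩)⟩
      rintro rfl
      exact h (.inl hu)
  have hzero : Nat.count (Within E s 0) (N - 1) = 1 := by
    rw [Nat.count_eq_card_filter_range, Finset.card_eq_one]
    refine ⟨s, ?_⟩
    ext v
    rw [Finset.mem_filter, Finset.mem_range, Finset.mem_singleton]
    change _ ∧ v = s ↔ v = s
    constructor
    · exact fun h => h.2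
    · intro h
      exact ⟨by omega, h⟩
  constructor
  · intro h
    suffices ∀ q : ℕ × ℕ, Relation.ReflTransGen _ (0, 1) q →
      q.2 = Nat.count (Within E s q.1) (N - 1) from this _ h
    intro q h
    induction h with
    | refl => exact hzero.symm
    | tail _ h ih =>
      obtain ⟨-, h1, h2⟩ := h
      refine h2.eq_count fun u _ h3 => ?_
      rw [ih, hAll] at h3
      rwa [h1]
  · rintro rfl
    have : ∀ d < N, Relation.ReflTransGen (fun p q : ℕ × ℕ => (q.1 < N ∧ q.2 < N) ∧
        q.1 = p.1 + 1 ∧ Tally N (Within E s q.1)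
          (fun v => AllWithin N E s p.1 p.2 fun u => u ≠ v ∧ ¬ E u v) q.2)
        (0, 1) (d, Nat.count (Within E s d) (N - 1)) := by
      intro d hd
      induction d with
      | zero => rw [hzero]
      | succ d ih =>
        refine (ih (by omega)).tail
          ⟨⟨hd, (Nat.count_le _).trans_lt (by omega)⟩, rfl, tally_count (by omega) fun u _ => ?_⟩
        simp only [hAll]
        exact Classical.em _
    exact this _ (by omega)

theorem forall_reachable_iff (hs : s + 1 < N) (hE : ∀ u v, E u v → v + 1 < N) {Q : ℕ → Prop} :
    (∀ u, Relation.ReflTransGen E s u → Q u) ↔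
      ∃ r < N, Census N E s r ∧ AllWithin N E s (N - 1) r Q := by
  classical
  simp only [census_iff hs hE]
  have hc := Nat.count_le (p := Within E s (N - 1)) (n := N - 1)
  constructor
  · intro h
    exact ⟨_, by omega, rfl, (allWithin_iff hs hE).2 fun u hu => h u hu.reflTransGen⟩
  · rintro ⟨_, -, rfl, h⟩ u hu
    exact (allWithin_iff hs hE).1 h u (within_of_reflTransGen (by omega)
      (fun u v h => by have := hE u v h; omega) hu)

end Counting

namespace PositiveLogic

variable {W : Type} {L : PositiveLogic W} {V : Type}

theorem HasOrder.within (hL : L.HasOrder) {E : W → ℕ → ℕ → Prop} {s : W → ℕ}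
    (hE : ∀ {V : Type} (a b : V), L.Def (fun x c => E x (c a) (c b)))
    (hs : ∀ {V : Type} (a : V), L.Def (fun x c => c a = s x))
    (hs' : ∀ x, s x < L.size x) (hE' : ∀ x u v, E x u v → v < L.size x) (a b : V) :
    L.Def (fun x c => Within (E x) (s x) (c a) (c b)) := by
  have h := L.exists_lt (P := fun x c s' => s' = s x ∧ ∃ z < L.size x, z = 0 ∧
      Relation.ReflTransGen (fun p q : ℕ × ℕ => (q.1 < L.size x ∧ q.2 < L.size x) ∧
        q.2 = p.2 + 1 ∧ (p.1 = q.1 ∨ E x p.1 q.1)) (s', z) (c b, c a))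
    (L.and (hs (V := V ⊕ Unit) (Sum.inr ())) (L.exists_lt (L.and (hL.zero (Sum.inr ()))
      (L.tc_pair (P := fun x c p q => q.2 = p.2 + 1 ∧ (p.1 = q.1 ∨ E x p.1 q.1))
        (L.and (hL.succ _ _) (L.or (hL.eq _ _) (hE _ _)))
        (Sum.inl (Sum.inr ())) (Sum.inr ()) (Sum.inl (Sum.inl b)) (Sum.inl (Sum.inl a))))))
  refine L.congr h fun x c hc => ?_
  rw [within_iff (hs' x) (hE' x) (hc a)]
  constructor
  · intro h
    exact ⟨_, hs' x, rfl, 0, L.size_pos x, rfl, h⟩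
  · rintro ⟨_, -, rfl, _, -, rfl, h⟩
    exact h

theorem HasOrder.tally (hL : L.HasOrder) {P P' : W → (V → ℕ) → ℕ → Prop}
    (hP : L.Def (fun x (c : V ⊕ Unit → ℕ) => P x (c ∘ Sum.inl) (c (Sum.inr ()))))
    (hP' : L.Def (fun x (c : V ⊕ Unit → ℕ) => P' x (c ∘ Sum.inl) (c (Sum.inr ())))) (a : V) :
    L.Def (fun x c => Tally (L.size x) (P x c) (P' x c) (c a)) := by
  have hat : ∀ {P : W → (V → ℕ) → ℕ → Prop},
      L.Def (fun x (c : V ⊕ Unit → ℕ) => P x (c ∘ Sum.inl) (c (Sum.inr ()))) →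
      L.Def (fun x (c : ((V ⊕ Unit) ⊕ Unit) ⊕ Bool ⊕ Bool → ℕ) =>
        P x (((c ∘ Sum.inl) ∘ Sum.inl) ∘ Sum.inl) (c (Sum.inr (Sum.inl false)))) := fun h =>
    L.subst (Sum.elim ((Sum.inl ∘ Sum.inl) ∘ Sum.inl) fun _ => Sum.inr (Sum.inl false)) h
  have h := L.exists_lt (P := fun x c z => z = 0 ∧ ∃ k < L.size x, k + 1 = L.size x ∧
      Relation.ReflTransGen (fun p q : ℕ × ℕ => (q.1 < L.size x ∧ q.2 < L.size x) ∧
        q.1 = p.1 + 1 ∧ (q.2 = p.2 + 1 ∧ P x c p.1 ∨ q.2 = p.2 ∧ P' x c p.1)) (z, z) (k, c a))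
    (L.and (hL.zero (V := V ⊕ Unit) (Sum.inr ())) (L.exists_lt (L.and (hL.max (Sum.inr ()))
      (L.tc_pair (P := fun x c p q => q.1 = p.1 + 1 ∧
          (q.2 = p.2 + 1 ∧ P x ((c ∘ Sum.inl) ∘ Sum.inl) p.1 ∨
            q.2 = p.2 ∧ P' x ((c ∘ Sum.inl) ∘ Sum.inl) p.1))
        (L.and (hL.succ _ _) (L.or (L.and (hL.succ _ _) (hat hP)) (L.and (hL.eq _ _) (hat hP'))))
        (Sum.inl (Sum.inr ())) (Sum.inl (Sum.inr ())) (Sum.inr ()) (Sum.inl (Sum.inl a))))))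
  refine L.congr h fun x c hc => ?_
  have := L.size_pos x
  constructor
  · intro h
    exact ⟨0, this, rfl, L.size x - 1, by omega, by omega, h⟩
  · rintro ⟨_, -, rfl, k, -, hk, h⟩
    obtain rfl : k = L.size x - 1 := by omega
    exact h

/-- Inductive counting: definable predicates can say that everything reachable is in some set. -/
theorem HasOrder.forall_reachable (hL : L.HasOrder) {E : W → ℕ → ℕ → Prop} {s : W → ℕ}
    {Q : W → ℕ → Prop} (hE : ∀ {V : Type} (a b : V), L.Decides (fun x c => E x (c a) (c b)))
    (hs : ∀ {V : Type} (a : V), L.Def (fun x c => c a = s x))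
    (hQ : ∀ {V : Type} (a : V), L.Def (fun x c => Q x (c a)))
    (hs' : ∀ x, s x + 1 < L.size x) (hE' : ∀ x u v, E x u v → v + 1 < L.size x) :
    L.Def (fun x (_ : V → ℕ) => ∀ u, Relation.ReflTransGen (E x) (s x) u → Q x u) := by
  have hW : ∀ {V : Type} (a b : V), L.Def (fun x c => Within (E x) (s x) (c a) (c b)) :=
    fun a b => hL.within (fun a b => (hE a b).1) hs (fun x => (Nat.lt_succ_self _).trans (hs' x))
      (fun x u v h => (Nat.lt_succ_self _).trans (hE' x u v h)) a b
  have hA : ∀ {V : Type} (R : W → (V → ℕ) → ℕ → Prop) (_ : L.Def (fun x (c : V ⊕ Unit → ℕ) =>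
      R x (c ∘ Sum.inl) (c (Sum.inr ())))) (a b : V),
      L.Def (fun x c => AllWithin (L.size x) (E x) (s x) (c a) (c b) (R x c)) := fun R h a b =>
    hL.tally (P := fun x c u => Within (E x) (s x) (c a) u ∧ R x c u) (P' := fun _ _ _ => True)
      (L.and (hW (Sum.inl a) (Sum.inr ())) h) (L.const True) b
  have hT : ∀ {V : Type} (d r d' r' : V), L.Def (fun x c => Tally (L.size x)
      (Within (E x) (s x) (c d')) (fun v => AllWithin (L.size x) (E x) (s x) (c d) (c r)
        fun u => u ≠ v ∧ ¬ E x u v) (c r')) := fun d r d' r' =>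
    hL.tally (P := fun x c u => Within (E x) (s x) (c d') u)
      (P' := fun x c v => AllWithin (L.size x) (E x) (s x) (c d) (c r) fun u => u ≠ v ∧ ¬ E x u v)
      (hW (Sum.inl d') (Sum.inr ()))
      (hA (fun x c u => u ≠ c (Sum.inr ()) ∧ ¬ E x u (c (Sum.inr ())))
        (L.and (hL.ne _ _) (hE _ _).2) (Sum.inl d) (Sum.inl r)) r'
  have hC := fun {V : Type} (z o k r : V) => L.tc_pair (P := fun x (c : V → ℕ) p q =>
    q.1 = p.1 + 1 ∧ Tally (L.size x) (Within (E x) (s x) q.1)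
      (fun v => AllWithin (L.size x) (E x) (s x) p.1 p.2 fun u => u ≠ v ∧ ¬ E x u v) q.2)
    (L.and (hL.succ _ _) (hT _ _ _ _)) z o k r
  have h := L.exists_lt (P := fun x (c : V → ℕ) r => ∃ k < L.size x, k + 1 = L.size x ∧
      ∃ z < L.size x, z = 0 ∧ ∃ o < L.size x, o = 1 ∧ Relation.ReflTransGen _ (z, o) (k, r) ∧
        AllWithin (L.size x) (E x) (s x) k r (Q x))
    (L.exists_lt (L.and (hL.max (Sum.inr ())) (L.exists_lt (L.and (hL.zero (Sum.inr ()))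
      (L.exists_lt (L.and (hL.const 1 (Sum.inr ())) (L.and
        (hC (Sum.inl (Sum.inr ())) (Sum.inr ()) (Sum.inl (Sum.inl (Sum.inr ())))
          (Sum.inl (Sum.inl (Sum.inl (Sum.inr ())))))
        (hA (fun x _ => Q x) (hQ (Sum.inr ())) (Sum.inl (Sum.inl (Sum.inr ())))
          (Sum.inl (Sum.inl (Sum.inl (Sum.inr ()))))))))))))
  refine L.congr h fun x c hc => ?_
  rw [forall_reachable_iff (hs' x) (hE' x)]
  have := hs' x
  constructor
  · rintro ⟨r, hr, h1, h2⟩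
    exact ⟨r, hr, L.size x - 1, by omega, by omega, 0, by omega, rfl, 1, by omega, rfl, h1, h2⟩
  · rintro ⟨r, hr, k, -, hk, _, -, rfl, _, -, rfl, h1, h2⟩
    obtain rfl : k = L.size x - 1 := by omega
    exact ⟨r, hr, h1, h2⟩

end PositiveLogic

/-- The features of a pair of positions `a`, `b` shown in the transition table of an automaton with
`m` heads. -/
inductive TableFeature (m : ℕ)
  | arrow (t : (Fin m → Option Bool) × Fin m × Bool)
  | diagonal
  | successor
  | zero
  | last
  | initial
  | rejecting
  | state
  | period

namespace TableFeature

variable {m : ℕ}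

instance : Finite (TableFeature m) := by
  refine Finite.of_surjective (Sum.elim arrow ![diagonal, successor, zero, last, initial,
    rejecting, state, period]) fun f => ?_
  cases f with
  | arrow t => exact ⟨Sum.inl t, rfl⟩
  | diagonal => exact ⟨Sum.inr 0, rfl⟩
  | successor => exact ⟨Sum.inr 1, rfl⟩
  | zero => exact ⟨Sum.inr 2, rfl⟩
  | last => exact ⟨Sum.inr 3, rfl⟩
  | initial => exact ⟨Sum.inr 4, rfl⟩
  | rejecting => exact ⟨Sum.inr 5, rfl⟩
  | state => exact ⟨Sum.inr 6, rfl⟩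
  | period => exact ⟨Sum.inr 7, rfl⟩

end TableFeature

namespace TwoWayAutomaton

variable {m : ℕ}

/-- The side of the transition table of `x`: there is space for all states and for all offsets in
the words by which `table` presents cells. -/
noncomputable def side (x : TwoWayAutomaton m) : ℕ :=
  x.n + (Nat.card (Set (TableFeature m) × Prop × Prop × Prop) + 1)

theorem side_pos (x : TwoWayAutomaton m) : 0 < x.side := by
  unfold side; omega

/-- The pair of positions `a`, `b` has the given feature. -/
def HasFeature (x : TwoWayAutomaton m) (a b : ℕ) : TableFeature m → Prop
  | .arrow t => ∃ q q' : Fin x.n, a = q ∧ b = q' ∧ ((t.1, q), (t.2, q')) ∈ x.trans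
  | .diagonal => a = b
  | .successor => b = a + 1
  | .zero => b = 0
  | .last => b + 1 = x.side
  | .initial => b = x.init
  | .rejecting => b = x.reject
  | .state => b < x.n
  | .period => x.side * a + b = x.side

/-- The transition tables of automata, row after row. -/
noncomputable def table (m : ℕ) : LabelledCycle (TwoWayAutomaton m) where
  Γ := Set (TableFeature m)
  finite := inferInstance
  size x := x.side * x.side
  size_pos x := Nat.mul_pos x.side_pos x.side_pos
  lab x p := {f | x.HasFeature (p / x.side) (p % x.side) f}

theorem width_table_lt (x : TwoWayAutomaton m) : (table m).width < x.side :=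
  Nat.lt_add_of_pos_left (Nat.zero_lt_of_lt x.init.isLt)

/-- The cell in row `a` and column `b` of the transition table. -/
noncomputable def cell (x : TwoWayAutomaton m) (a b : ℕ) : ℕ := x.side * a + b

theorem cell_div (x : TwoWayAutomaton m) {a b : ℕ} (hb : b < x.side) : x.cell a b / x.side = a := by
  rw [cell, Nat.mul_add_div x.side_pos, Nat.div_eq_of_lt hb, add_zero]

theorem cell_mod (x : TwoWayAutomaton m) {a b : ℕ} (hb : b < x.side) : x.cell a b % x.side = b := by
  rw [cell, Nat.mul_add_mod, Nat.mod_eq_of_lt hb]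

theorem cell_div_mod (x : TwoWayAutomaton m) (p : ℕ) : x.cell (p / x.side) (p % x.side) = p :=
  Nat.div_add_mod p x.side

theorem cell_lt (x : TwoWayAutomaton m) {a b : ℕ} (ha : a < x.side) (hb : b < x.side) :
    x.cell a b < (table m).size x := by
  have := Nat.mul_le_mul_left x.side (Nat.succ_le_of_lt ha)
  rw [Nat.mul_succ] at this
  simp only [cell, table]
  omega

theorem cell_eq_iff (x : TwoWayAutomaton m) {a b a' b' : ℕ} (hb : b < x.side) (hb' : b' < x.side) :
    x.cell a b = x.cell a' b' ↔ a = a' ∧ b = b' := by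
  refine ⟨fun h => ⟨?_, ?_⟩, fun h => by rw [h.1, h.2]⟩
  · rw [← x.cell_div (a := a) hb, h, x.cell_div hb']
  · rw [← x.cell_mod (a := a) hb, h, x.cell_mod hb']

theorem cell_eq_succ_iff (x : TwoWayAutomaton m) {a b a' b' : ℕ} (hb : b < x.side)
    (hb' : b' < x.side) : x.cell a' b' = x.cell a b + 1 ↔
      (a' = a ∧ b' = b + 1) ∨ (b + 1 = x.side ∧ b' = 0 ∧ a' = a + 1) := by
  rcases Nat.lt_or_ge (b + 1) x.side with h | h
  · rw [show x.cell a b + 1 = x.cell a (b + 1) from rfl, x.cell_eq_iff hb' h]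
    omega
  · have h : b + 1 = x.side := by omega
    have : x.cell a b + 1 = x.cell (a + 1) 0 := by
      simp only [cell, Nat.mul_succ]
      omega
    rw [this, x.cell_eq_iff hb' x.side_pos]
    omega

/-- The features seen at a cell. -/
def features (g : (table m).Full) : Set (TableFeature m) := g.1

theorem mem_features (x : TwoWayAutomaton m) {a b : ℕ} (hb : b < x.side) (f : TableFeature m) :
    f ∈ features ((table m).full x (x.cell a b)) ↔ x.HasFeature a b f := by
  change x.HasFeature (x.cell a b / x.side) (x.cell a b % x.side) f ↔ _
  rw [x.cell_div hb, x.cell_mod hb]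

/-- Transition tables of automata. -/
noncomputable def square (m : ℕ) : LabelledSquare (TwoWayAutomaton m) where
  Γ := (table m).Full
  size := side
  size_pos := side_pos
  lab x a b := (table m).full x (x.cell a b)
  diag := {g | TableFeature.diagonal ∈ features g}
  lab_mem_diag x _ _ _ hb := x.mem_features hb .diagonal

/-- The logic of transition tables. -/
noncomputable abbrev tableLogic (m : ℕ) : PositiveLogic (TwoWayAutomaton m) := (square m).logic

variable {V : Type}

theorem decides_full (a b : V) (T : Set (table m).Full) :
    (tableLogic m).Decides (fun x c => (table m).full x (x.cell (c a) (c b)) ∈ T) :=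
  ⟨LabelledSquare.testable_lab (B := square m) a b T,
    LabelledSquare.testable_lab (B := square m) a b Tᶜ⟩

theorem decides_feature (a b : V) (f : TableFeature m) :
    (tableLogic m).Decides (fun x c => x.HasFeature (c a) (c b) f) :=
  (decides_full a b {g | f ∈ features g}).congr fun x _ hc =>
    (x.mem_features (hc b) f).symm

theorem hasOrder_tableLogic : (tableLogic m).HasOrder where
  eq a b := (decides_feature a b .diagonal).1
  ne a b := (decides_feature a b .diagonal).2
  zero a := (decides_feature a a .zero).1
  max a := (decides_feature a a .last).1
  succ a b := (decides_feature a b .successor).1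

theorem decides_cell_eq (a b a' b' : V) :
    (tableLogic m).Decides (fun x c => x.cell (c a') (c b') = x.cell (c a) (c b)) :=
  ((hasOrder_tableLogic.decides_eq a' a).and (hasOrder_tableLogic.decides_eq b' b)).congr
    fun x _ hc => x.cell_eq_iff (hc b') (hc b)

theorem decides_cell_succ (a b a' b' : V) :
    (tableLogic m).Decides (fun x c => x.cell (c a') (c b') = x.cell (c a) (c b) + 1) :=
  have h := hasOrder_tableLogic (m := m)
  (((h.decides_eq a' a).and (h.decides_succ b b')).or ((h.decides_max b).and
    ((h.decides_zero b').and (h.decides_succ a a')))).congr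
    fun x _ hc => x.cell_eq_succ_iff (hc b) (hc b')

theorem decides_cell_zero (a b : V) :
    (tableLogic m).Decides (fun x c => x.cell (c a) (c b) = 0) :=
  decides_full a b {g | g.2.1}

theorem decides_cell_max (a b : V) :
    (tableLogic m).Decides (fun x c => x.cell (c a) (c b) + 1 = (table m).size x) :=
  decides_full a b {g | g.2.2.2}

open LabelledCycle in
theorem decides_right {l : ℕ} (i : Fin l) (o o' : Fin l → Fin (table m).width)
    (a b a' b' : Fin l → V) :
    (tableLogic m).Decides (fun x c => Right i o o' x (fun j => x.cell (c (a j)) (c (b j)))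
      (fun j => x.cell (c (a' j)) (c (b' j)))) := by
  have h0 : (tableLogic m).Decides (fun x c => (fun j => x.cell (c (a j)) (c (b j))) =
      (fun j => x.cell (c (a' j)) (c (b' j)))) :=
    (PositiveLogic.Decides.forall_finite fun j =>
      decides_cell_eq (a' j) (b' j) (a j) (b j)).congr fun _ _ _ => funext_iff
  have h1 : (tableLogic m).Decides (fun x c => (fun j => x.cell (c (a' j)) (c (b' j))) =
      Function.update (fun j => x.cell (c (a j)) (c (b j))) i
        (x.cell (c (a i)) (c (b i)) + 1)) := by
    refine (PositiveLogic.Decides.forall_finite (P := fun j x c => x.cell (c (a' j)) (c (b' j)) =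
      if j = i then x.cell (c (a i)) (c (b i)) + 1 else x.cell (c (a j)) (c (b j)))
      fun j => ?_).congr fun _ _ _ => by
        simp only [funext_iff, Function.update_apply]
    split_ifs
    · exact decides_cell_succ _ _ _ _
    · exact decides_cell_eq _ _ _ _
  have h2 : (tableLogic m).Decides (fun x c => (fun j => x.cell (c (a' j)) (c (b' j))) =
      Function.update (fun j => x.cell (c (a j)) (c (b j))) i 0) := by
    refine (PositiveLogic.Decides.forall_finite (P := fun j x c => x.cell (c (a' j)) (c (b' j)) =
      if j = i then 0 else x.cell (c (a j)) (c (b j)))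
      fun j => ?_).congr fun _ _ _ => by
        simp only [funext_iff, Function.update_apply]
    split_ifs
    · exact decides_cell_zero _ _
    · exact decides_cell_eq _ _ _ _
  refine (((PositiveLogic.Decides.const
    (∃ h : (o i : ℕ) + 1 < (table m).width, o' = Function.update o i ⟨o i + 1, h⟩)).and h0).or
    ((PositiveLogic.Decides.const ((o i : ℕ) + 1 = (table m).width ∧
      o' = Function.update o i ⟨0, width_pos⟩)).and (((decides_cell_max (a i) (b i)).not.and h1).or
      ((decides_cell_max (a i) (b i)).and h2)))).congr fun x c hc => ?_
  have := x.cell_lt (hc (a i)) (hc (b i))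
  have e1 : (¬ x.cell (c (a i)) (c (b i)) + 1 = (table m).size x) ↔
      x.cell (c (a i)) (c (b i)) + 1 < (table m).size x := by omega
  simp only [Right, exists_and_right, and_assoc, e1, this, true_and]

end TwoWayAutomaton

namespace TwoWayAutomaton

open LabelledCycle

variable {m : ℕ}

/-- Positions in the tuples which describe configurations: one for the state, and three for the row,
the column and the offset of each head. -/
abbrev Digit (m : ℕ) := Option (Fin m × Fin 3)

/-- States together with offsets. -/
abbrev Slice (x : TwoWayAutomaton m) := Fin x.n × (Fin m → Fin (table m).width)

/-- The digits of a configuration. -/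
noncomputable def digits (x : TwoWayAutomaton m) (f : x.Slice) (c : Fin m → ℕ) : Digit m → ℕ
  | none => f.1
  | some (j, 0) => c j / x.side
  | some (j, 1) => c j % x.side
  | some (j, 2) => f.2 j

noncomputable def slot (i : Digit m) : Fin (Fintype.card (Digit m)) := Fintype.equivFin _ i

/-- The number of a configuration. -/
noncomputable def number (x : TwoWayAutomaton m) (f : x.Slice) (c : Fin m → ℕ) : ℕ :=
  posVal x.side fun i => x.digits f c ((Fintype.equivFin (Digit m)).symm i)

variable {x : TwoWayAutomaton m} {f g : x.Slice} {c d : Fin m → ℕ}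

theorem digits_lt (hc : ∀ j, c j < (table m).size x) (i : Digit m) : x.digits f c i < x.side := by
  have h1 : x.n < x.side := by unfold side; omega
  have h2 := width_table_lt x
  match i with
  | none => exact f.1.isLt.trans h1
  | some (j, 0) => exact Nat.div_lt_of_lt_mul (hc j)
  | some (j, 1) => exact Nat.mod_lt _ x.side_pos
  | some (j, 2) => exact (f.2 j).isLt.trans h2

theorem posVal_eq_number_iff (hc : ∀ j, c j < (table m).size x)
    {y : Fin (Fintype.card (Digit m)) → ℕ} (hy : ∀ i, y i < x.side) :
    posVal x.side y = x.number f c ↔ y (slot none) = f.1 ∧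
      (∀ j, y (slot (some (j, 2))) = f.2 j) ∧
      ∀ j, x.cell (y (slot (some (j, 0)))) (y (slot (some (j, 1)))) = c j := by
  have : posVal x.side y = x.number f c ↔ ∀ i, y (slot i) = x.digits f c i := by
    constructor
    · intro h i
      simp only [posVal_injective hy (fun i => digits_lt hc _) h, slot, Equiv.symm_apply_apply]
    · intro h
      unfold number
      congr 1
      funext i
      rw [← h, slot, Equiv.apply_symm_apply]
  rw [this]
  constructor
  · intro h
    refine ⟨h none, fun j => h (some (j, 2)), fun j => ?_⟩
    rw [h, h]
    exact x.cell_div_mod _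
  · rintro ⟨h1, h2, h3⟩ i
    match i with
    | none => exact h1
    | some (j, 0) => exact (x.cell_div (hy _)).symm.trans (congrArg (· / x.side) (h3 j))
    | some (j, 1) => exact (x.cell_mod (hy _)).symm.trans (congrArg (· % x.side) (h3 j))
    | some (j, 2) => exact h2 j

theorem number_injective (hc : ∀ j, c j < (table m).size x) (hd : ∀ j, d j < (table m).size x)
    (h : x.number f c = x.number g d) : f = g ∧ c = d := by
  have h1 := (posVal_eq_number_iff hc (fun i => digits_lt hc _)).1 (rfl : x.number f c = _)
  have h2 := (posVal_eq_number_iff hd (fun i => digits_lt hc _)).1 h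
  exact ⟨Prod.ext (Fin.ext (h1.1.symm.trans h2.1))
    (funext fun j => Fin.ext ((h1.2.1 j).symm.trans (h2.2.1 j))),
    funext fun j => (h1.2.2 j).symm.trans (h2.2.2 j)⟩

/-- The numbers `u`, `v` stand for configurations of `x`, the second of which succeeds the first in
the computation of `x` on its own transition table. -/
def Edge (x : TwoWayAutomaton m) (u v : ℕ) : Prop :=
  ∃ (f g : x.Slice) (c d : Fin m → ℕ),
    ((∀ j, c j < (table m).size x) ∧ ∀ j, d j < (table m).size x) ∧
    (u = x.number f c ∧ v = x.number g d) ∧ SlicedStep x f g x c d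

/-- The number of the initial configuration. -/
noncomputable def start (x : TwoWayAutomaton m) : ℕ :=
  x.number (x.init, fun _ => ⟨0, width_pos⟩) fun _ => 0

/-- The number `u` does not stand for a rejecting configuration of `x`. -/
def NotRejecting (x : TwoWayAutomaton m) (u : ℕ) : Prop :=
  ∀ (f : x.Slice) (c : Fin m → ℕ), (∀ j, c j < (table m).size x) → u = x.number f c →
    f.1 ≠ x.reject

theorem accepts_table_iff (x : TwoWayAutomaton m) : Accepts x ((table m).word x) ↔
    ∀ u, Relation.ReflTransGen x.Edge x.start u → x.NotRejecting u := by
  have h0 : ∀ j : Fin m, (fun _ => 0 : Fin m → ℕ) j < (table m).size x :=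
    fun _ => (table m).size_pos x
  have hp0 : place x (fun _ => 0) (fun _ => ⟨0, width_pos⟩) =
      (fun _ => 0 : Fin m → ZMod (((table m).word x).length + 1)) := by
    funext j; simp [place]
  constructor
  · intro h u hu
    have key : ∃ (f : x.Slice) (c : Fin m → ℕ), (∀ j, c j < (table m).size x) ∧
        u = x.number f c ∧ Relation.ReflTransGen (Step x ((table m).word x)) (fun _ => 0, x.init)
          (place x c f.2, f.1) := by
      induction hu with
      | refl =>
        refine ⟨_, _, h0, rfl, ?_⟩
        rw [hp0]
      | tail _ hs ih =>
        obtain ⟨f, c, hc, rfl, ih⟩ := ih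
        obtain ⟨f', g, c', d, ⟨hc', hd⟩, ⟨h1, rfl⟩, h2⟩ := hs
        obtain ⟨rfl, rfl⟩ := number_injective hc hc' h1
        exact ⟨g, d, hd, rfl, ih.tail ((slicedStep_iff hc hd).1 h2)⟩
    obtain ⟨f, c, hc, rfl, hr⟩ := key
    intro g d hd h1 h2
    obtain ⟨rfl, rfl⟩ := number_injective hc hd h1
    exact h ⟨_, hr, h2⟩
  · rintro h ⟨p, hp, hr⟩
    have key : ∃ (f : x.Slice) (c : Fin m → ℕ), (∀ j, c j < (table m).size x) ∧
        (place x c f.2, f.1) = p ∧ Relation.ReflTransGen x.Edge x.start (x.number f c) := by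
      clear hr
      induction hp with
      | refl => exact ⟨(x.init, fun _ => ⟨0, width_pos⟩), fun _ => 0, h0, by rw [hp0], .refl⟩
      | @tail p p' _ hs ih =>
        obtain ⟨f, c, hc, rfl, ih⟩ := ih
        obtain ⟨d, o, hd, h1⟩ := place_surjective x p'.1
        have h2 : (place x d o, p'.2) = p' := Prod.ext h1 rfl
        refine ⟨(p'.2, o), d, hd, h2, ih.tail ⟨f, (p'.2, o), c, d, ⟨hc, hd⟩, ⟨rfl, rfl⟩, ?_⟩⟩
        refine (slicedStep_iff hc hd).2 ?_
        rw [h2]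
        exact hs
    obtain ⟨f, c, hc, rfl, hu⟩ := key
    exact h _ hu f c hc rfl hr

variable {V : Type}

theorem decides_edge (a b : V) : ((tableLogic m).pow (Fintype.card (Digit m))).Decides
    (fun x c => x.Edge (c a) (c b)) := by
  have key : (tableLogic m).Decides (V := V × Fin (Fintype.card (Digit m))) (fun x c =>
      ∃ (o o' : Fin m → Fin (table m).width) (t : (Fin m → Option Bool) × Fin m × Bool),
        ((∀ j, c (a, slot (some (j, 2))) = o j) ∧ ∀ j, c (b, slot (some (j, 2))) = o' j) ∧
        x.HasFeature (c (a, slot none)) (c (b, slot none)) (.arrow t) ∧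
        (∀ j, (table m).full x (x.cell (c (a, slot (some (j, 0)))) (c (a, slot (some (j, 1)))))
          ∈ {e | (table m).sym e (o j) = t.1 j}) ∧
        if t.2.2 then
          Right t.2.1 o o' x
            (fun j => x.cell (c (a, slot (some (j, 0)))) (c (a, slot (some (j, 1)))))
            (fun j => x.cell (c (b, slot (some (j, 0)))) (c (b, slot (some (j, 1)))))
        else
          Right t.2.1 o' o x
            (fun j => x.cell (c (b, slot (some (j, 0)))) (c (b, slot (some (j, 1)))))
            (fun j => x.cell (c (a, slot (some (j, 0)))) (c (a, slot (some (j, 1)))))) := by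
    refine .exists_finite fun o => .exists_finite fun o' => .exists_finite fun t => .and
      (.and (.forall_finite fun j => hasOrder_tableLogic.decides_const _ _)
        (.forall_finite fun j => hasOrder_tableLogic.decides_const _ _))
      (.and (decides_feature _ _ _) (.and (.forall_finite fun j => decides_full _ _ _) ?_))
    split_ifs
    · exact decides_right t.2.1 o o' _ _ _ _
    · exact decides_right t.2.1 o' o _ _ _ _
  have e : ∀ (x : TwoWayAutomaton m) (y z : Fin (Fintype.card (Digit m)) → ℕ),
      (∀ i, y i < x.side) → (∀ i, z i < x.side) →
      (x.Edge (posVal x.side y) (posVal x.side z) ↔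
      ∃ (o o' : Fin m → Fin (table m).width) (t : (Fin m → Option Bool) × Fin m × Bool),
        ((∀ j, y (slot (some (j, 2))) = o j) ∧ ∀ j, z (slot (some (j, 2))) = o' j) ∧
        x.HasFeature (y (slot none)) (z (slot none)) (.arrow t) ∧
        (∀ j, (table m).full x (x.cell (y (slot (some (j, 0)))) (y (slot (some (j, 1)))))
          ∈ {e | (table m).sym e (o j) = t.1 j}) ∧
        if t.2.2 then
          Right t.2.1 o o' x
            (fun j => x.cell (y (slot (some (j, 0)))) (y (slot (some (j, 1)))))
            (fun j => x.cell (z (slot (some (j, 0)))) (z (slot (some (j, 1)))))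
        else
          Right t.2.1 o' o x
            (fun j => x.cell (z (slot (some (j, 0)))) (z (slot (some (j, 1)))))
            (fun j => x.cell (y (slot (some (j, 0)))) (y (slot (some (j, 1)))))) := by
    intro x y z hy hz
    constructor
    · rintro ⟨f, g, c, d, ⟨hc, hd⟩, ⟨h1, h2⟩, t, h3, h4, h5⟩
      obtain ⟨h6, h7, h8⟩ := (posVal_eq_number_iff hc hy).1 h1
      obtain ⟨h6', h7', h8'⟩ := (posVal_eq_number_iff hd hz).1 h2
      simp only [h8, h8']
      exact ⟨f.2, g.2, t, ⟨h7, h7'⟩, ⟨f.1, g.1, h6, h6', h3⟩, h4, h5⟩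
    · rintro ⟨o, o', t, ⟨h1, h2⟩, ⟨q, q', h3, h4, h5⟩, h6, h7⟩
      have hc := fun j => x.cell_lt (hy (slot (some (j, 0)))) (hy (slot (some (j, 1))))
      have hd := fun j => x.cell_lt (hz (slot (some (j, 0)))) (hz (slot (some (j, 1))))
      exact ⟨(q, o), (q', o'), _, _, ⟨hc, hd⟩,
        ⟨(posVal_eq_number_iff hc hy).2 ⟨h3, h1, fun _ => rfl⟩,
          (posVal_eq_number_iff hd hz).2 ⟨h4, h2, fun _ => rfl⟩⟩, t, h5, h6, h7⟩
  exact key.congr fun x c hc => e x _ _ (fun i => hc (a, i)) (fun i => hc (b, i))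

theorem def_start (a : V) : ((tableLogic m).pow (Fintype.card (Digit m))).Def
    (fun x c => c a = x.start) := by
  have key : (tableLogic m).Decides (V := V × Fin (Fintype.card (Digit m))) (fun x c =>
      x.HasFeature (c (a, slot none)) (c (a, slot none)) .initial ∧
      (∀ j, c (a, slot (some (j, 2))) = 0) ∧
      ∀ j, x.cell (c (a, slot (some (j, 0)))) (c (a, slot (some (j, 1)))) = 0) :=
    .and (decides_feature _ _ _)
      (.and (.forall_finite fun j => hasOrder_tableLogic.decides_zero _)
        (.forall_finite fun j => decides_cell_zero _ _))
  exact (tableLogic m).congr key.1 fun x c hc =>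
    posVal_eq_number_iff (fun _ => (table m).size_pos x) fun i => hc (a, i)

theorem def_notRejecting (a : V) : ((tableLogic m).pow (Fintype.card (Digit m))).Def
    (fun x c => x.NotRejecting (c a)) := by
  have key : (tableLogic m).Decides (V := V × Fin (Fintype.card (Digit m))) (fun x c =>
      ¬ (x.HasFeature (c (a, slot none)) (c (a, slot none)) .rejecting ∧
        ∃ o : Fin m → Fin (table m).width, ∀ j, c (a, slot (some (j, 2))) = o j)) :=
    .not (.and (decides_feature _ _ _)
      (.exists_finite fun o => .forall_finite fun j => hasOrder_tableLogic.decides_const _ _))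
  have e : ∀ (x : TwoWayAutomaton m) (y : Fin (Fintype.card (Digit m)) → ℕ),
      (∀ i, y i < x.side) → (x.NotRejecting (posVal x.side y) ↔
      ¬ (x.HasFeature (y (slot none)) (y (slot none)) .rejecting ∧
        ∃ o : Fin m → Fin (table m).width, ∀ j, y (slot (some (j, 2))) = o j)) := by
    intro x y hy
    constructor
    · rintro h ⟨h1, o, h2⟩
      have hc := fun j => x.cell_lt (hy (slot (some (j, 0)))) (hy (slot (some (j, 1))))
      exact h (x.reject, o) _ hc ((posVal_eq_number_iff hc hy).2 ⟨h1, h2, fun _ => rfl⟩) rfl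
    · rintro h f c hc h1 h2
      obtain ⟨h3, h4, -⟩ := (posVal_eq_number_iff hc hy).1 h1
      exact h ⟨by rw [HasFeature, h3, h2], _, h4⟩
  exact (tableLogic m).congr key.1 fun x c hc => e x _ fun i => hc (a, i)

theorem number_succ_lt (hc : ∀ j, c j < (table m).size x) :
    x.number f c + 1 < x.side ^ Fintype.card (Digit m) := by
  have h1 := posVal_lt (m := x.side) (r := Fintype.card (Digit m)) fun i =>
    digits_lt (f := f) hc ((Fintype.equivFin (Digit m)).symm i)
  refine lt_of_le_of_ne h1 fun h2 => ?_
  have h3 := (posVal_eq_max_iff x.side_pos fun i => digits_lt (f := f) hc _).1 h2 (slot none)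
  rw [slot, Equiv.symm_apply_apply] at h3
  have h4 : (f.1 : ℕ) + 1 = x.side := h3
  have := f.1.isLt
  have := (table m).width_pos
  have := width_table_lt x
  unfold side at h4
  omega

/-- Whether an automaton accepts its own transition table is definable in that table. -/
theorem def_accepts_table : ((tableLogic m).pow (Fintype.card (Digit m))).Def
    (fun x (_ : Empty → ℕ) => Accepts x ((table m).word x)) :=
  PositiveLogic.congr _ ((hasOrder_tableLogic.pow _).forall_reachable decides_edge def_start
    def_notRejecting (fun x => number_succ_lt fun _ => (table m).size_pos x)
    (by
      rintro x u v ⟨f, g, c, d, ⟨-, hd⟩, ⟨-, rfl⟩, -⟩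
      exact number_succ_lt hd)) fun x _ _ => accepts_table_iff x

end TwoWayAutomaton

namespace Prog

/-- Pulling back the inputs along `f`. -/
theorem pullback {W W' A : Type} {P : Fam W A → Prop} (f : W' → W) {R : Fam W A} (h : Prog P R) :
    Prog (fun R' : Fam W' A => ∃ R, P R ∧ R' = fun x => R (f x)) (fun x => R (f x)) := by
  induction h with
  | base h => exact .base ⟨_, h, rfl⟩
  | idle => exact .idle
  | empty => exact .empty
  | comp _ _ h1 h2 => exact .comp h1 h2
  | union _ _ h1 h2 => exact .union h1 h2
  | star _ h => exact .star h

end Prog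

namespace LabelledCycle

variable {W ι : Type} [DecidableEq ι] {S : LabelledCycle W}

/-- Several heads can be moved simultaneously, if each of them can be moved. -/
theorem prog_shift_finset (b : ι) (τ : W → ℕ) (s : Finset ι) (hb : b ∉ s)
    (h : ∀ a ∈ s, Prog (S.Heads ι) (fun x c d => c b = 0 ∧ c a + τ x < S.size x ∧
      d = Function.update c a (c a + τ x))) :
    Prog (S.Heads ι) (fun x c d => c b = 0 ∧ (∀ a ∈ s, c a + τ x < S.size x) ∧
      d = fun a => if a ∈ s then c a + τ x else c a) := by
  induction s using Finset.induction_on with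
  | empty =>
    refine Prog.congr (test_zero (S := S) b) fun x c d => ?_
    simp [and_comm, eq_comm]
  | insert a s ha ih =>
    have hab : b ≠ a := fun e => hb (e ▸ Finset.mem_insert_self _ _)
    refine ((h a (Finset.mem_insert_self _ _)).comp (ih (fun h => hb (Finset.mem_insert_of_mem h))
      fun a' h' => h a' (Finset.mem_insert_of_mem h'))).congr fun x c d => ?_
    have e1 : ∀ a' ∈ s, Function.update c a (c a + τ x) a' = c a' := fun a' h' =>
      Function.update_of_ne (by rintro rfl; exact ha h') _ _
    have e2 : (fun a' => if a' ∈ insert a s then c a' + τ x else c a') = fun a' => if a' ∈ s then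
        Function.update c a (c a + τ x) a' + τ x else Function.update c a (c a + τ x) a' := by
      funext a'
      by_cases h1 : a' = a
      · subst h1
        simp [ha]
      · simp [h1]
    rw [e2]
    constructor
    · rintro ⟨h1, h2, rfl⟩
      refine ⟨_, ⟨h1, h2 _ (Finset.mem_insert_self _ _), rfl⟩, ?_, fun a' h' => ?_, rfl⟩
      · rwa [Function.update_of_ne hab]
      · rw [e1 a' h']
        exact h2 a' (Finset.mem_insert_of_mem h')
    · rintro ⟨e, ⟨h1, h2, rfl⟩, h3, h4, rfl⟩
      refine ⟨h1, fun a' h' => ?_, rfl⟩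
      rcases Finset.mem_insert.1 h' with rfl | h'
      · exact h2
      · have := h4 a' h'
        rwa [e1 a' h'] at this

end LabelledCycle

namespace TwoWayAutomaton

open LabelledCycle

variable {m : ℕ} {κ : Type} [DecidableEq κ] [Fintype κ]

/-- Heads which represent registers, with a spare head on the cell `0`. -/
noncomputable def encode (x : TwoWayAutomaton m) (z : κ → ℕ) : Option (κ × κ) → ℕ
  | none => 0
  | some (i, j) => x.cell (z i) (z j)

omit [Fintype κ] in
/-- The cell at the start of the second row is recognizable by its label. -/
theorem prog_shift_side (p : κ × κ) : Prog ((table m).Heads (Option (κ × κ))) (fun x c d =>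
    c none = 0 ∧ c (some p) + x.side < (table m).size x ∧
      d = Function.update c (some p) (c (some p) + x.side)) :=
  prog_shift (Option.some_ne_none p) {g | TableFeature.period ∈ features g} side side_pos
    fun x q _ => by
      change x.side * (q / x.side) + q % x.side = x.side ↔ _
      rw [Nat.div_add_mod]

/-- The increments of heads which represent the increment of the register `k`. -/
def Inc (k : κ) : Fam (TwoWayAutomaton m) (Option (κ × κ) → ℕ) := fun x c d =>
  (table m).full x (c (some (k, k))) ∈ {g | TableFeature.last ∉ features g} ∧
  ∃ e, (c none = 0 ∧ (∀ a ∈ Finset.univ.image (fun j => some (k, j)),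
      c a + x.side < (table m).size x) ∧
    e = fun a => if a ∈ Finset.univ.image (fun j => some (k, j)) then c a + x.side else c a) ∧
  (e none = 0 ∧ (∀ a ∈ Finset.univ.image (fun i => some (i, k)), e a + 1 < (table m).size x) ∧
    d = fun a => if a ∈ Finset.univ.image (fun i => some (i, k)) then e a + 1 else e a)

theorem prog_inc (k : κ) : Prog ((table m).Heads (Option (κ × κ))) (Inc k) := by
  refine Prog.guard (test_full _ _) (Prog.comp (prog_shift_finset none side _ (by simp) ?_)
    (prog_shift_finset none (fun _ => 1) _ (by simp) ?_))
  · intro a ha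
    obtain ⟨j, -, rfl⟩ := Finset.mem_image.1 ha
    exact prog_shift_side _
  · intro a _
    exact Prog.guard (test_zero none) (Prog.base (.inc a))

variable {x : TwoWayAutomaton m} {k : κ} {z : κ → ℕ}

theorem Inc.eq_add {c d : Option (κ × κ) → ℕ} (h : Inc k x c d) : c none = 0 ∧ d none = 0 ∧
    ∀ i j, d (some (i, j)) = c (some (i, j)) + (if i = k then x.side else 0) +
      if j = k then 1 else 0 := by
  obtain ⟨-, e, ⟨h1, -, rfl⟩, -, -, rfl⟩ := h
  refine ⟨h1, by simpa using h1, fun i j => ?_⟩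
  by_cases hi : i = k <;> by_cases hj : j = k <;> simp [hi, hj, @eq_comm _ k]

omit [Fintype κ] in
theorem cell_update (i j : κ) : x.cell (Function.update z k (z k + 1) i)
    (Function.update z k (z k + 1) j) = x.cell (z i) (z j) + (if i = k then x.side else 0) +
      if j = k then 1 else 0 := by
  by_cases hi : i = k <;> by_cases hj : j = k <;> simp [hi, hj, cell, Nat.mul_succ] <;> omega

theorem inc_encode (hz : ∀ i, z i < x.side) (hk : z k + 1 < x.side) :
    Inc k x (encode x z) (encode x (Function.update z k (z k + 1))) := by
  have hz' : ∀ i, Function.update z k (z k + 1) i < x.side :=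
    (forall_update_lt_iff (hz k) hk).2 hz
  refine ⟨fun h => ?_, _, ⟨rfl, ?_, rfl⟩, by simp [encode], ?_, ?_⟩
  · have := (x.mem_features (hz k) .last).1 h
    exact hk.ne this
  · intro a ha
    obtain ⟨j, -, rfl⟩ := Finset.mem_image.1 ha
    have := x.cell_lt hk (hz j)
    simp only [encode, cell, Nat.mul_succ] at this ⊢
    omega
  · intro a ha
    obtain ⟨i, -, rfl⟩ := Finset.mem_image.1 ha
    have := x.cell_lt (hz' i) (hz' k)
    rw [cell_update] at this
    by_cases hi : i = k
    · subst hi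
      simpa [encode] using this
    · simpa [encode, hi, Ne.symm hi] using this
  · funext a
    rcases a with _ | ⟨i, j⟩
    · simp [encode]
    · simp only [encode, cell_update]
      by_cases hi : i = k <;> by_cases hj : j = k <;> simp [hi, hj, @eq_comm _ k]

theorem inc_from (hz : ∀ i, z i < x.side) {d : Option (κ × κ) → ℕ} (h : Inc k x (encode x z) d) :
    z k + 1 < x.side ∧ d = encode x (Function.update z k (z k + 1)) := by
  obtain ⟨-, h0, h1⟩ := h.eq_add
  refine ⟨lt_of_le_of_ne (hz k) fun e => h.1 ((x.mem_features (hz k) .last).2 e), ?_⟩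
  funext a
  rcases a with _ | ⟨i, j⟩
  · exact h0
  · simp only [encode, cell_update, h1]

theorem inc_to (hz : ∀ i, z i < x.side) {c : Option (κ × κ) → ℕ} (h : Inc k x c (encode x z)) :
    ∃ y, (∀ i, y i < x.side) ∧ c = encode x y ∧ y k + 1 < x.side ∧
      z = Function.update y k (y k + 1) := by
  obtain ⟨h0, -, h1⟩ := h.eq_add
  have hk : z k ≠ 0 := by
    intro e
    have := h1 k k
    simp [encode, e, cell] at this
  have hy : z k - 1 < x.side := by have := hz k; omega
  have e : z = Function.update (Function.update z k (z k - 1)) k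
      (Function.update z k (z k - 1) k + 1) := by
    rw [Function.update_idem, Function.update_self, Nat.sub_add_cancel (Nat.pos_of_ne_zero hk),
      Function.update_eq_self]
  refine ⟨Function.update z k (z k - 1), (forall_update_lt_iff (hz k) hy).2 hz, ?_, ?_, e⟩
  · funext a
    rcases a with _ | ⟨i, j⟩
    · exact h0
    · have h2 := h1 i j
      have h3 := cell_update (x := x) (k := k) (z := Function.update z k (z k - 1)) i j
      rw [← e] at h3
      simp only [encode] at h2 ⊢
      omega
  · have := hz k
    simp only [Function.update_self]
    omega

/-- The representation of registers by heads. -/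
def Represents (x : TwoWayAutomaton m) (z : κ → ℕ) (c : Option (κ × κ) → ℕ) : Prop :=
  (∀ i, z i < x.side) ∧ c = encode x z

theorem simulates_assign (k : κ) : Simulates Represents
    (fun (x : TwoWayAutomaton m) z z' => ∃ t < x.side, z' = Function.update z k t)
    (fun x => Relation.ReflTransGen fun c d => Inc k x c d ∨ Inc k x d c) := by
  have h : Simulates Represents
      (fun (x : TwoWayAutomaton m) (z z' : κ → ℕ) =>
        ((∀ i, z i < x.side) ∧ z k + 1 < x.side ∧ z' = Function.update z k (z k + 1)) ∨
        ((∀ i, z' i < x.side) ∧ z' k + 1 < x.side ∧ z = Function.update z' k (z' k + 1)))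
      (fun x c d => Inc k x c d ∨ Inc k x d c) := by
    rintro x z _ ⟨hz, rfl⟩
    constructor
    · rintro z' (⟨-, h1, rfl⟩ | ⟨hz', h1, rfl⟩)
      · exact ⟨_, Or.inl (inc_encode hz h1), (forall_update_lt_iff (hz k) h1).2 hz, rfl⟩
      · exact ⟨_, Or.inr (inc_encode hz' h1), hz', rfl⟩
    · rintro d (h | h)
      · obtain ⟨h1, rfl⟩ := inc_from hz h
        exact ⟨_, Or.inl ⟨hz, h1, rfl⟩, (forall_update_lt_iff (hz k) h1).2 hz, rfl⟩
      · obtain ⟨y, hy, rfl, h1, h2⟩ := inc_to hz h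
        exact ⟨y, Or.inr ⟨hy, h1, h2⟩, hy, rfl⟩
  have hs := Prog.simulates_star h
  intro x z c hc
  have key : ∀ z', (∃ t < x.side, z' = Function.update z k t) ↔
      Relation.ReflTransGen (fun z z' : κ → ℕ =>
        ((∀ i, z i < x.side) ∧ z k + 1 < x.side ∧ z' = Function.update z k (z k + 1)) ∨
        ((∀ i, z' i < x.side) ∧ z' k + 1 < x.side ∧ z = Function.update z' k (z' k + 1))) z z' := by
    have hz := hc.1
    intro z'
    constructor
    · have hup : ∀ t, t < x.side → Relation.ReflTransGen (fun z z' : κ → ℕ =>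
          ((∀ i, z i < x.side) ∧ z k + 1 < x.side ∧ z' = Function.update z k (z k + 1)) ∨
          ((∀ i, z' i < x.side) ∧ z' k + 1 < x.side ∧ z = Function.update z' k (z' k + 1)))
          (Function.update z k 0) (Function.update z k t) := by
        intro t ht
        induction t with
        | zero => exact .refl
        | succ t ih =>
          refine (ih (by omega)).tail (Or.inl ⟨?_, ?_, ?_⟩)
          · exact (forall_update_lt_iff (hz k) (by omega)).2 hz
          · simpa using ht
          · simp
      rintro ⟨t, ht, rfl⟩
      refine Relation.ReflTransGen.trans ?_ (hup t ht)
      have := hup (z k) (hz k)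
      rw [Function.update_eq_self] at this
      exact (@Relation.ReflTransGen.stdSymm _ _ ⟨fun _ _ h => h.symm⟩).symm _ _ this
    · intro h
      induction h with
      | refl => exact ⟨z k, hz k, (Function.update_eq_self k z).symm⟩
      | tail _ h ih =>
        obtain ⟨t, ht, rfl⟩ := ih
        rcases h with ⟨-, h1, rfl⟩ | ⟨hy, h1, h2⟩
        · exact ⟨_, h1, by simp⟩
        · rename_i y _
          refine ⟨y k, hy k, ?_⟩
          funext i
          by_cases hi : i = k
          · simp [hi]
          · have := congrFun h2 i
            simpa [hi, eq_comm] using this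
  simp only [key]
  exact hs x z c hc

/-- Properties definable in the transition table of an automaton are recognized by machines on
it. -/
theorem recognizes_of_def {V : Type} [IsEmpty V] {P : TwoWayAutomaton m → Prop}
    (h : (tableLogic m).Def (fun x (_ : V → ℕ) => P x)) :
    ∃ n, (table m).Recognizes (Fin n) P := by
  obtain ⟨κ, _, _, R, hR, h⟩ := h
  have := Fintype.ofFinite κ
  have hR' := hR.pullback fun x : TwoWayAutomaton m => (x, (isEmptyElim : V → ℕ))
  obtain ⟨R', hR', hs⟩ := hR'.simulate (Φ := Represents)
    (Q := (table m).Heads (Option (κ × κ))) (by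
      rintro _ ⟨_, hE, rfl⟩
      cases hE with
      | assign k => exact ⟨_, ((prog_inc k).union (converse (prog_inc k))).star, simulates_assign k⟩
      | test i j T =>
        rcases i with v | i
        · exact isEmptyElim v
        rcases j with v | j
        · exact isEmptyElim v
        refine ⟨_, test_full (some (i, j)) T, ?_⟩
        rintro x z _ ⟨hz, rfl⟩
        constructor
        · rintro _ ⟨rfl, h⟩
          exact ⟨_, ⟨rfl, h⟩, hz, rfl⟩
        · rintro _ ⟨rfl, h⟩
          exact ⟨_, ⟨rfl, h⟩, hz, rfl⟩)
  refine ⟨Fintype.card (Option (κ × κ)), Recognizes.of_card_le (κ := Option (κ × κ))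
    ⟨R', hR', fun x => ?_⟩ (by simp)⟩
  have h0 : Represents x (fun _ : κ => 0) (fun _ => 0) := by
    refine ⟨fun _ => x.side_pos, ?_⟩
    funext a
    rcases a with _ | ⟨i, j⟩ <;> simp [encode, cell]
  refine (h x isEmptyElim (fun _ => 0) isEmptyElim fun _ => x.side_pos).trans ?_
  constructor
  · rintro ⟨d, hd⟩
    obtain ⟨e, he, -⟩ := (hs x _ _ h0).1 d hd
    exact ⟨e, he⟩
  · rintro ⟨d, hd⟩
    obtain ⟨e, he, -⟩ := (hs x _ _ h0).2 d hd
    exact ⟨e, he⟩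

/-- No machine with `m` heads recognizes the automata which accept their own transition table. -/
theorem not_recognizes_accepts_table (hm : m ≠ 0) :
    ¬ (table m).Recognizes (Fin m) (fun x => Accepts x ((table m).word x)) := by
  obtain ⟨m, rfl⟩ := Nat.exists_eq_succ_of_ne_zero hm
  intro h
  obtain ⟨M, hM⟩ := h.exists_automaton
  exact iff_not_self (hM M)

theorem not_co2NFA_subset {k : ℕ} (hk : 1 ≤ k) : ¬ co2NFA (k + 1) ⊆ co2NFA k := by
  intro H
  obtain ⟨n, h⟩ := recognizes_of_def (def_accepts_table (m := k * k * (k + 1)))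
  exact not_recognizes_accepts_table (by positivity)
    (h.collapse hk fun T L hL => hL.spare_head H)

end TwoWayAutomaton

namespace TwoWayAutomaton

/-- The automaton `M` with an additional head, which does not move. -/
def addHead {k : ℕ} (M : TwoWayAutomaton k) : TwoWayAutomaton (k + 1) where
  n := M.n
  init := M.init
  accept := M.accept
  reject := M.reject
  trans := {t | ∃ i, t.2.1.1 = Fin.succ i ∧
    ((fun j => t.1.1 j.succ, t.1.2), ((i, t.2.1.2), t.2.2)) ∈ M.trans}

theorem accepts_addHead {k : ℕ} (M : TwoWayAutomaton k) (w : List Bool) :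
    Accepts M.addHead w ↔ Accepts M w := by
  refine not_congr ⟨?_, ?_⟩
  · rintro ⟨c, hc, h⟩
    refine ⟨(fun j => c.1 j.succ, c.2), hc.lift (fun c => (fun j => c.1 (Fin.succ j), c.2)) ?_, h⟩
    rintro ⟨p, q⟩ _ ⟨s, _, d, q', ⟨i, rfl, ht⟩, hs, rfl⟩
    refine ⟨fun j => s j.succ, i, d, q', ht, fun j => hs _, Prod.ext (funext fun j => ?_) rfl⟩
    simp [Function.update_apply]
  · rintro ⟨c, hc, h⟩
    refine ⟨(Fin.cons 0 c.1, c.2), ?_, h⟩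
    have := hc.lift (p := Step M.addHead w)
      (fun c => ((Fin.cons 0 c.1 : Fin (k + 1) → ZMod (w.length + 1)), c.2)) ?_
    · convert this using 1
      refine Prod.ext (funext fun j => ?_) rfl
      cases j using Fin.cases <;> rfl
    · rintro ⟨p, q⟩ _ ⟨s, i, d, q', ht, hs, rfl⟩
      refine ⟨Fin.cons (symbolAt w 0) s, i.succ, d, q', ⟨i, rfl, ht⟩, fun j => ?_,
        Prod.ext (funext fun j => ?_) rfl⟩
      · cases j using Fin.cases with
        | zero => rfl
        | succ j => exact hs j
      · cases j using Fin.cases with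
        | zero => simp [(Fin.succ_ne_zero i).symm]
        | succ j => simp [Function.update_apply]

end TwoWayAutomaton

theorem co2NFA_subset_succ (k : ℕ) : co2NFA k ⊆ co2NFA (k + 1) := by
  rintro L ⟨M, hM⟩
  exact ⟨M.addHead, fun w => (hM w).trans (M.accepts_addHead w).symm⟩

/-- Monien's hierarchy theorem: for every `k ≥ 1`, the class `co2NFA(k)` is a strict
subset of `co2NFA(k+1)`: every language accepted by a two-way `k`-head automaton is
accepted by a two-way `(k+1)`-head automaton, and some language is accepted by a
two-way `(k+1)`-head automaton but by no two-way `k`-head automaton. -/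
theorem co2NFA_strict_hierarchy (k : ℕ) (hk : 1 ≤ k) :
    co2NFA k ⊆ co2NFA (k + 1) ∧
    ∃ L : Set (List Bool), L ∈ co2NFA (k + 1) ∧ L ∉ co2NFA k := by
  refine ⟨co2NFA_subset_succ k, ?_⟩
  by_contra! h
  exact TwoWayAutomaton.not_co2NFA_subset hk h
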